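/- Suppose n = p₁⋯p_{t₁}·q₁⋯q_{t₂} is a product of t₁ + t₂ ≥ 1 distinct primes, all congruent to 1 (mod 4) and coprime to l, with (p_i/l) = −1 for all i ∈ {1,…,t₁} and (q_j/l) = 1 for all j ∈ {1,…,t₂}. If (q_j/l)₄ ≠ (l/q_j)₄ for at least one j, then r₂(H) = t₁ + 2t₂ − 1; if (q_j/l)₄ = (l/q_j)₄ for all j (in particular when t₂ = 0), then r₂(H) = t₁ + 2t₂. -/

import Mathlib

/-- `ε` is the fundamental unit of the real quadratic field `ℚ(√l)` (viewed inside `ℝ`):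
it lies in `ℚ(√l)`, it is a unit of the ring of integers (both `ε` and `ε⁻¹` are
algebraic integers), `ε > 1`, and it is the smallest such unit. -/
def IsFundamentalUnit (l : ℕ) (ε : ℝ) : Prop :=
  1 < ε ∧ ε ∈ IntermediateField.adjoin ℚ ({Real.sqrt (l : ℝ)} : Set ℝ) ∧
    IsIntegral ℤ ε ∧ IsIntegral ℤ ε⁻¹ ∧
    ∀ x : ℝ, 1 < x → x ∈ IntermediateField.adjoin ℚ ({Real.sqrt (l : ℝ)} : Set ℝ) →
      IsIntegral ℤ x → IsIntegral ℤ x⁻¹ → ε ≤ x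

/-- The Legendre symbol `(a/p)`, via Euler's criterion (so that no `Fact p.Prime`
instance is needed): for an odd prime `p` it is `1` if `a` is a nonzero square mod `p`,
`0` if `p ∣ a`, and `-1` otherwise. -/
def legSym (p : ℕ) (a : ℤ) : ℤ :=
  if (a : ZMod p) ^ ((p - 1) / 2) = 1 then 1 else if (a : ZMod p) = 0 then 0 else -1

/-- The rational fourth power residue symbol `(a/p)₄ ∈ {±1}`, meaningful when
`(a/p) = 1`; it is determined by `(a/p)₄ ≡ a ^ ((p-1)/4) (mod p)`. -/
def quartSym (p : ℕ) (a : ℤ) : ℤ :=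
  if (a : ZMod p) ^ ((p - 1) / 4) = 1 then 1 else -1

/-- The cardinality of the 2-torsion subgroup of the class group of `K`.
For a number field `K` this equals `2 ^ r₂(H)`, where `r₂(H)` is the rank of the
2-class group `H` of `K` (i.e. `dim_{𝔽₂} Cl(K)/Cl(K)²`); in particular
`r₂(H) = r` iff this cardinality is `2 ^ r`. -/
noncomputable def twoTorsCard (K : IntermediateField ℚ ℝ) : ℕ :=
  Nat.card {x : ClassGroup (NumberField.RingOfIntegers K) // x ^ 2 = 1}

section ClassGroups

open NumberField nonZeroDivisors

set_option linter.unusedSectionVars false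

open NumberField nonZeroDivisors

/-- The subgroup of squares of a commutative group. -/
abbrev squares (G : Type*) [CommGroup G] : Subgroup G := (powMonoidHom 2 : G →* G).range

theorem relIndex_squares_comap_squares {E G J C : Type*} [CommGroup E] [CommGroup G] [CommGroup J]
    [CommGroup C] (i : E →* G) (f : G →* J) (π : J →* C) (hi : Function.Injective i)
    (hf : f.ker = i.range) (hπ : π.ker = f.range) (hπs : Function.Surjective π)
    (hJ : Function.Injective (powMonoidHom 2 : J →* J)) :
    (squares G).relIndex ((squares J).comap f) =
      (squares E).index * Nat.card {x : C // x ^ 2 = 1} := by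
  set S := squares G
  set V := (squares J).comap f
  have hSV : S ≤ V := by
    rintro _ ⟨y, rfl⟩
    exact ⟨f y, by simp⟩
  have hkV : f.ker ≤ V := fun x hx => ⟨1, by
    rw [MonoidHom.mem_ker] at hx
    simp [hx]⟩
  rw [← Subgroup.relIndex_mul_relIndex S (f.ker ⊔ S) V le_sup_right (sup_le hkV hSV)]
  congr 1
  · rw [Subgroup.relIndex_sup_right, hf, MonoidHom.range_eq_map, ← Subgroup.relIndex_comap,
      Subgroup.relIndex_top_right]
    congr 1
    ext x
    constructor
    · rintro ⟨y, hy⟩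
      have hy' : y ^ 2 = i x := hy
      have h1 : f y = 1 := hJ (by
        have : i x ∈ f.ker := hf ▸ ⟨x, rfl⟩
        simp only [powMonoidHom_apply, one_pow, ← map_pow]
        rw [hy']
        exact this)
      have h2 : y ∈ i.range := hf ▸ h1
      obtain ⟨z, rfl⟩ := h2
      exact ⟨z, hi (by simpa using hy')⟩
    · rintro ⟨y, rfl⟩
      exact ⟨i y, by simp⟩
  · have h1 : (f.ker ⊔ S).relIndex V = (S.map f).relIndex (V.map f) := by
      rw [Subgroup.relIndex_map_map, sup_comm, sup_eq_left.mpr hkV]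
    have h2 : S.map f = f.range.map (powMonoidHom 2 : J →* J) := by
      ext x
      constructor
      · rintro ⟨_, ⟨y, rfl⟩, rfl⟩
        exact ⟨f y, ⟨y, rfl⟩, by simp⟩
      · rintro ⟨_, ⟨y, rfl⟩, rfl⟩
        exact ⟨y ^ 2, ⟨y, rfl⟩, by simp⟩
    have h3 : V.map f = (f.range.comap (powMonoidHom 2 : J →* J)).map (powMonoidHom 2 : J →* J) := by
      ext x
      constructor
      · rintro ⟨y, ⟨z, hz⟩, rfl⟩
        exact ⟨z, ⟨y, hz.symm⟩, hz⟩
      · rintro ⟨z, ⟨y, hz⟩, rfl⟩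
        exact ⟨y, ⟨z, hz.symm⟩, hz⟩
    rw [h1, h2, h3, Subgroup.relIndex_map_map_of_injective _ _ hJ, ← hπ, Subgroup.relIndex_ker]
    refine Nat.card_congr (Equiv.subtypeEquivRight fun x => ?_)
    constructor
    · rintro ⟨y, hy, rfl⟩
      have : π (y ^ 2) = 1 := hy
      simpa using this
    · intro hx
      obtain ⟨y, rfl⟩ := hπs x
      exact ⟨y, by simpa [MonoidHom.mem_ker] using hx, rfl⟩

section Selmer

variable (K : Type*) [Field K] [NumberField K]

/-- The group of `x : Kˣ` generating the square of a fractional ideal. -/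
noncomputable def selmerTwo : Subgroup Kˣ := (squares (FractionalIdeal (𝓞 K)⁰ K)ˣ).comap
  (toPrincipalIdeal (𝓞 K) K)

theorem squares_le_selmerTwo : squares Kˣ ≤ selmerTwo K := by
  rintro _ ⟨y, rfl⟩
  exact ⟨toPrincipalIdeal (𝓞 K) K y, by simp⟩

variable {K}

theorem fracIdeal_sq_le_one {I : FractionalIdeal (𝓞 K)⁰ K} (h : I ^ 2 ≤ 1) : I ≤ 1 := by
  intro x hx
  have h1 : x ^ 2 ∈ (1 : FractionalIdeal (𝓞 K)⁰ K) := h (by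
    rw [pow_two, pow_two]; exact FractionalIdeal.mul_mem_mul hx hx)
  rw [FractionalIdeal.mem_one_iff] at h1 ⊢
  obtain ⟨y, hy⟩ := h1
  have h2 : IsIntegral (𝓞 K) x := by
    apply IsIntegral.of_pow (n := 2) (by norm_num)
    rw [← hy]
    exact isIntegral_algebraMap
  exact IsIntegrallyClosed.isIntegral_iff.mp h2

theorem fracIdeal_units_sq_injective :
    Function.Injective (powMonoidHom 2 : (FractionalIdeal (𝓞 K)⁰ K)ˣ →* _) := by
  rw [injective_iff_map_eq_one]
  intro I hI
  have h : ∀ J : (FractionalIdeal (𝓞 K)⁰ K)ˣ, J ^ 2 = 1 → (J : FractionalIdeal (𝓞 K)⁰ K) ≤ 1 :=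
    fun J hJ => fracIdeal_sq_le_one (by rw [← Units.val_pow_eq_pow_val, hJ]; simp)
  have hI' : I ^ 2 = 1 := hI
  have h1 := h I hI'
  have h2 := h I⁻¹ (by rw [inv_pow, hI', inv_one])
  apply Units.ext
  refine le_antisymm h1 ?_
  calc ((1 : (FractionalIdeal (𝓞 K)⁰ K)ˣ) : FractionalIdeal (𝓞 K)⁰ K) = I * (I⁻¹ : (FractionalIdeal (𝓞 K)⁰ K)ˣ) := by simp
    _ ≤ I * 1 := by gcongr
    _ = I := mul_one _

theorem mem_selmerTwo_iff {x : Kˣ} {y : 𝓞 K} (h : (x : K) = y) :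
    x ∈ selmerTwo K ↔ ∃ I : Ideal (𝓞 K), I ^ 2 = Ideal.span {y} := by
  have key : ∀ I : Ideal (𝓞 K), ((I : FractionalIdeal (𝓞 K)⁰ K) ^ 2 =
      FractionalIdeal.spanSingleton (𝓞 K)⁰ (x : K) ↔ I ^ 2 = Ideal.span {y}) := by
    intro I
    rw [h, ← FractionalIdeal.coeIdeal_span_singleton, ← FractionalIdeal.coeIdeal_pow,
      FractionalIdeal.coeIdeal_inj]
  constructor
  · rintro ⟨J, hJ⟩
    have hJ' : (J : FractionalIdeal (𝓞 K)⁰ K) ^ 2 =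
        FractionalIdeal.spanSingleton (𝓞 K)⁰ (x : K) := by
      rw [← coe_toPrincipalIdeal, ← hJ]; simp
    obtain ⟨I, hI⟩ := FractionalIdeal.le_one_iff_exists_coeIdeal.mp
      (fracIdeal_sq_le_one (I := (J : FractionalIdeal (𝓞 K)⁰ K)) (by
        rw [hJ', h]
        exact FractionalIdeal.spanSingleton_le_iff_mem.mpr
          ((FractionalIdeal.mem_one_iff _).mpr ⟨y, rfl⟩)))
    exact ⟨I, (key I).mp (by rw [hI, hJ'])⟩
  · rintro ⟨I, hI⟩
    have hu := (key I).mpr hI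
    have hne : (I : FractionalIdeal (𝓞 K)⁰ K) ≠ 0 := by
      rintro h0
      rw [h0, zero_pow two_ne_zero, eq_comm, FractionalIdeal.spanSingleton_eq_zero_iff] at hu
      exact x.ne_zero hu
    exact ⟨Units.mk0 _ hne, by
      apply Units.ext
      simpa using hu⟩

theorem exists_integral_mul_sq (x : Kˣ) : ∃ (z : Kˣ) (w y : 𝓞 K), w ≠ 0 ∧ (z : K) = w ∧
    y ≠ 0 ∧ ((x * z ^ 2 : Kˣ) : K) = y := by
  obtain ⟨a, b, hb, hab⟩ := IsFractionRing.div_surjective (A := 𝓞 K) (x : K)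
  have hb0 : b ≠ 0 := nonZeroDivisors.ne_zero hb
  have hb' : (b : K) ≠ 0 := by simpa using hb0
  have e : ((x * (Units.mk0 (b : K) hb') ^ 2 : Kˣ) : K) = (a * b : 𝓞 K) := by
    simp only [Units.val_mul, Units.val_pow_eq_pow_val, Units.val_mk0, ← hab]
    push_cast
    field_simp
  refine ⟨Units.mk0 (b : K) hb', b, a * b, hb0, rfl, ?_, e⟩
  intro h0
  rw [h0] at e
  exact (Units.ne_zero _) (e.trans (by simp))

variable (K) in
theorem relIndex_squares_selmerTwo : (squares Kˣ).relIndex (selmerTwo K) =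
    (squares (𝓞 K)ˣ).index * Nat.card {x : ClassGroup (𝓞 K) // x ^ 2 = 1} := by
  refine relIndex_squares_comap_squares (Units.map (algebraMap (𝓞 K) K).toMonoidHom)
    (toPrincipalIdeal (𝓞 K) K) (ClassGroup.mk (R := 𝓞 K) (K := K)) ?_ ?_ ?_ ?_
    fracIdeal_units_sq_injective
  · exact Units.map_injective (IsFractionRing.injective (𝓞 K) K)
  · ext x
    constructor
    · intro hx
      have hx' : FractionalIdeal.spanSingleton (𝓞 K)⁰ (x : K) = 1 := by
        rw [← coe_toPrincipalIdeal, MonoidHom.mem_ker.mp hx, Units.val_one]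
      have hx'' : FractionalIdeal.spanSingleton (𝓞 K)⁰ ((x⁻¹ : Kˣ) : K) = 1 := by
        rw [← coe_toPrincipalIdeal, map_inv, MonoidHom.mem_ker.mp hx, inv_one, Units.val_one]
      obtain ⟨a, ha⟩ := (FractionalIdeal.mem_one_iff _).mp
        (FractionalIdeal.spanSingleton_le_iff_mem.mp hx'.le)
      obtain ⟨b, hb⟩ := (FractionalIdeal.mem_one_iff _).mp
        (FractionalIdeal.spanSingleton_le_iff_mem.mp hx''.le)
      have hab : a * b = 1 := IsFractionRing.injective (𝓞 K) K (by
        rw [map_mul, ha, hb]; simp)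
      exact ⟨⟨a, b, hab, by rw [mul_comm, hab]⟩, Units.ext ha⟩
    · rintro ⟨u, rfl⟩
      rw [MonoidHom.mem_ker, toPrincipalIdeal_eq_iff]
      simp only [Units.val_one]
      have : ((Units.map (algebraMap (𝓞 K) K).toMonoidHom u : Kˣ) : K) = algebraMap (𝓞 K) K u := rfl
      rw [this, ← FractionalIdeal.coeIdeal_span_singleton, Ideal.span_singleton_eq_top.mpr u.isUnit,
        FractionalIdeal.coeIdeal_top]
  · ext I
    rw [MonoidHom.mem_ker, ClassGroup.mk_eq_one_iff, mem_principal_ideals_iff]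
    constructor
    · intro h
      obtain ⟨x, hx⟩ := (FractionalIdeal.isPrincipal_iff _).mp h
      exact ⟨x, hx.symm⟩
    · rintro ⟨x, hx⟩
      exact (FractionalIdeal.isPrincipal_iff _).mpr ⟨x, hx.symm⟩
  · intro c
    obtain ⟨I, rfl⟩ := ClassGroup.mk0_surjective c
    exact ⟨FractionalIdeal.mk0 K I, ClassGroup.mk_mk0 K I⟩

end Selmer

set_option linter.unusedVariables false

section DedekindIdeals

variable {R : Type*} [CommRing R] [IsDedekindDomain R]

theorem Ideal.mem_of_sq_mem_mul_sup {J : Ideal R} {t : R}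
    (h : t ^ 2 ∈ J * (Ideal.span {t} ⊔ J)) : t ∈ J := by
  rcases eq_or_ne J ⊥ with rfl | hJ
  · simpa using h
  set C := Ideal.span {t} ⊔ J with hC
  have hC0 : C ≠ ⊥ := fun h0 => hJ (le_bot_iff.mp (h0 ▸ le_sup_right))
  have h1 : C * C ≤ J * C := by
    conv_lhs => rw [hC, Ideal.sup_mul]
    refine sup_le ?_ le_rfl
    rw [hC, Ideal.mul_sup, ← hC]
    refine sup_le ?_ ?_
    · rw [Ideal.span_singleton_mul_span_singleton, Ideal.span_singleton_le_iff_mem, ← pow_two]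
      exact h
    · rw [mul_comm]
      exact Ideal.mul_mono_right le_sup_left
  have h2 : C ≤ J := by
    rw [← Ideal.dvd_iff_le] at h1 ⊢
    exact (mul_dvd_mul_iff_right hC0).mp h1
  exact h2 (Ideal.mem_sup_left (Ideal.mem_span_singleton_self t))

theorem Ideal.le_of_sq_le_sq {I J : Ideal R} (h : I ^ 2 ≤ J ^ 2) : I ≤ J := by
  intro t ht
  apply Ideal.mem_of_sq_mem_mul_sup
  have h1 : t ^ 2 ∈ J ^ 2 := h (Ideal.pow_mem_pow ht 2)
  rw [pow_two J] at h1
  exact Ideal.mul_mono_right le_sup_right h1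

theorem Ideal.eq_of_sq_eq_sq {I J : Ideal R} (h : I ^ 2 = J ^ 2) : I = J :=
  le_antisymm (Ideal.le_of_sq_le_sq h.le) (Ideal.le_of_sq_le_sq h.ge)

end DedekindIdeals

section ExtendIdeals

variable {k L : Type*} [Field k] [NumberField k] [Field L] [NumberField L] [Algebra k L]

theorem mem_of_algebraMap_eq {x : 𝓞 L} {a : k} (h : algebraMap k L a = x) :
    ∃ b : 𝓞 k, (b : k) = a ∧ algebraMap (𝓞 k) (𝓞 L) b = x := by
  have h1 : IsIntegral ℤ a := by
    rw [← isIntegral_algebraMap_iff (algebraMap k L).injective, h]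
    exact RingOfIntegers.isIntegral_coe x
  exact ⟨⟨a, h1⟩, rfl, RingOfIntegers.ext h⟩

theorem algebraMap_ringOfIntegers_injective : Function.Injective (algebraMap (𝓞 k) (𝓞 L)) :=
  fun a b h => RingOfIntegers.ext ((algebraMap k L).injective
    (congrArg (algebraMap (𝓞 L) L) h))

theorem Ideal.map_le_map_ringOfIntegers {I J : Ideal (𝓞 k)}
    (h : I.map (algebraMap (𝓞 k) (𝓞 L)) ≤ J.map (algebraMap (𝓞 k) (𝓞 L))) : I ≤ J := by
  intro x hx
  rcases eq_or_ne J ⊥ with rfl | hJ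
  · have h1 := h (Ideal.mem_map_of_mem _ hx)
    rw [Ideal.map_bot, Ideal.mem_bot] at h1
    exact (Ideal.mem_bot).mpr (algebraMap_ringOfIntegers_injective (h1.trans (map_zero _).symm))
  obtain ⟨c, hc, hc0⟩ := Submodule.exists_mem_ne_zero_of_ne_bot hJ
  obtain ⟨J', hJ'⟩ := Ideal.dvd_span_singleton.mpr hc
  have h2 : Ideal.span {x} * J' ≤ J * J' := by
    rw [← hJ', Ideal.span_singleton_mul_le_iff]
    intro z hz
    have h3 : algebraMap (𝓞 k) (𝓞 L) (x * z) ∈ (Ideal.span {c}).map (algebraMap (𝓞 k) (𝓞 L)) := by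
      rw [hJ', Ideal.map_mul, map_mul]
      exact Ideal.mul_mem_mul (h (Ideal.mem_map_of_mem _ hx)) (Ideal.mem_map_of_mem _ hz)
    rw [Ideal.map_span, Set.image_singleton, Ideal.mem_span_singleton] at h3
    obtain ⟨w, hw⟩ := h3
    have hc0' : (c : k) ≠ 0 := by simpa using hc0
    have h4 : algebraMap k L ((x * z : 𝓞 k) / c : k) = w := by
      rw [map_div₀, div_eq_iff ((map_ne_zero _).mpr hc0'), mul_comm (w : L)]
      exact congrArg (algebraMap (𝓞 L) L) hw
    obtain ⟨b, hb, -⟩ := mem_of_algebraMap_eq h4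
    rw [Ideal.mem_span_singleton]
    refine ⟨b, RingOfIntegers.ext ?_⟩
    rw [eq_div_iff hc0'] at hb
    exact hb.symm.trans (mul_comm _ _)
  have hJ'0 : J' ≠ ⊥ := by
    rintro rfl
    rw [Ideal.mul_bot, Ideal.span_singleton_eq_bot] at hJ'
    exact hc0 hJ'
  rw [← Ideal.dvd_iff_le, mul_dvd_mul_iff_right hJ'0, Ideal.dvd_span_singleton] at h2
  exact h2

theorem Ideal.map_ringOfIntegers_injective :
    Function.Injective (Ideal.map (algebraMap (𝓞 k) (𝓞 L))) := fun _ _ h =>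
  le_antisymm (Ideal.map_le_map_ringOfIntegers h.le) (Ideal.map_le_map_ringOfIntegers h.ge)

end ExtendIdeals

/-- A quadratic extension `L = k(ρ)` with `ρ ^ 2 = δ ∈ k` and nontrivial automorphism `σ`. -/
structure QuadExt (k L : Type*) [Field k] [Field L] [Algebra k L] where
  σ : L ≃ₐ[k] L
  δ : k
  ρ : L
  σ_σ : ∀ x, σ (σ x) = x
  fixed : ∀ x, σ x = x → ∃ a, algebraMap k L a = x
  ρ_sq : ρ ^ 2 = algebraMap k L δ
  σ_ρ : σ ρ = -ρ
  ρ_ne_zero : ρ ≠ 0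

namespace QuadExt

variable {k L : Type*} [Field k] [NumberField k] [Field L] [NumberField L] [Algebra k L]
  (Q : QuadExt k L)

theorem exists_norm (x : L) : ∃ a, algebraMap k L a = x * Q.σ x :=
  Q.fixed _ (by rw [map_mul, Q.σ_σ, mul_comm])

/-- The relative norm. -/
noncomputable def norm : Lˣ →* kˣ where
  toFun x := Units.mk0 (Q.exists_norm x).choose (by
    intro h
    have h1 := (Q.exists_norm x).choose_spec
    rw [h, map_zero, eq_comm, mul_eq_zero] at h1
    rcases h1 with h1 | h1
    · exact x.ne_zero h1
    · exact x.ne_zero ((map_eq_zero Q.σ).mp h1))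
  map_one' := by
    apply Units.ext
    apply (algebraMap k L).injective
    simp only [Units.val_mk0]
    rw [(Q.exists_norm _).choose_spec]
    simp
  map_mul' x y := by
    apply Units.ext
    apply (algebraMap k L).injective
    rw [Units.val_mul (Units.mk0 _ _), map_mul]
    simp only [Units.val_mk0]
    rw [(Q.exists_norm x).choose_spec, (Q.exists_norm y).choose_spec,
      (Q.exists_norm ((x * y : Lˣ) : L)).choose_spec, Units.val_mul, map_mul]
    ring

theorem algebraMap_norm (x : Lˣ) : algebraMap k L (Q.norm x) = x * Q.σ x :=
  (Q.exists_norm x).choose_spec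

theorem norm_eq_iff {x : Lˣ} {a : kˣ} : Q.norm x = a ↔ (x : L) * Q.σ x = algebraMap k L a := by
  rw [← Q.algebraMap_norm, Units.ext_iff, (algebraMap k L).injective.eq_iff]

/-- The inclusion of multiplicative groups. -/
abbrev incl (_ : QuadExt k L) : kˣ →* Lˣ := Units.map (algebraMap k L).toMonoidHom

theorem norm_incl (a : kˣ) : Q.norm (Q.incl a) = a ^ 2 := by
  rw [norm_eq_iff]
  have : ((Q.incl a : Lˣ) : L) = algebraMap k L a := rfl
  rw [this, Q.σ.commutes]
  simp [pow_two]

theorem hilbert90 {x : Lˣ} (h : Q.norm x = 1) : ∃ (a : kˣ) (y : Lˣ), x = Q.incl a * y ^ 2 := by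
  have h1 : (x : L) * Q.σ x = 1 := by
    rw [Q.norm_eq_iff] at h
    simpa using h
  obtain ⟨y, hy⟩ : ∃ y : Lˣ, (x : L) * Q.σ y = y := by
    by_cases hx : (x : L) = -1
    · exact ⟨Units.mk0 _ Q.ρ_ne_zero, by simp [hx, Q.σ_ρ]⟩
    · have h0 : 1 + (x : L) ≠ 0 := fun h0 => hx (eq_neg_of_add_eq_zero_right h0)
      exact ⟨Units.mk0 _ h0, by
        simp only [Units.val_mk0, map_add, map_one, mul_add, h1]; ring⟩
  refine ⟨(Q.norm y)⁻¹, y, ?_⟩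
  apply Units.ext
  have e : ((Q.incl (Q.norm y)⁻¹ : Lˣ) : L) = (algebraMap k L (Q.norm y))⁻¹ := by
    rw [map_inv, Units.val_inv_eq_inv_val]; rfl
  have hs : Q.σ y ≠ 0 := by simp
  rw [Units.val_mul, e, Q.algebraMap_norm, Units.val_pow_eq_pow_val]
  have := y.ne_zero
  field_simp
  exact hy

theorem sq_mem_range_incl {x : Lˣ} {a : kˣ} (h : x ^ 2 = Q.incl a) :
    ∃ b : kˣ, x = Q.incl b ∨ (x : L) = Q.ρ * algebraMap k L b := by
  have h' : (x : L) ^ 2 = algebraMap k L a := by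
    rw [← Units.val_pow_eq_pow_val, h]; rfl
  have h1 : Q.σ x ^ 2 = (x : L) ^ 2 := by rw [← map_pow, h', Q.σ.commutes]
  rcases sq_eq_sq_iff_eq_or_eq_neg.mp h1 with h2 | h2
  · obtain ⟨b, hb⟩ := Q.fixed _ h2
    have hb0 : b ≠ 0 := by
      rintro rfl
      exact x.ne_zero (by rw [← hb, map_zero])
    exact ⟨Units.mk0 b hb0, Or.inl (Units.ext hb.symm)⟩
  · obtain ⟨b, hb⟩ := Q.fixed (x / Q.ρ) (by rw [map_div₀, h2, Q.σ_ρ, neg_div_neg_eq])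
    have hb0 : b ≠ 0 := by
      rintro rfl
      rw [map_zero, eq_comm, div_eq_zero_iff] at hb
      exact hb.elim x.ne_zero Q.ρ_ne_zero
    refine ⟨Units.mk0 b hb0, Or.inr ?_⟩
    rw [Units.val_mk0, hb, mul_div_cancel₀ _ Q.ρ_ne_zero]

theorem ρ_notMem : ∀ a : k, algebraMap k L a ≠ Q.ρ := by
  intro a ha
  have h := Q.σ_ρ
  rw [← ha, Q.σ.commutes, ha, eq_neg_iff_add_eq_zero, ← two_mul] at h
  exact Q.ρ_ne_zero ((mul_eq_zero.mp h).resolve_left two_ne_zero)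

theorem δ_ne_zero : Q.δ ≠ 0 := by
  intro h
  have := Q.ρ_sq
  rw [h, map_zero] at this
  exact Q.ρ_ne_zero (pow_eq_zero_iff two_ne_zero |>.mp this)

theorem δ_not_sq (a : k) : a ^ 2 ≠ Q.δ := by
  intro h
  have h1 := Q.ρ_sq
  rw [← h, map_pow] at h1
  rcases sq_eq_sq_iff_eq_or_eq_neg.mp h1 with h2 | h2
  · exact Q.ρ_notMem a h2.symm
  · exact Q.ρ_notMem (-a) (by rw [map_neg, h2])

/-- `σ` on the ring of integers. -/
noncomputable abbrev σR : 𝓞 L ≃+* 𝓞 L := RingOfIntegers.mapRingEquiv Q.σ.toRingEquiv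

theorem coe_σR (x : 𝓞 L) : ((Q.σR x : 𝓞 L) : L) = Q.σ x := rfl

theorem σR_σR (x : 𝓞 L) : Q.σR (Q.σR x) = x := RingOfIntegers.ext (Q.σ_σ x)

theorem σR_algebraMap (a : 𝓞 k) : Q.σR (algebraMap (𝓞 k) (𝓞 L) a) = algebraMap (𝓞 k) (𝓞 L) a :=
  RingOfIntegers.ext (Q.σ.commutes a)

theorem fixedR {x : 𝓞 L} (h : Q.σR x = x) : ∃ a, algebraMap (𝓞 k) (𝓞 L) a = x := by
  obtain ⟨a, ha⟩ := Q.fixed x (congrArg (algebraMap (𝓞 L) L) h)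
  obtain ⟨b, -, hb⟩ := mem_of_algebraMap_eq ha
  exact ⟨b, hb⟩

/-- The conjugate ideal. -/
noncomputable abbrev conj (I : Ideal (𝓞 L)) : Ideal (𝓞 L) := I.map Q.σR

theorem exists_normIdeal (I : Ideal (𝓞 L)) :
    ∃ 𝔞 : Ideal (𝓞 k), 𝔞.map (algebraMap (𝓞 k) (𝓞 L)) = I * Q.conj I := by
  set 𝔞 : Ideal (𝓞 k) :=
    Ideal.span {c | ∃ x ∈ I, algebraMap (𝓞 k) (𝓞 L) c = x * Q.σR x} with h𝔞
  set A := 𝔞.map (algebraMap (𝓞 k) (𝓞 L)) with hA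
  have hmem : ∀ x ∈ I, x * Q.σR x ∈ A := by
    intro x hx
    obtain ⟨c, hc⟩ := Q.fixedR (x := x * Q.σR x) (by rw [map_mul, Q.σR_σR, mul_comm])
    rw [← hc]
    exact Ideal.mem_map_of_mem _ (Ideal.subset_span ⟨x, hx, hc⟩)
  refine ⟨𝔞, le_antisymm ?_ ?_⟩
  · rw [Ideal.map_span, Ideal.span_le]
    rintro _ ⟨c, ⟨x, hx, hc⟩, rfl⟩
    rw [hc]
    exact Ideal.mul_mem_mul hx (Ideal.mem_map_of_mem _ hx)
  · rw [Ideal.mul_le]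
    intro x hx y' hy'
    obtain ⟨y, hy, rfl⟩ := (Ideal.mem_map_of_equiv Q.σR y').mp hy'
    apply Ideal.mem_of_sq_mem_mul_sup
    have hs : x * Q.σR y + y * Q.σR x ∈ A := by
      have h1 := hmem _ (I.add_mem hx hy)
      have h2 := A.sub_mem (A.sub_mem h1 (hmem x hx)) (hmem y hy)
      convert h2 using 1
      rw [map_add]; ring
    have hp : (x * Q.σR x) * (y * Q.σR y) ∈ A * A := Ideal.mul_mem_mul (hmem x hx) (hmem y hy)
    have e : (x * Q.σR y) ^ 2 = (x * Q.σR y + y * Q.σR x) * (x * Q.σR y) -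
        (x * Q.σR x) * (y * Q.σR y) := by ring
    rw [e]
    refine Ideal.sub_mem _ ?_ ?_
    · exact Ideal.mul_mem_mul hs (Ideal.mem_sup_left (Ideal.mem_span_singleton_self _))
    · exact Ideal.mul_mono_right le_sup_right hp

end QuadExt

theorem mem_of_odd_pow_mem {G : Type*} [CommGroup G] {A : Subgroup G} (hA : squares G ≤ A) {n : ℕ}
    (hn : Odd n) {x : G} (h : x ^ n ∈ A) : x ∈ A := by
  obtain ⟨m, rfl⟩ := hn
  rw [pow_succ, pow_mul'] at h
  exact (A.mul_mem_cancel_left (hA ⟨x ^ m, rfl⟩)).mp h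

section OddClassNumber

/-- Some odd power of every ideal is principal. -/
def OddClass (k : Type*) [Field k] [NumberField k] : Prop :=
  ∃ H, Odd H ∧ ∀ I : Ideal (𝓞 k), ∃ a, I ^ H = Ideal.span {a}

variable {k : Type*} [Field k] [NumberField k]

theorem oddClass_of_card (h : Nat.card {x : ClassGroup (𝓞 k) // x ^ 2 = 1} = 1) : OddClass k := by
  refine ⟨Fintype.card (ClassGroup (𝓞 k)), ?_, fun I => ?_⟩
  · rw [← Nat.not_even_iff_odd, even_iff_two_dvd]
    intro h2
    obtain ⟨x, hx⟩ := exists_prime_orderOf_dvd_card 2 h2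
    have := (Nat.card_eq_one_iff_unique.mp h).1
    have h1 : (⟨x, by rw [← hx, pow_orderOf_eq_one]⟩ : {x : ClassGroup (𝓞 k) // x ^ 2 = 1}) =
      ⟨1, by simp⟩ := Subsingleton.elim _ _
    rw [Subtype.mk.injEq] at h1
    rw [h1, orderOf_one] at hx
    omega
  · rcases eq_or_ne I ⊥ with rfl | hI
    · refine ⟨0, ?_⟩
      rw [← Ideal.zero_eq_bot, zero_pow Fintype.card_ne_zero]
      simp
    · have hI' : I ∈ (Ideal (𝓞 k))⁰ := mem_nonZeroDivisors_of_ne_zero hI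
      have h1 := pow_card_eq_one (x := ClassGroup.mk0 ⟨I, hI'⟩)
      rw [← map_pow, ClassGroup.mk0_eq_one_iff] at h1
      exact ((Submodule.isPrincipal_iff _).mp h1)

/-- Units of the ring of integers, as elements of the field. -/
noncomputable abbrev unitsIncl (k : Type*) [Field k] : (𝓞 k)ˣ →* kˣ :=
  Units.map (algebraMap (𝓞 k) k).toMonoidHom

theorem coe_unitsIncl (u : (𝓞 k)ˣ) : ((unitsIncl k u : kˣ) : k) = ((u : 𝓞 k) : k) := rfl

theorem exists_unitsIncl_of_span_eq {x y : kˣ} {a b : 𝓞 k} (hx : (x : k) = a) (hy : (y : k) = b)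
    (h : Ideal.span {a} = Ideal.span {b}) : ∃ u, x = unitsIncl k u * y := by
  obtain ⟨u, hu⟩ := Ideal.span_singleton_eq_span_singleton.mp h.symm
  refine ⟨u, Units.ext ?_⟩
  rw [Units.val_mul, hx, hy, coe_unitsIncl, ← hu, mul_comm]
  simp

theorem unitsIncl_mem_selmerTwo (u : (𝓞 k)ˣ) : unitsIncl k u ∈ selmerTwo k := by
  rw [mem_selmerTwo_iff (coe_unitsIncl u)]
  exact ⟨⊤, by rw [Ideal.span_singleton_eq_top.mpr u.isUnit, pow_two, Ideal.mul_top]⟩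

theorem selmerTwo_eq (h : OddClass k) :
    selmerTwo k = (unitsIncl k).range ⊔ squares kˣ := by
  apply le_antisymm
  · intro x hx
    obtain ⟨H, hH, hp⟩ := h
    obtain ⟨z, w, y, -, -, hy0, hxy⟩ := exists_integral_mul_sq x
    have hx' : x * z ^ 2 ∈ selmerTwo k := mul_mem hx (squares_le_selmerTwo k ⟨z, rfl⟩)
    obtain ⟨I, hI⟩ := (mem_selmerTwo_iff hxy).mp hx'
    obtain ⟨a, ha⟩ := hp I
    have h1 : Ideal.span {y ^ H} = Ideal.span {a ^ 2} := by
      rw [← Ideal.span_singleton_pow, ← Ideal.span_singleton_pow, ← ha, ← hI, ← pow_mul, ← pow_mul,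
        mul_comm]
    have ha0 : (a : k) ≠ 0 := by
      intro h0
      have : a = 0 := by simpa using h0
      rw [this, zero_pow two_ne_zero, Ideal.span_singleton_eq_span_singleton] at h1
      exact hy0 (pow_eq_zero_iff hH.pos.ne' |>.mp (h1.eq_zero_iff.mpr rfl))
    obtain ⟨u, hu⟩ := exists_unitsIncl_of_span_eq (x := (x * z ^ 2) ^ H) (y := Units.mk0 _ ha0 ^ 2)
      (by rw [Units.val_pow_eq_pow_val, hxy]; push_cast; rfl) (by simp) h1
    have h2 : x * z ^ 2 ∈ (unitsIncl k).range ⊔ squares kˣ := by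
      apply mem_of_odd_pow_mem le_sup_right hH
      rw [hu]
      exact mul_mem (Subgroup.mem_sup_left ⟨u, rfl⟩) (Subgroup.mem_sup_right ⟨_, rfl⟩)
    exact (Subgroup.mul_mem_cancel_right _ (Subgroup.mem_sup_right
      (show z ^ 2 ∈ squares kˣ from ⟨z, rfl⟩))).mp h2
  · refine sup_le ?_ (squares_le_selmerTwo k)
    rintro _ ⟨u, rfl⟩
    exact unitsIncl_mem_selmerTwo u

end OddClassNumber

theorem relIndex_squares_mul_two {G M : Type*} [CommGroup G] [CommGroup M] (i : G →* M) (N : M →* G)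
    (hN : ∀ a, N (i a) = a ^ 2) (h90 : ∀ x, N x = 1 → ∃ a y, x = i a * y ^ 2)
    (hi : (squares G).relIndex ((squares M).comap i) = 2) (V : Subgroup M) (hV : squares M ≤ V)
    (U : Subgroup G) (hU : squares G ≤ U) (hVU : V.map N ≤ U)
    (hUV : ∀ g ∈ U, g ∈ N.range → ∃ x ∈ V, ∃ s, N x = g * s ^ 2) :
    (squares M).relIndex V * 2 = (squares G).relIndex (V.comap i) *
      (squares G).relIndex (U ⊓ N.range) := by
  have h1 : squares M ≤ V ⊓ (squares G).comap N := by
    refine le_inf hV ?_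
    rintro _ ⟨y, rfl⟩
    exact ⟨N y, by simp⟩
  rw [← Subgroup.relIndex_mul_relIndex _ _ _ h1 inf_le_left, Subgroup.inf_relIndex_left,
    Subgroup.relIndex_comap]
  have h2 : V.map N ⊔ squares G = U ⊓ N.range := by
    apply le_antisymm
    · refine sup_le (le_inf hVU ?_) (le_inf hU ?_)
      · rintro _ ⟨x, -, rfl⟩
        exact ⟨x, rfl⟩
      · rintro _ ⟨x, rfl⟩
        exact ⟨i x, hN x⟩
    · rintro g ⟨hg, hg'⟩
      obtain ⟨x, hx, s, hs⟩ := hUV g hg hg'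
      have : g = N x * (s⁻¹) ^ 2 := by rw [hs]; simp
      rw [this]
      exact mul_mem (Subgroup.mem_sup_left ⟨x, hx, rfl⟩) (Subgroup.mem_sup_right ⟨_, rfl⟩)
  have h3 : V ⊓ (squares G).comap N = (V.comap i).map i ⊔ squares M := by
    apply le_antisymm
    · rintro x ⟨hx, s, hs⟩
      have hs' : s ^ 2 = N x := hs
      obtain ⟨a, y, hy⟩ := h90 (x * (i s)⁻¹) (by rw [map_mul, map_inv, hN, hs', mul_inv_cancel])
      have e : x = i (a * s) * y ^ 2 := by
        rw [map_mul, mul_right_comm, ← hy, inv_mul_cancel_right]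
      have hy2 : y ^ 2 ∈ squares M := ⟨y, rfl⟩
      have : i (a * s) ∈ V := by
        rw [e] at hx
        exact (V.mul_mem_cancel_right (hV hy2)).mp hx
      rw [e]
      exact mul_mem (Subgroup.mem_sup_left ⟨a * s, this, rfl⟩) (Subgroup.mem_sup_right hy2)
    · refine sup_le ?_ h1
      rintro _ ⟨x, hx, rfl⟩
      exact ⟨hx, x, (hN x).symm⟩
  rw [← h2, Subgroup.relIndex_sup_right, h3, Subgroup.relIndex_sup_right, ← Subgroup.relIndex_comap]
  have h4 : squares G ≤ (squares M).comap i := by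
    rintro _ ⟨y, rfl⟩
    exact ⟨i y, by simp⟩
  rw [← Subgroup.relIndex_mul_relIndex _ _ _ h4 (Subgroup.comap_mono hV), hi]
  ring

namespace QuadExt

variable {k L : Type*} [Field k] [NumberField k] [Field L] [NumberField L] [Algebra k L]
  (Q : QuadExt k L)

theorem coe_incl (a : kˣ) : ((Q.incl a : Lˣ) : L) = algebraMap k L a := rfl

theorem norm_mem_selmerTwo {x : Lˣ} (hx : x ∈ selmerTwo L) : Q.norm x ∈ selmerTwo k := by
  obtain ⟨z, w, y, -, -, hy0, hxy⟩ := exists_integral_mul_sq x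
  have hx' : x * z ^ 2 ∈ selmerTwo L := mul_mem hx (squares_le_selmerTwo L ⟨z, rfl⟩)
  obtain ⟨I, hI⟩ := (mem_selmerTwo_iff hxy).mp hx'
  obtain ⟨c, hc⟩ := Q.fixedR (x := y * Q.σR y) (by rw [map_mul, Q.σR_σR, mul_comm])
  have hN : ((Q.norm (x * z ^ 2) : kˣ) : k) = c := by
    apply (algebraMap k L).injective
    rw [Q.algebraMap_norm, hxy]
    exact (congrArg (algebraMap (𝓞 L) L) hc).symm
  have h1 : Q.norm (x * z ^ 2) ∈ selmerTwo k := by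
    rw [mem_selmerTwo_iff hN]
    obtain ⟨𝔞, h𝔞⟩ := Q.exists_normIdeal I
    refine ⟨𝔞, Ideal.map_ringOfIntegers_injective (L := L) ?_⟩
    rw [Ideal.map_pow, h𝔞, Ideal.map_span, Set.image_singleton, hc, mul_pow, ← Ideal.map_pow, hI,
      Ideal.map_span, Set.image_singleton, Ideal.span_singleton_mul_span_singleton]
  rw [map_mul, map_pow] at h1
  exact (Subgroup.mul_mem_cancel_right _ (squares_le_selmerTwo k ⟨_, rfl⟩)).mp h1

theorem exists_mem_selmerTwo_norm (hk : OddClass k) {g : kˣ} (hg : g ∈ selmerTwo k)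
    (hgN : g ∈ Q.norm.range) : ∃ x ∈ selmerTwo L, ∃ s, Q.norm x = g * s ^ 2 := by
  obtain ⟨x', hx'⟩ := hgN
  rw [selmerTwo_eq hk] at hg
  obtain ⟨_, ⟨η, rfl⟩, _, ⟨z, rfl⟩, hg⟩ := Subgroup.mem_sup.mp hg
  obtain ⟨H, hH, hp⟩ := hk
  set x₀ : Lˣ := x' * (Q.incl z)⁻¹ with hx₀
  have hNx₀ : Q.norm x₀ = unitsIncl k η := by
    rw [hx₀, map_mul, map_inv, Q.norm_incl, hx', ← hg]
    simp
  obtain ⟨y, m, hm0, hy⟩ : ∃ (y : 𝓞 L) (m : ℤ), m ≠ 0 ∧ (m : L) * x₀ = y := by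
    obtain ⟨m, hm0, hm⟩ := exists_integral_multiples ℤ ℚ ({(x₀ : L)} : Finset L)
    have := hm (x₀ : L) (by simp)
    exact ⟨⟨_, this⟩, m, hm0, (zsmul_eq_mul _ _).symm⟩
  have hηL : (x₀ : L) * Q.σ x₀ = algebraMap k L (η : 𝓞 k) := by
    rw [← Q.algebraMap_norm, hNx₀, coe_unitsIncl]
  set ηL : 𝓞 L := algebraMap (𝓞 k) (𝓞 L) η with hηLdef
  have hyy : y * Q.σR y = (m : 𝓞 L) ^ 2 * ηL := by
    apply RingOfIntegers.ext
    have : (y : L) * Q.σ y = (m : L) ^ 2 * algebraMap k L (η : 𝓞 k) := by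
      rw [← hy, map_mul, map_intCast, ← hηL]; ring
    exact this.trans (by push_cast; rfl)
  set I : Ideal (𝓞 L) := Ideal.span {(m : 𝓞 L), y} with hI
  have hconj : Q.conj I = Ideal.span {(m : 𝓞 L), Q.σR y} := by
    rw [hI]
    refine (Ideal.map_span _ _).trans ?_
    rw [Set.image_pair, map_intCast]
  obtain ⟨𝔞, h𝔞⟩ := Q.exists_normIdeal I
  obtain ⟨a, ha⟩ := hp 𝔞
  have key : Ideal.span {y} * (I * Q.conj I) = Ideal.span {(m : 𝓞 L)} * I ^ 2 := by
    have e1 : I * Q.conj I = Ideal.span {(m : 𝓞 L) * m, m * Q.σR y, y * m, y * Q.σR y} := by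
      rw [hconj, hI, Ideal.span_pair_mul_span_pair]
    have e2 : I ^ 2 = Ideal.span {(m : 𝓞 L) * m, m * y, y * m, y * y} := by
      rw [pow_two, hI, Ideal.span_pair_mul_span_pair]
    have hη : Ideal.span {ηL} = ⊤ :=
      Ideal.span_singleton_eq_top.mpr ((Units.isUnit η).map (algebraMap (𝓞 k) (𝓞 L)))
    obtain ⟨ηi, hηi⟩ : ∃ ηi, ηL * ηi = 1 :=
      ((Units.isUnit η).map (algebraMap (𝓞 k) (𝓞 L))).exists_right_inv
    rw [e1, e2]
    apply le_antisymm
    · rw [Ideal.span_mul_span, Ideal.span_mul_span]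
      simp only [Set.singleton_mul, Set.image_insert_eq, Set.image_singleton]
      rw [Ideal.span_le]
      rintro t (rfl | rfl | rfl | rfl)
      · exact Ideal.subset_span (by right; left; ring)
      · have : y * ((m : 𝓞 L) * Q.σR y) = ηL * (m * (m * m)) := by
          linear_combination (m : 𝓞 L) * hyy
        rw [this]
        exact Ideal.mul_mem_left _ _ (Ideal.subset_span (by left; rfl))
      · exact Ideal.subset_span (by right; right; right; rw [Set.mem_singleton_iff]; ring)
      · have : y * (y * Q.σR y) = ηL * (m * (m * y)) := by linear_combination y * hyy
        rw [this]
        exact Ideal.mul_mem_left _ _ (Ideal.subset_span (by right; left; rfl))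
    · rw [Ideal.span_mul_span, Ideal.span_mul_span]
      simp only [Set.singleton_mul, Set.image_insert_eq, Set.image_singleton]
      rw [Ideal.span_le]
      rintro t (rfl | rfl | rfl | rfl)
      · have : (m : 𝓞 L) * (m * m) = ηi * (y * (m * Q.σR y)) := by
          linear_combination (-ηi * m) * hyy - (m : 𝓞 L) ^ 3 * hηi
        rw [this]
        exact Ideal.mul_mem_left _ _ (Ideal.subset_span (by right; left; rfl))
      · exact Ideal.subset_span (by left; ring)
      · exact Ideal.subset_span (by left; ring)
      · exact Ideal.subset_span (by right; right; left; ring)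
  set x₁ : 𝓞 L := y ^ H * algebraMap (𝓞 k) (𝓞 L) a * (m : 𝓞 L) ^ H with hx₁
  have hI0 : I ≠ ⊥ := by
    intro h0
    have : (m : 𝓞 L) ∈ I := Ideal.subset_span (by left; rfl)
    rw [h0, Ideal.mem_bot] at this
    exact hm0 (by exact_mod_cast this)
  have ha0 : a ≠ 0 := by
    rintro rfl
    rw [Ideal.span_singleton_zero, ← Ideal.zero_eq_bot, pow_eq_zero_iff hH.pos.ne'] at ha
    rw [ha, Ideal.zero_eq_bot, Ideal.map_bot, eq_comm, ← Ideal.zero_eq_bot, mul_eq_zero] at h𝔞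
    rcases h𝔞 with h | h
    · exact hI0 h
    · rw [Ideal.zero_eq_bot, Ideal.map_eq_bot_iff_of_injective Q.σR.injective] at h
      exact hI0 h
  have ha0' : (a : k) ≠ 0 := by simpa using ha0
  have hm0' : (m : k) ≠ 0 := by exact_mod_cast hm0
  set x₂ : Lˣ := (Q.incl (Units.mk0 _ hm0') * x₀) ^ H * Q.incl (Units.mk0 _ ha0') *
    (Q.incl (Units.mk0 _ hm0')) ^ H with hx₂
  have hx₁₂ : (x₂ : L) = x₁ := by
    rw [hx₂, hx₁]
    simp only [map_mul, map_pow, Units.val_mul, Units.val_pow_eq_pow_val, Q.coe_incl,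
      Units.val_mk0, map_intCast]
    rw [hy]
    rfl
  refine ⟨x₂, ?_, ?_⟩
  · rw [mem_selmerTwo_iff hx₁₂]
    refine ⟨Ideal.span {(m : 𝓞 L)} ^ H * I ^ H, ?_⟩
    have ha' : Ideal.span {algebraMap (𝓞 k) (𝓞 L) a} = (I * Q.conj I) ^ H := by
      rw [← h𝔞, ← Ideal.map_pow, ha, Ideal.map_span, Set.image_singleton]
    rw [hx₁, ← Ideal.span_singleton_mul_span_singleton, ← Ideal.span_singleton_mul_span_singleton,
      ← Ideal.span_singleton_pow, ← Ideal.span_singleton_pow, ha',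
      ← mul_pow (Ideal.span {y}), key]
    ring
  · obtain ⟨j, rfl⟩ := hH
    refine ⟨z⁻¹ * ((Units.mk0 _ hm0') ^ (2 * j + 1)) ^ 2 * Units.mk0 _ ha0' * unitsIncl k η ^ j, ?_⟩
    rw [hx₂, map_mul, map_mul, map_pow, map_mul, map_pow, hNx₀, Q.norm_incl, Q.norm_incl, ← hg,
      powMonoidHom_apply]
    generalize unitsIncl k η = e
    apply Units.ext
    simp only [Units.val_mul, Units.val_pow_eq_pow_val, Units.val_mk0, Units.val_inv_eq_inv_val]
    have := z.ne_zero
    field_simp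
    ring

/-- `δ` as a unit. -/
noncomputable abbrev δu : kˣ := Units.mk0 Q.δ Q.δ_ne_zero

theorem mem_comap_squares {a : kˣ} : a ∈ (squares Lˣ).comap Q.incl ↔
    a ∈ squares kˣ ∨ Q.δu * a ∈ squares kˣ := by
  constructor
  · rintro ⟨x, hx⟩
    have hx' : x ^ 2 = Q.incl a := hx
    obtain ⟨b, rfl | hb⟩ := Q.sq_mem_range_incl hx'
    · left
      refine ⟨b, ?_⟩
      rw [← map_pow] at hx'
      exact Units.map_injective (algebraMap k L).injective hx'
    · right
      refine ⟨Q.δu * b, Units.ext ((algebraMap k L).injective ?_)⟩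
      have h1 : (x : L) ^ 2 = algebraMap k L a := by
        rw [← Units.val_pow_eq_pow_val, hx']; rfl
      rw [hb, mul_pow, Q.ρ_sq] at h1
      simp only [powMonoidHom_apply, Units.val_pow_eq_pow_val, Units.val_mul, Units.val_mk0,
        map_mul, map_pow]
      rw [← h1]; ring
  · rintro (⟨b, rfl⟩ | ⟨b, hb⟩)
    · exact ⟨Q.incl b, by simp⟩
    · have hb' : b ^ 2 = Q.δu * a := hb
      refine ⟨Q.incl b * (Units.mk0 Q.ρ Q.ρ_ne_zero)⁻¹, ?_⟩
      have : a = Q.δu⁻¹ * b ^ 2 := by rw [hb']; simp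
      rw [this]
      simp only [powMonoidHom_apply, map_mul, map_pow, map_inv]
      rw [mul_comm]
      congr 2
      apply Units.ext
      simpa using Q.ρ_sq

theorem relIndex_comap_squares : (squares kˣ).relIndex ((squares Lˣ).comap Q.incl) = 2 := by
  rw [Subgroup.relIndex_eq_two_iff]
  have hδ : Q.δu ∉ squares kˣ := by
    rintro ⟨b, hb⟩
    exact Q.δ_not_sq b (by
      have := congrArg Units.val hb
      simpa using this)
  refine ⟨Q.δu, ?_, ?_⟩
  · rw [Q.mem_comap_squares]
    right
    exact ⟨Q.δu, by simp [pow_two]⟩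
  · intro b hb
    rw [Q.mem_comap_squares] at hb
    by_cases h : b ∈ squares kˣ
    · right
      refine ⟨h, fun h' => hδ ((Subgroup.mul_mem_cancel_left _ h).mp ?_)⟩
      exact h'
    · left
      refine ⟨?_, h⟩
      have := hb.resolve_left h
      rwa [mul_comm]

theorem index_formula (hk : OddClass k) :
    (squares (𝓞 L)ˣ).index * Nat.card {x : ClassGroup (𝓞 L) // x ^ 2 = 1} * 2 =
      (squares kˣ).relIndex ((selmerTwo L).comap Q.incl) *
        (squares kˣ).relIndex (selmerTwo k ⊓ Q.norm.range) := by
  rw [← relIndex_squares_selmerTwo]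
  refine relIndex_squares_mul_two _ _ Q.norm_incl (fun _ => Q.hilbert90) Q.relIndex_comap_squares _
    (squares_le_selmerTwo L) _ (squares_le_selmerTwo k) ?_
    (fun g hg hg' => Q.exists_mem_selmerTwo_norm hk hg hg')
  rintro _ ⟨x, hx, rfl⟩
  exact Q.norm_mem_selmerTwo hx

end QuadExt

theorem index_squares_of_basis {G : Type*} [CommGroup G] {r : ℕ}
    (b : Module.Basis (Fin r) ℤ (Additive G)) : (squares G).index = 2 ^ r := by
  let f : Additive G →+ (Fin r → ZMod 2) :=
    { toFun := fun a i => (b.repr a i : ZMod 2)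
      map_zero' := by ext; simp
      map_add' := by intros; ext; simp }
  have hf : Function.Surjective f := by
    intro c
    refine ⟨b.equivFun.symm fun i => (c i).val, ?_⟩
    ext i
    simp only [f, AddMonoidHom.coe_mk, ZeroHom.coe_mk]
    rw [← b.equivFun_apply, LinearEquiv.apply_symm_apply]
    simp
  let g : G →* Multiplicative (Fin r → ZMod 2) := AddMonoidHom.toMultiplicativeRight f
  have hg : Function.Surjective g := fun c => hf c
  have hk : squares G = g.ker := by
    ext x
    constructor
    · rintro ⟨y, rfl⟩
      rw [MonoidHom.mem_ker, powMonoidHom_apply, map_pow]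
      refine congrArg Multiplicative.ofAdd (a₂ := 0) (show 2 • f (Additive.ofMul y) = 0 from ?_)
      ext i
      rw [two_nsmul, Pi.add_apply, CharTwo.add_self_eq_zero, Pi.zero_apply]
    · intro hx
      have hx' : f (Additive.ofMul x) = 0 := hx
      have h2 : ∀ i, (2 : ℤ) ∣ b.repr (Additive.ofMul x) i := fun i =>
        (ZMod.intCast_zmod_eq_zero_iff_dvd _ 2).mp (congrFun hx' i)
      choose c hc using h2
      refine ⟨(b.equivFun.symm c).toMul, ?_⟩
      change (2 • b.equivFun.symm c : Additive G) = Additive.ofMul x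
      rw [← map_nsmul, LinearEquiv.symm_apply_eq]
      ext i
      rw [b.equivFun_apply, hc]
      simp
  rw [hk, Subgroup.index_ker, MonoidHom.range_eq_top.mpr hg, Nat.card_congr Subgroup.topEquiv.toEquiv,
    Nat.card_congr Multiplicative.toAdd]
  simp

theorem index_squares_units (K : Type*) [Field K] [NumberField K] :
    (squares (𝓞 K)ˣ).index = 2 ^ (Units.rank K + 1) := by
  set T := Units.torsion K
  set S := squares (𝓞 K)ˣ
  have hT : ∀ x, x ∈ T ↔ IsOfFinOrder x := fun x => CommGroup.mem_torsion x
  have h1 : S.relIndex T = 2 := by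
    have e : S.subgroupOf T = squares T := by
      ext x
      constructor
      · rintro ⟨y, hy⟩
        have hy' : y ^ 2 = x := hy
        have : y ∈ T := by
          have := x.2
          rw [← hy', hT, isOfFinOrder_pow] at this
          rw [hT]
          exact this.resolve_right two_ne_zero
        exact ⟨⟨y, this⟩, Subtype.ext hy'⟩
      · rintro ⟨y, rfl⟩
        exact ⟨y, by simp⟩
    rw [Subgroup.relIndex, e, Subgroup.index_range]
    have : Nat.card ({1, -1} : Set (𝓞 K)) = 2 := by
      rw [Nat.card_coe_set_eq, Set.ncard_pair]
      intro h
      have : (2 : 𝓞 K) = 0 := by linear_combination h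
      exact two_ne_zero this
    refine (Nat.card_congr (Equiv.ofBijective (β := ({1, -1} : Set (𝓞 K)))
      (fun x : (powMonoidHom 2 : T →* T).ker => ⟨((x : T) : (𝓞 K)ˣ), ?_⟩) ⟨?_, ?_⟩)).trans this
    · have h : (((x : T) : (𝓞 K)ˣ) : 𝓞 K) ^ 2 = 1 := by
        have := x.2
        rw [MonoidHom.mem_ker] at this
        have h2 := congrArg (fun t : T => ((t : (𝓞 K)ˣ) : 𝓞 K)) this
        simpa using h2
      rw [← one_pow 2] at h
      exact sq_eq_sq_iff_eq_or_eq_neg.mp h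
    · intro x y h
      apply Subtype.ext
      apply Subtype.ext
      apply Units.ext
      exact congrArg Subtype.val h
    · rintro ⟨x, rfl | rfl⟩
      · exact ⟨1, by simp⟩
      · exact ⟨⟨⟨-1, by
          rw [hT]
          exact isOfFinOrder_iff_pow_eq_one.mpr ⟨2, by norm_num, by simp⟩⟩, by
          rw [MonoidHom.mem_ker]
          apply Subtype.ext
          simp⟩, by simp⟩
  have h2 : (T ⊔ S).index = 2 ^ Units.rank K := by
    rw [← index_squares_of_basis (Units.basisModTorsion K)]
    rw [← Subgroup.index_comap_of_surjective _ (QuotientGroup.mk'_surjective T)]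
    congr 1
    ext x
    constructor
    · intro hx
      obtain ⟨t, ht, _, ⟨s, rfl⟩, rfl⟩ := Subgroup.mem_sup.mp hx
      refine ⟨(s : (𝓞 K)ˣ ⧸ T), ?_⟩
      exact (QuotientGroup.mk'_eq_mk' T).mpr ⟨t, ht, mul_comm _ _⟩
    · rintro ⟨y, hy⟩
      obtain ⟨y, rfl⟩ := QuotientGroup.mk'_surjective T y
      have hy' : QuotientGroup.mk' T (y ^ 2) = QuotientGroup.mk' T x := by rw [map_pow]; exact hy
      obtain ⟨z, hz, hzx⟩ := (QuotientGroup.mk'_eq_mk' T).mp hy'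
      rw [← hzx]
      exact mul_mem (Subgroup.mem_sup_right ⟨y, rfl⟩) (Subgroup.mem_sup_left hz)
  rw [← Subgroup.relIndex_mul_index (le_sup_right : S ≤ T ⊔ S), h2, Subgroup.relIndex_sup_right, h1,
    pow_succ, mul_comm]

namespace QuadExt

variable {k L : Type*} [Field k] [NumberField k] [Field L] [NumberField L] [Algebra k L]
  (Q : QuadExt k L)

theorem exists_ideal_mul_eq_sq {w : 𝓞 k} (hw : w ≠ 0) {I : Ideal (𝓞 L)}
    (hI : I ^ 2 = Ideal.span {algebraMap (𝓞 k) (𝓞 L) w}) :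
    ∃ 𝔞 𝔟 : Ideal (𝓞 k), 𝔞 ≠ ⊥ ∧ Ideal.span {w} * 𝔟 = 𝔞 ^ 2 ∧
      ∀ (θ : 𝓞 L) (D : 𝓞 k), algebraMap (𝓞 k) (𝓞 L) D = (θ - Q.σR θ) ^ 2 → 𝔟 ∣ Ideal.span {D} := by
  have hw' : algebraMap (𝓞 k) (𝓞 L) w ≠ 0 := fun h =>
    hw (algebraMap_ringOfIntegers_injective (h.trans (map_zero _).symm))
  have hI0 : I ≠ ⊥ := by
    rintro rfl
    rw [← Ideal.zero_eq_bot, zero_pow two_ne_zero, Ideal.zero_eq_bot, eq_comm,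
      Ideal.span_singleton_eq_bot] at hI
    exact hw' hI
  have hconj : Q.conj I = I := by
    apply Ideal.eq_of_sq_eq_sq
    rw [← Ideal.map_pow, hI, Ideal.map_span, Set.image_singleton, Q.σR_algebraMap]
  have hσ : ∀ x ∈ I, Q.σR x ∈ I := fun x hx => by
    rw [← hconj]
    exact Ideal.mem_map_of_mem _ hx
  set 𝔞 := I.comap (algebraMap (𝓞 k) (𝓞 L)) with h𝔞
  have htr : ∀ x ∈ I, x + Q.σR x ∈ 𝔞.map (algebraMap (𝓞 k) (𝓞 L)) := by
    intro x hx
    obtain ⟨c, hc⟩ := Q.fixedR (x := x + Q.σR x) (by rw [map_add, Q.σR_σR, add_comm])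
    rw [← hc]
    apply Ideal.mem_map_of_mem
    rw [h𝔞, Ideal.mem_comap, hc]
    exact I.add_mem hx (hσ x hx)
  obtain ⟨J, hJ⟩ := Ideal.dvd_iff_le.mpr (Ideal.map_comap_le (f := algebraMap (𝓞 k) (𝓞 L)) (K := I))
  rw [← h𝔞] at hJ
  have hJθ : ∀ θ : 𝓞 L, J ∣ Ideal.span {θ - Q.σR θ} := by
    intro θ
    rw [← mul_dvd_mul_iff_left hI0, ← hJ, Ideal.dvd_iff_le, mul_comm, Ideal.span_singleton_mul_le_iff]
    intro t ht
    have e : (θ - Q.σR θ) * t = (θ * t + Q.σR (θ * t)) - Q.σR θ * (t + Q.σR t) := by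
      rw [map_mul]; ring
    rw [e]
    exact Ideal.sub_mem _ (htr _ (I.mul_mem_left _ ht)) (Ideal.mul_mem_left _ _ (htr _ ht))
  have h1 : (𝔞 ^ 2).map (algebraMap (𝓞 k) (𝓞 L)) =
      (Ideal.span {w}).map (algebraMap (𝓞 k) (𝓞 L)) * J ^ 2 := by
    rw [Ideal.map_pow, hJ, mul_pow, hI, Ideal.map_span, Set.image_singleton]
  obtain ⟨𝔟, h𝔟⟩ : Ideal.span {w} ∣ 𝔞 ^ 2 := by
    rw [Ideal.dvd_iff_le]
    apply Ideal.map_le_map_ringOfIntegers (L := L)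
    rw [← Ideal.dvd_iff_le]
    exact ⟨_, h1⟩
  have h𝔟J : 𝔟.map (algebraMap (𝓞 k) (𝓞 L)) = J ^ 2 := by
    rw [h𝔟, Ideal.map_mul] at h1
    refine mul_left_cancel₀ ?_ h1
    rw [Ideal.map_span, Set.image_singleton, Ideal.zero_eq_bot, Ne, Ideal.span_singleton_eq_bot]
    exact hw'
  refine ⟨𝔞, 𝔟, ?_, h𝔟.symm, fun θ D hD => ?_⟩
  · intro h0
    have : w ∈ 𝔞 := by
      rw [h𝔞, Ideal.mem_comap]
      exact Ideal.pow_le_self two_ne_zero (hI ▸ Ideal.mem_span_singleton_self _)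
    rw [h0, Ideal.mem_bot] at this
    exact hw this
  · rw [Ideal.dvd_iff_le]
    apply Ideal.map_le_map_ringOfIntegers (L := L)
    rw [← Ideal.dvd_iff_le, h𝔟J, Ideal.map_span, Set.image_singleton, hD, ← Ideal.span_singleton_pow]
    exact pow_dvd_pow_of_dvd (hJθ θ) 2

/-- `w` and `𝔟` agree up to squares of ideals. -/
def _root_.SqRel {k : Type*} [Field k] (w : kˣ) (𝔟 : Ideal (𝓞 k)) : Prop :=
  ∃ (z : kˣ) (y : 𝓞 k) (𝔞 : Ideal (𝓞 k)), y ≠ 0 ∧ ((w * z ^ 2 : kˣ) : k) = y ∧ 𝔞 ≠ ⊥ ∧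
    Ideal.span {y} * 𝔟 = 𝔞 ^ 2

theorem _root_.SqRel.mul_mem {w w' : kˣ} {𝔟 : Ideal (𝓞 k)} (h : SqRel w 𝔟) (h' : SqRel w' 𝔟) :
    w * w' ∈ selmerTwo k := by
  obtain ⟨z, y, 𝔞, -, hy, h𝔞, e⟩ := h
  obtain ⟨z', y', 𝔞', -, hy', h𝔞', e'⟩ := h'
  have e2 : Ideal.span {y * y'} * 𝔟 ^ 2 = (𝔞 * 𝔞') ^ 2 := by
    rw [mul_pow, ← e, ← e', ← Ideal.span_singleton_mul_span_singleton]
    ring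
  have h𝔟 : 𝔟 ≠ ⊥ := by
    rintro rfl
    rw [Ideal.mul_bot, eq_comm, ← Ideal.zero_eq_bot, pow_eq_zero_iff two_ne_zero] at e
    exact h𝔞 e
  obtain ⟨𝔠, h𝔠⟩ : 𝔟 ∣ 𝔞 * 𝔞' := by
    rw [Ideal.dvd_iff_le]
    apply Ideal.le_of_sq_le_sq
    rw [← Ideal.dvd_iff_le, ← e2]
    exact dvd_mul_left _ _
  have h1 : (w * w') * (z * z') ^ 2 ∈ selmerTwo k := by
    rw [mem_selmerTwo_iff (y := y * y') (by
      change _ = (y : k) * (y' : k)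
      rw [← hy, ← hy', ← Units.val_mul]
      congr 1
      rw [mul_pow]
      exact mul_mul_mul_comm _ _ _ _)]
    refine ⟨𝔠, ?_⟩
    rw [h𝔠, mul_pow, mul_comm] at e2
    exact (mul_left_cancel₀ (pow_ne_zero 2 h𝔟) e2).symm
  exact (Subgroup.mul_mem_cancel_right _ (squares_le_selmerTwo k
    (show (z * z') ^ 2 ∈ squares kˣ from ⟨_, rfl⟩))).mp h1

theorem selmerTwo_le_comap : selmerTwo k ≤ (selmerTwo L).comap Q.incl := by
  intro x hx
  obtain ⟨z, w, y, -, -, hy0, hxy⟩ := exists_integral_mul_sq x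
  obtain ⟨I, hI⟩ := (mem_selmerTwo_iff hxy).mp
    (mul_mem hx (squares_le_selmerTwo k (show z ^ 2 ∈ squares kˣ from ⟨z, rfl⟩)))
  have h1 : Q.incl (x * z ^ 2) ∈ selmerTwo L := by
    rw [mem_selmerTwo_iff (y := algebraMap (𝓞 k) (𝓞 L) y) (by rw [Q.coe_incl, hxy]; rfl)]
    exact ⟨I.map (algebraMap (𝓞 k) (𝓞 L)), by
      rw [← Ideal.map_pow, hI, Ideal.map_span, Set.image_singleton]⟩
  rw [map_mul, map_pow] at h1
  exact (Subgroup.mul_mem_cancel_right _ (squares_le_selmerTwo L ⟨_, rfl⟩)).mp h1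

theorem exists_sqRel {w : kˣ} (hw : w ∈ (selmerTwo L).comap Q.incl) :
    ∃ 𝔟, SqRel w 𝔟 ∧ ∀ (θ : 𝓞 L) (D : 𝓞 k),
      algebraMap (𝓞 k) (𝓞 L) D = (θ - Q.σR θ) ^ 2 → 𝔟 ∣ Ideal.span {D} := by
  obtain ⟨z, -, y, -, -, hy0, hxy⟩ := exists_integral_mul_sq w
  have h1 : Q.incl (w * z ^ 2) ∈ selmerTwo L := by
    rw [map_mul, map_pow]
    exact mul_mem hw (squares_le_selmerTwo L ⟨_, rfl⟩)
  obtain ⟨I, hI⟩ := (mem_selmerTwo_iff (y := algebraMap (𝓞 k) (𝓞 L) y)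
    (by rw [Q.coe_incl, hxy]; rfl)).mp h1
  obtain ⟨𝔞, 𝔟, h𝔞, e, h⟩ := Q.exists_ideal_mul_eq_sq hy0 hI
  exact ⟨𝔟, ⟨z, y, 𝔞, hy0, hxy, h𝔞, e⟩, h⟩

theorem exists_quotient_injection (B : Finset (Ideal (𝓞 k)))
    (hB : ∀ 𝔟, (∀ (θ : 𝓞 L) (D : 𝓞 k), algebraMap (𝓞 k) (𝓞 L) D = (θ - Q.σR θ) ^ 2 →
      𝔟 ∣ Ideal.span {D}) → 𝔟 ∈ B) :
    ∃ g : (selmerTwo L).comap Q.incl ⧸ (selmerTwo k).subgroupOf ((selmerTwo L).comap Q.incl) → B,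
      Function.Injective g := by
  set W := (selmerTwo L).comap Q.incl
  have h : ∀ w : W, ∃ 𝔟 : B, SqRel (w : kˣ) 𝔟 := by
    intro w
    obtain ⟨𝔟, h1, h2⟩ := Q.exists_sqRel w.2
    exact ⟨⟨𝔟, hB 𝔟 h2⟩, h1⟩
  choose f hf using h
  let g : W ⧸ (selmerTwo k).subgroupOf W → B := fun c => f c.out
  have hg : Function.Injective g := by
    intro c c' hcc
    rw [← Quotient.out_eq' c, ← Quotient.out_eq' c']
    apply QuotientGroup.eq.mpr
    rw [Subgroup.mem_subgroupOf]
    have h1 := hf c.out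
    have h2 := hf c'.out
    have hcc' : f c.out = f c'.out := hcc
    rw [hcc'] at h1
    have h3 := h1.mul_mem h2
    have h4 : ((c.out : W) : kˣ) ^ 2 ∈ selmerTwo k := squares_le_selmerTwo k ⟨_, rfl⟩
    have e : (((c.out)⁻¹ * c'.out : W) : kˣ) = (((c.out : W) : kˣ) ^ 2)⁻¹ * ((c.out : W) * (c'.out : W)) := by
      push_cast
      rw [pow_two, mul_inv, mul_assoc, inv_mul_cancel_left]
    have := mul_mem (inv_mem h4) h3
    rw [← e] at this
    exact this
  exact ⟨g, hg⟩

theorem relIndex_selmerTwo_le (B : Finset (Ideal (𝓞 k)))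
    (hB : ∀ 𝔟, (∀ (θ : 𝓞 L) (D : 𝓞 k), algebraMap (𝓞 k) (𝓞 L) D = (θ - Q.σR θ) ^ 2 →
      𝔟 ∣ Ideal.span {D}) → 𝔟 ∈ B) :
    (selmerTwo k).relIndex ((selmerTwo L).comap Q.incl) ≤ B.card := by
  obtain ⟨g, hg⟩ := Q.exists_quotient_injection B hB
  simpa [Subgroup.relIndex, Subgroup.index] using Nat.card_le_card_of_injective g hg

theorem normalizedFactors_finset_prod {s : Finset (Ideal (𝓞 k))} (hs : ∀ 𝔭 ∈ s, Prime 𝔭) :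
    UniqueFactorizationMonoid.normalizedFactors (∏ 𝔭 ∈ s, 𝔭) = s.val := by
  rw [Finset.prod_eq_multiset_prod, Multiset.map_id']
  exact UniqueFactorizationMonoid.normalizedFactors_prod_of_prime fun p hp => hs p hp

theorem relIndex_selmerTwo_eq (hk : OddClass k) (P : Finset (Ideal (𝓞 k)))
    (hP : ∀ 𝔭 ∈ P, Prime 𝔭) (θ : 𝓞 L) (D : 𝓞 k)
    (hD : algebraMap (𝓞 k) (𝓞 L) D = (θ - Q.σR θ) ^ 2) (hDP : Ideal.span {D} = ∏ 𝔭 ∈ P, 𝔭) :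
    (selmerTwo k).relIndex ((selmerTwo L).comap Q.incl) = 2 ^ P.card := by
  classical
  set W := (selmerTwo L).comap Q.incl with hW
  have hmem : ∀ 𝔟, 𝔟 ∣ Ideal.span {D} → 𝔟 ∈ P.powerset.image (fun s => ∏ 𝔭 ∈ s, 𝔭) := by
    intro 𝔟 h𝔟
    have hP0 : ∏ 𝔭 ∈ P, 𝔭 ≠ 0 := Finset.prod_ne_zero_iff.mpr fun p hp => (hP p hp).ne_zero
    rw [hDP] at h𝔟
    have h𝔟0 : 𝔟 ≠ 0 := fun h => hP0 (zero_dvd_iff.mp (h ▸ h𝔟))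
    have h1 := (UniqueFactorizationMonoid.dvd_iff_normalizedFactors_le_normalizedFactors h𝔟0 hP0).mp h𝔟
    rw [normalizedFactors_finset_prod hP] at h1
    rw [Finset.mem_image]
    refine ⟨⟨UniqueFactorizationMonoid.normalizedFactors 𝔟, Multiset.nodup_of_le h1 P.nodup⟩, ?_, ?_⟩
    · rw [Finset.mem_powerset, ← Finset.val_le_iff]
      exact h1
    · rw [Finset.prod_eq_multiset_prod, Multiset.map_id', Ideal.prod_normalizedFactors_eq_self h𝔟0]
  obtain ⟨g, hg⟩ := Q.exists_quotient_injection _ (fun 𝔟 h => hmem 𝔟 (h θ D hD))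
  have hfin : Finite (W ⧸ (selmerTwo k).subgroupOf W) := Finite.of_injective g hg
  apply le_antisymm
  · refine (Q.relIndex_selmerTwo_le _ (fun 𝔟 h => hmem 𝔟 (h θ D hD))).trans ?_
    exact Finset.card_image_le.trans (Finset.card_powerset P).le
  · obtain ⟨H, hH, hp⟩ := hk
    have hs : ∀ s : P.powerset, ∃ (w : W) (a : 𝓞 k), ((w : kˣ) : k) = a ∧
        (∏ 𝔭 ∈ (s : Finset (Ideal (𝓞 k))), 𝔭) ^ H = Ideal.span {a} := by
      rintro ⟨s, hs⟩
      rw [Finset.mem_powerset] at hs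
      set 𝔟 := ∏ 𝔭 ∈ s, 𝔭 with h𝔟
      obtain ⟨a, ha⟩ := hp 𝔟
      have h𝔟0 : 𝔟 ≠ 0 := Finset.prod_ne_zero_iff.mpr fun p hp => (hP p (hs hp)).ne_zero
      have ha0 : a ≠ 0 := by
        rintro rfl
        rw [Ideal.span_singleton_zero] at ha
        exact h𝔟0 (pow_eq_zero_iff hH.pos.ne' |>.mp ha)
      have ha0' : (a : k) ≠ 0 := by simpa using ha0
      refine ⟨⟨Units.mk0 (a : k) ha0', ?_⟩, a, rfl, ha⟩
      rw [hW, Subgroup.mem_comap, mem_selmerTwo_iff (y := algebraMap (𝓞 k) (𝓞 L) a) rfl]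
      set 𝔟' := ∏ 𝔭 ∈ P \ s, 𝔭 with h𝔟'
      have hmul : 𝔟' * 𝔟 = Ideal.span {D} := by rw [hDP, Finset.prod_sdiff hs]
      have hcop : 𝔟 ⊔ 𝔟' = ⊤ := by
        rw [← Ideal.isCoprime_iff_sup_eq]
        refine IsCoprime.prod_left fun p hp => IsCoprime.prod_right fun q hq => ?_
        rw [Finset.mem_sdiff] at hq
        have hp' := hP p (hs hp)
        have hq' := hP q hq.1
        have := (Ideal.isPrime_of_prime hp').isMaximal hp'.ne_zero
        have := (Ideal.isPrime_of_prime hq').isMaximal hq'.ne_zero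
        exact Ideal.isCoprime_of_isMaximal (by rintro rfl; exact hq.2 hp)
      set A := 𝔟.map (algebraMap (𝓞 k) (𝓞 L)) with hA
      set A' := 𝔟'.map (algebraMap (𝓞 k) (𝓞 L)) with hA'
      set R := Ideal.span {θ - Q.σR θ} with hR
      have hR2 : R * R = A' * A := by
        rw [← Ideal.map_mul, hmul, Ideal.map_span, Set.image_singleton, hD, hR,
          Ideal.span_singleton_mul_span_singleton, pow_two]
      have hAA : A ⊔ A' = ⊤ := by rw [← Ideal.map_sup, hcop, Ideal.map_top]
      have hC : (A ⊔ R) ^ 2 = A := by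
        calc (A ⊔ R) ^ 2 = A * A ⊔ A * R ⊔ (R * A ⊔ R * R) := by
              rw [pow_two, Ideal.sup_mul, Ideal.mul_sup, Ideal.mul_sup]
          _ = A * (A ⊔ A' ⊔ R) := by
              rw [hR2, mul_comm R A, mul_comm A' A, Ideal.mul_sup, Ideal.mul_sup]
              apply le_antisymm
              · refine sup_le (sup_le ?_ ?_) (sup_le ?_ ?_)
                · exact le_sup_left.trans le_sup_left
                · exact le_sup_right
                · exact le_sup_right
                · exact le_sup_right.trans le_sup_left
              · refine sup_le (sup_le ?_ ?_) ?_
                · exact le_sup_left.trans le_sup_left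
                · exact le_sup_right.trans le_sup_right
                · exact le_sup_left.trans le_sup_right
          _ = A := by rw [hAA, top_sup_eq, Ideal.mul_top]
      refine ⟨(A ⊔ R) ^ H, ?_⟩
      rw [← pow_mul, mul_comm H, pow_mul, hC, hA, ← Ideal.map_pow, ha, Ideal.map_span,
        Set.image_singleton]
    choose w a hwa hsa using hs
    let f : P.powerset → W ⧸ (selmerTwo k).subgroupOf W := fun s => QuotientGroup.mk (w s)
    have hf : Function.Injective f := by
      intro s t hst
      have h1 := QuotientGroup.eq.mp hst
      rw [Subgroup.mem_subgroupOf] at h1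
      have h4 : ((w s : W) : kˣ) ^ 2 ∈ selmerTwo k := squares_le_selmerTwo k ⟨_, rfl⟩
      have h5 := mul_mem h4 h1
      have e : ((w s : W) : kˣ) ^ 2 * (((w s)⁻¹ * w t : W) : kˣ) = (w s : kˣ) * (w t : kˣ) := by
        push_cast
        rw [pow_two, mul_assoc, mul_inv_cancel_left]
      have h6 : (w s : kˣ) * (w t : kˣ) ∈ selmerTwo k := by
        rw [← e]; exact h5
      rw [mem_selmerTwo_iff (y := a s * a t) (by
        rw [Units.val_mul, hwa, hwa]; rfl)] at h6
      obtain ⟨𝔠, h𝔠⟩ := h6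
      rw [← Ideal.span_singleton_mul_span_singleton, ← hsa, ← hsa] at h𝔠
      have hsP := Finset.mem_powerset.mp s.2
      have htP := Finset.mem_powerset.mp t.2
      have hs0 : ∏ 𝔭 ∈ (s : Finset (Ideal (𝓞 k))), 𝔭 ≠ 0 :=
        Finset.prod_ne_zero_iff.mpr fun p hp => (hP p (hsP hp)).ne_zero
      have ht0 : ∏ 𝔭 ∈ (t : Finset (Ideal (𝓞 k))), 𝔭 ≠ 0 :=
        Finset.prod_ne_zero_iff.mpr fun p hp => (hP p (htP hp)).ne_zero
      have h7 := congrArg UniqueFactorizationMonoid.normalizedFactors h𝔠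
      rw [UniqueFactorizationMonoid.normalizedFactors_mul (pow_ne_zero _ hs0) (pow_ne_zero _ ht0),
        UniqueFactorizationMonoid.normalizedFactors_pow, UniqueFactorizationMonoid.normalizedFactors_pow,
        UniqueFactorizationMonoid.normalizedFactors_pow,
        normalizedFactors_finset_prod fun p hp => hP p (hsP hp),
        normalizedFactors_finset_prod fun p hp => hP p (htP hp)] at h7
      apply Subtype.ext
      ext p
      have h8 := congrArg (Multiset.count p) h7
      rw [Multiset.count_nsmul, Multiset.count_add, Multiset.count_nsmul, Multiset.count_nsmul] at h8
      obtain ⟨m, rfl⟩ := hH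
      have hcs := Multiset.nodup_iff_count_le_one.mp (s : Finset (Ideal (𝓞 k))).nodup p
      have hct := Multiset.nodup_iff_count_le_one.mp (t : Finset (Ideal (𝓞 k))).nodup p
      rw [← Finset.mem_val, ← Finset.mem_val, ← Multiset.one_le_count_iff_mem,
        ← Multiset.one_le_count_iff_mem]
      generalize Multiset.count p (s : Finset (Ideal (𝓞 k))).val = x at *
      generalize Multiset.count p (t : Finset (Ideal (𝓞 k))).val = y at *
      generalize Multiset.count p _ = c at *
      interval_cases x <;> interval_cases y <;> omega
    have := Nat.card_le_card_of_injective f hf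
    rw [Nat.card_eq_fintype_card (α := P.powerset), Fintype.card_coe, Finset.card_powerset] at this
    exact this

end QuadExt

section ConstructQuadExt

variable {k L : Type*} [Field k] [CharZero k] [Field L] [Algebra k L]

theorem exists_quadExt (ρ : L) (δ : k) (hρ : ρ ^ 2 = algebraMap k L δ) (hδ : ∀ a : k, a ^ 2 ≠ δ)
    (hgen : ∀ x : L, ∃ a b : k, x = algebraMap k L a + algebraMap k L b * ρ) :
    ∃ Q : QuadExt k L, Q.δ = δ ∧ Q.ρ = ρ := by
  have hinj := (algebraMap k L).injective
  have huniq : ∀ a b a' b' : k, algebraMap k L a + algebraMap k L b * ρ =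
      algebraMap k L a' + algebraMap k L b' * ρ → a = a' ∧ b = b' := by
    intro a b a' b' h
    by_cases hb : b = b'
    · subst hb
      exact ⟨hinj (add_right_cancel h), rfl⟩
    · exfalso
      have hb' : b' - b ≠ 0 := sub_ne_zero.mpr (Ne.symm hb)
      apply hδ ((a - a') / (b' - b))
      apply hinj
      have hb2 : algebraMap k L b' - algebraMap k L b ≠ 0 := by
        rw [← map_sub]; exact (map_ne_zero _).mpr hb'
      rw [← hρ, map_pow, map_div₀, map_sub, map_sub]
      congr 1
      rw [div_eq_iff hb2]
      linear_combination h
  choose A B hAB using hgen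
  have hA : ∀ a b, A (algebraMap k L a + algebraMap k L b * ρ) = a := fun a b =>
    (huniq _ _ _ _ (hAB (algebraMap k L a + algebraMap k L b * ρ))).1.symm
  have hB : ∀ a b, B (algebraMap k L a + algebraMap k L b * ρ) = b := fun a b =>
    (huniq _ _ _ _ (hAB (algebraMap k L a + algebraMap k L b * ρ))).2.symm
  let f : L → L := fun x => algebraMap k L (A x) - algebraMap k L (B x) * ρ
  have hf : ∀ a b, f (algebraMap k L a + algebraMap k L b * ρ) =
      algebraMap k L a - algebraMap k L b * ρ := fun a b => by simp only [f, hA, hB]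
  let φ : L →ₐ[k] L :=
    { toFun := f
      map_one' := by simpa using hf 1 0
      map_zero' := by simpa using hf 0 0
      map_mul' := fun x y => by
        rw [hAB x, hAB y, hf, hf]
        have : (algebraMap k L (A x) + algebraMap k L (B x) * ρ) *
            (algebraMap k L (A y) + algebraMap k L (B y) * ρ) =
            algebraMap k L (A x * A y + B x * B y * δ) +
              algebraMap k L (A x * B y + B x * A y) * ρ := by
          simp only [map_add, map_mul]
          linear_combination algebraMap k L (B x) * algebraMap k L (B y) * hρ
        rw [this, hf]
        simp only [map_add, map_mul]
        linear_combination - algebraMap k L (B x) * algebraMap k L (B y) * hρ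
      map_add' := fun x y => by
        rw [hAB x, hAB y, hf, hf]
        have : (algebraMap k L (A x) + algebraMap k L (B x) * ρ) +
            (algebraMap k L (A y) + algebraMap k L (B y) * ρ) =
            algebraMap k L (A x + A y) + algebraMap k L (B x + B y) * ρ := by
          simp only [map_add]
          ring
        rw [this, hf]
        simp only [map_add]
        ring
      commutes' := fun a => by simpa using hf a 0 }
  have hφ : ∀ a b, φ (algebraMap k L a + algebraMap k L b * ρ) =
      algebraMap k L a - algebraMap k L b * ρ := hf
  have hφφ : ∀ x, φ (φ x) = x := by
    intro x
    rw [hAB x, hφ]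
    have := hφ (A x) (- B x)
    simp only [map_neg, neg_mul, sub_neg_eq_add, ← sub_eq_add_neg] at this
    exact this
  have hρ0 : ρ ≠ 0 := by
    rintro rfl
    refine hδ 0 (hinj ?_)
    rw [← hρ, map_pow, map_zero]
  have hid : φ.comp φ = AlgHom.id k L := AlgHom.ext hφφ
  refine ⟨⟨AlgEquiv.ofAlgHom φ φ hid hid, δ, ρ, hφφ, ?_, hρ, ?_, hρ0⟩, rfl, rfl⟩
  · intro x hx
    have hx' : φ x = x := hx
    rw [hAB x, hφ] at hx'
    refine ⟨A x, ?_⟩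
    have : (2 : L) * (algebraMap k L (B x) * ρ) = 0 := by linear_combination - hx'
    have h2 : (2 : L) ≠ 0 := by
      have : (2 : L) = algebraMap k L 2 := by rw [map_ofNat]
      rw [this]
      exact (map_ne_zero _).mpr two_ne_zero
    have h3 := (mul_eq_zero.mp this).resolve_left h2
    conv_rhs => rw [hAB x, h3, add_zero]
  · have := hφ 0 1
    simpa using this

end ConstructQuadExt

namespace QuadExt

variable {k L : Type*} [Field k] [NumberField k] [Field L] [NumberField L] [Algebra k L]
  (Q : QuadExt k L)

theorem exists_coords (x : L) : ∃ a b : k, x = algebraMap k L a + algebraMap k L b * Q.ρ := by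
  obtain ⟨a, ha⟩ := Q.fixed (x + Q.σ x) (by rw [map_add, Q.σ_σ, add_comm])
  obtain ⟨b, hb⟩ := Q.fixed ((x - Q.σ x) * Q.ρ)
    (by rw [map_mul, map_sub, Q.σ_σ, Q.σ_ρ]; ring)
  refine ⟨a / 2, b / (2 * Q.δ), ?_⟩
  rw [map_div₀, map_div₀, map_mul, map_ofNat, ha, hb, ← Q.ρ_sq]
  field_simp [Q.ρ_ne_zero]
  ring

theorem finrank_eq_two (Q : QuadExt k L) : Module.finrank k L = 2 := by
  have hli : LinearIndependent k ![(1 : L), Q.ρ] := by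
    rw [LinearIndependent.pair_iff]
    intro s t h
    rw [Algebra.smul_def, Algebra.smul_def, mul_one] at h
    have h' := congrArg Q.σ h
    rw [map_add, map_mul, Q.σ.commutes, Q.σ.commutes, Q.σ_ρ, map_zero] at h'
    have h1 : algebraMap k L (2 * s) = 0 := by
      rw [map_mul, map_ofNat]; linear_combination h + h'
    have hs : s = 0 := by simpa using h1
    subst hs
    rw [map_zero, zero_add, mul_eq_zero] at h
    exact ⟨rfl, by simpa using h.resolve_right Q.ρ_ne_zero⟩
  let b := Module.Basis.mk hli (by
    intro x _
    obtain ⟨a, b, h⟩ := Q.exists_coords x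
    rw [h]
    refine add_mem ?_ ?_
    · rw [Algebra.algebraMap_eq_smul_one]
      exact Submodule.smul_mem _ _ (Submodule.subset_span ⟨0, rfl⟩)
    · rw [← Algebra.smul_def]
      exact Submodule.smul_mem _ _ (Submodule.subset_span ⟨1, rfl⟩))
  rw [Module.finrank_eq_card_basis b, Fintype.card_fin]

end QuadExt

section UnitRank

open InfinitePlace

theorem nrRealPlaces_pos_of_embedding {K : Type*} [Field K] [NumberField K] (φ : K →+* ℝ) :
    0 < nrRealPlaces K := by
  classical
  refine Fintype.card_pos_iff.mpr ⟨⟨InfinitePlace.mk (Complex.ofRealHom.comp φ), ?_⟩⟩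
  rw [isReal_mk_iff, ComplexEmbedding.isReal_iff]
  ext x
  simp [ComplexEmbedding.conjugate]

theorem rank_eq_zero_of_finrank_one {K : Type*} [Field K] [NumberField K]
    (h : Module.finrank ℚ K = 1) : Units.rank K = 0 := by
  have h1 := card_add_two_mul_card_eq_rank K
  have h2 := card_eq_nrRealPlaces_add_nrComplexPlaces K
  rw [Units.rank]
  omega

theorem rank_eq_one_of_finrank_two {K : Type*} [Field K] [NumberField K]
    (h : Module.finrank ℚ K = 2) (φ : K →+* ℝ) : Units.rank K = 1 := by
  have h1 := card_add_two_mul_card_eq_rank K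
  have h2 := card_eq_nrRealPlaces_add_nrComplexPlaces K
  have h3 := nrRealPlaces_pos_of_embedding φ
  rw [Units.rank]
  omega

theorem two_le_rank_of_finrank_four {K : Type*} [Field K] [NumberField K]
    (h : Module.finrank ℚ K = 4) (φ : K →+* ℝ) : 2 ≤ Units.rank K := by
  have h1 := card_add_two_mul_card_eq_rank K
  have h2 := card_eq_nrRealPlaces_add_nrComplexPlaces K
  have h3 := nrRealPlaces_pos_of_embedding φ
  rw [Units.rank]
  omega

theorem rank_of_isTotallyReal {K : Type*} [Field K] [NumberField K] [IsTotallyReal K] :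
    Units.rank K = Module.finrank ℚ K - 1 := by
  have h1 := card_add_two_mul_card_eq_rank K
  have h2 := card_eq_nrRealPlaces_add_nrComplexPlaces K
  have h3 := IsTotallyReal.nrComplexPlaces_eq_zero K
  rw [Units.rank]
  omega

end UnitRank

section RationalBase

instance : IsPrincipalIdealRing (𝓞 ℚ) :=
  IsPrincipalIdealRing.of_surjective Rat.ringOfIntegersEquiv.symm.toRingHom
    Rat.ringOfIntegersEquiv.symm.surjective

theorem oddClass_of_isPrincipalIdealRing {k : Type*} [Field k] [NumberField k]
    [IsPrincipalIdealRing (𝓞 k)] : OddClass k :=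
  ⟨1, odd_one, fun I => by
    obtain ⟨a, ha⟩ := (IsPrincipalIdealRing.principal I).principal
    exact ⟨a, by rw [pow_one]; exact ha⟩⟩

theorem relIndex_squares_selmerTwo_of_card_eq_one {k : Type*} [Field k] [NumberField k]
    (h : Nat.card {x : ClassGroup (𝓞 k) // x ^ 2 = 1} = 1) :
    (squares kˣ).relIndex (selmerTwo k) = 2 ^ (Units.rank k + 1) := by
  rw [relIndex_squares_selmerTwo, h, mul_one, index_squares_units]

theorem relIndex_squares_selmerTwo_rat : (squares ℚˣ).relIndex (selmerTwo ℚ) = 2 := by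
  have h : classNumber ℚ = 1 := classNumber_eq_one_iff.mpr inferInstance
  have := Fintype.card_le_one_iff_subsingleton.mp h.le
  have h1 : Nat.card {x : ClassGroup (𝓞 ℚ) // x ^ 2 = 1} = 1 :=
    Nat.card_of_subsingleton (⟨1, one_pow 2⟩ : {x : ClassGroup (𝓞 ℚ) // x ^ 2 = 1})
  rw [relIndex_squares_selmerTwo_of_card_eq_one h1, rank_eq_zero_of_finrank_one
    (Module.finrank_self ℚ)]
  norm_num

end RationalBase

theorem exists_integer_of_sq_eq {K : Type*} [Field K] {x : K} {b c : 𝓞 K}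
    (h : x ^ 2 = b * x + c) : ∃ y : 𝓞 K, (y : K) = x := by
  have h1 : IsIntegral (𝓞 K) x := by
    refine ⟨Polynomial.X ^ 2 - (Polynomial.C b * Polynomial.X + Polynomial.C c), ?_, ?_⟩
    · exact Polynomial.monic_X_pow_sub Polynomial.degree_linear_lt
    · simp only [Polynomial.eval₂_sub, Polynomial.eval₂_add, Polynomial.eval₂_mul,
        Polynomial.eval₂_pow, Polynomial.eval₂_X, Polynomial.eval₂_C]
      exact sub_eq_zero.mpr h
  exact ⟨⟨x, isIntegral_trans x h1⟩, rfl⟩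

theorem mem_of_relIndex_eq_four {G : Type*} [CommGroup G] {S V : Subgroup G}
    (h : S.relIndex V = 4) (hS : squares G ≤ S) {a b x : G} (haV : a ∈ V) (hbV : b ∈ V)
    (ha : a ∉ S) (hb : b ∉ S) (hab : a * b ∉ S) (hx : x ∈ V) :
    x ∈ S ∨ a * x ∈ S ∨ b * x ∈ S ∨ a * b * x ∈ S := by
  classical
  have key : ∀ y (hy : y ∈ V), (QuotientGroup.mk ⟨y, hy⟩ : V ⧸ S.subgroupOf V) = 1 ↔ y ∈ S :=
    fun y hy => by rw [QuotientGroup.eq_one_iff, Subgroup.mem_subgroupOf]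
  have hcard : Nat.card (V ⧸ S.subgroupOf V) = 4 := h
  have : Finite (V ⧸ S.subgroupOf V) := Nat.finite_of_card_ne_zero (by omega)
  have := Fintype.ofFinite (V ⧸ S.subgroupOf V)
  rw [Nat.card_eq_fintype_card] at hcard
  have hsq : ∀ z : V ⧸ S.subgroupOf V, z * z = 1 := by
    intro z
    induction z using QuotientGroup.induction_on with
    | H z =>
      rw [← QuotientGroup.mk_mul, QuotientGroup.eq_one_iff, Subgroup.mem_subgroupOf]
      exact hS ⟨z, by simp [pow_two]⟩
  set A : V ⧸ S.subgroupOf V := QuotientGroup.mk ⟨a, haV⟩ with hA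
  set B : V ⧸ S.subgroupOf V := QuotientGroup.mk ⟨b, hbV⟩ with hB
  set X : V ⧸ S.subgroupOf V := QuotientGroup.mk ⟨x, hx⟩ with hX
  have hA1 : A ≠ 1 := fun h => ha ((key _ _).mp h)
  have hB1 : B ≠ 1 := fun h => hb ((key _ _).mp h)
  have hAB1 : A * B ≠ 1 := fun h => hab ((key _ (mul_mem haV hbV)).mp h)
  have hAB : A ≠ B := fun h => hAB1 (by rw [h, hsq])
  have hcard' : ({1, A, B, A * B} : Finset (V ⧸ S.subgroupOf V)).card = 4 := by
    rw [Finset.card_insert_of_notMem, Finset.card_insert_of_notMem, Finset.card_pair]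
    · intro h; exact hA1 (mul_eq_right.mp h.symm)
    · simp only [Finset.mem_insert, Finset.mem_singleton, not_or]
      exact ⟨hAB, fun h => hB1 (mul_eq_left.mp h.symm)⟩
    · simp only [Finset.mem_insert, Finset.mem_singleton, not_or]
      exact ⟨hA1.symm, hB1.symm, hAB1.symm⟩
  have huniv := (Finset.card_eq_iff_eq_univ _).mp (hcard'.trans hcard.symm)
  have hXm : X ∈ ({1, A, B, A * B} : Finset (V ⧸ S.subgroupOf V)) := by
    rw [huniv]; exact Finset.mem_univ _
  simp only [Finset.mem_insert, Finset.mem_singleton] at hXm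
  rcases hXm with h | h | h | h
  · exact Or.inl ((key _ _).mp h)
  · refine Or.inr (Or.inl ((key _ (mul_mem haV hx)).mp ?_))
    change A * X = 1
    rw [h, hsq]
  · refine Or.inr (Or.inr (Or.inl ((key _ (mul_mem hbV hx)).mp ?_)))
    change B * X = 1
    rw [h, hsq]
  · refine Or.inr (Or.inr (Or.inr ((key _ (mul_mem (mul_mem haV hbV) hx)).mp ?_)))
    change A * B * X = 1
    rw [h, hsq]

namespace QuadExt

variable {k L : Type*} [Field k] [NumberField k] [Field L] [NumberField L] [Algebra k L]
  (Q : QuadExt k L)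

theorem squares_le_norm_range : squares kˣ ≤ Q.norm.range := by
  rintro _ ⟨x, rfl⟩
  exact ⟨Q.incl x, Q.norm_incl x⟩

theorem relIndex_comap_selmerTwo : (squares kˣ).relIndex ((selmerTwo L).comap Q.incl) =
    (squares kˣ).relIndex (selmerTwo k) *
      (selmerTwo k).relIndex ((selmerTwo L).comap Q.incl) :=
  (Subgroup.relIndex_mul_relIndex _ _ _ (squares_le_selmerTwo k) Q.selmerTwo_le_comap).symm

theorem relIndex_inf_norm_mul : (squares kˣ).relIndex (selmerTwo k ⊓ Q.norm.range) *
    (selmerTwo k ⊓ Q.norm.range).relIndex (selmerTwo k) =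
      (squares kˣ).relIndex (selmerTwo k) :=
  Subgroup.relIndex_mul_relIndex _ _ _
    (le_inf (squares_le_selmerTwo k) Q.squares_le_norm_range) inf_le_left

theorem relIndex_selmerTwo_le_of_dvd_prime_pow {𝔭 : Ideal (𝓞 k)} (hp : Prime 𝔭) (n : ℕ)
    (h : ∀ 𝔟 : Ideal (𝓞 k), (∀ θ : 𝓞 L, ∀ D : 𝓞 k,
      algebraMap (𝓞 k) (𝓞 L) D = (θ - Q.σR θ) ^ 2 → 𝔟 ∣ Ideal.span {D}) → 𝔟 ∣ 𝔭 ^ n) :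
    (selmerTwo k).relIndex ((selmerTwo L).comap Q.incl) ≤ n + 1 := by
  classical
  refine (Q.relIndex_selmerTwo_le ((Finset.range (n + 1)).image (𝔭 ^ ·)) ?_).trans
    (Finset.card_image_le.trans (Finset.card_range _).le)
  intro 𝔟 h𝔟
  obtain ⟨i, hi, hi'⟩ := (dvd_prime_pow hp n).mp (h 𝔟 h𝔟)
  exact Finset.mem_image.mpr ⟨i, Finset.mem_range.mpr (Nat.lt_succ_of_le hi),
    (associated_iff_eq.mp hi').symm⟩

theorem mem_norm_range_iff {g : kˣ} :
    g ∈ Q.norm.range ↔ ∃ a b : k, a ^ 2 - Q.δ * b ^ 2 = g := by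
  constructor
  · rintro ⟨x, hx⟩
    obtain ⟨a, b, hab⟩ := Q.exists_coords x
    refine ⟨a, b, (algebraMap k L).injective ?_⟩
    rw [norm_eq_iff] at hx
    rw [← hx, hab, map_add, map_mul, Q.σ.commutes, Q.σ.commutes, Q.σ_ρ, map_sub, map_mul, map_pow,
      map_pow, ← Q.ρ_sq]
    ring
  · rintro ⟨a, b, hab⟩
    have hne : algebraMap k L a + algebraMap k L b * Q.ρ ≠ 0 := by
      intro h0
      have h1 : (algebraMap k L a + algebraMap k L b * Q.ρ) *
          (algebraMap k L a - algebraMap k L b * Q.ρ) = algebraMap k L g := by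
        rw [← hab, map_sub, map_mul, map_pow, map_pow, ← Q.ρ_sq]
        ring
      rw [h0, zero_mul] at h1
      exact g.ne_zero ((map_eq_zero _).mp h1.symm)
    refine ⟨Units.mk0 _ hne, ?_⟩
    rw [norm_eq_iff, Units.val_mk0, map_add, map_mul, Q.σ.commutes, Q.σ.commutes, Q.σ_ρ, ← hab,
      map_sub, map_mul, map_pow, map_pow, ← Q.ρ_sq]
    ring

end QuadExt

section QuadraticField

theorem nat_card_sq_eq_one_pos (k : Type*) [Field k] [NumberField k] :
    0 < Nat.card {x : ClassGroup (𝓞 k) // x ^ 2 = 1} := by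
  have : Nonempty {x : ClassGroup (𝓞 k) // x ^ 2 = 1} := ⟨⟨1, one_pow 2⟩⟩
  exact Nat.card_pos

theorem card_twoTorsion_quadratic {k : Type*} [Field k] [NumberField k] (Q : QuadExt ℚ k)
    {l : ℕ} (hl : l.Prime) (hl4 : l % 4 = 1) (hδ : Q.δ = l) (φ : k →+* ℝ) :
    Nat.card {x : ClassGroup (𝓞 k) // x ^ 2 = 1} = 1 := by
  classical
  have h1 := Q.index_formula oddClass_of_isPrincipalIdealRing
  have hr : Units.rank k = 1 := rank_eq_one_of_finrank_two Q.finrank_eq_two φ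
  have h2 := Q.relIndex_inf_norm_mul
  rw [index_squares_units, hr, Q.relIndex_comap_selmerTwo, relIndex_squares_selmerTwo_rat] at h1
  rw [relIndex_squares_selmerTwo_rat] at h2
  have h3 : (squares ℚˣ).relIndex (selmerTwo ℚ ⊓ Q.norm.range) ≤ 2 :=
    Nat.le_of_dvd two_pos (Dvd.intro _ h2)
  obtain ⟨θ, hθ⟩ : ∃ θ : 𝓞 k, (θ : k) = (1 + Q.ρ) / 2 := by
    refine exists_integer_of_sq_eq (b := 1) (c := ((l / 4 : ℕ) : 𝓞 k)) ?_
    have h4 : Q.ρ ^ 2 = (4 * (l / 4 : ℕ) + 1 : k) := by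
      rw [Q.ρ_sq, hδ, map_natCast]
      have : l = 4 * (l / 4) + 1 := by omega
      exact_mod_cast this
    have h5 : (((l / 4 : ℕ) : 𝓞 k) : k) = ((l / 4 : ℕ) : k) := map_natCast (algebraMap (𝓞 k) k) _
    have h6 : ((1 : 𝓞 k) : k) = 1 := map_one _
    rw [h5, h6]
    linear_combination h4 / 4
  have hprime : Prime (Ideal.span {(l : 𝓞 ℚ)}) := by
    rw [Ideal.prime_span_singleton_iff]
    have := (MulEquiv.prime_iff Rat.ringOfIntegersEquiv.symm (p := (l : ℤ))).mpr
      (Nat.prime_iff_prime_int.mp hl)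
    rwa [map_natCast] at this
  have h4 : (selmerTwo ℚ).relIndex ((selmerTwo k).comap Q.incl) ≤ 2 := by
    refine Q.relIndex_selmerTwo_le_of_dvd_prime_pow hprime 1 ?_
    intro 𝔟 h𝔟
    have h5 := h𝔟 θ (l : 𝓞 ℚ) (by
      apply RingOfIntegers.ext
      change ((algebraMap (𝓞 ℚ) (𝓞 k) (l : 𝓞 ℚ) : 𝓞 k) : k) = ((θ : k) - (Q.σR θ : k)) ^ 2
      have h6 : ((algebraMap (𝓞 ℚ) (𝓞 k) (l : 𝓞 ℚ) : 𝓞 k) : k) = (l : k) := by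
        rw [map_natCast]; exact map_natCast (algebraMap (𝓞 k) k) _
      have h7 : Q.σ (2 : k) = 2 := map_ofNat Q.σ 2
      rw [h6, Q.coe_σR, hθ, map_div₀, map_add, map_one, Q.σ_ρ, h7]
      have h4 : Q.ρ ^ 2 = (l : k) := by rw [Q.ρ_sq, hδ, map_natCast]
      linear_combination - h4)
    rwa [pow_one]
  have h5 := nat_card_sq_eq_one_pos k
  have : 2 * (selmerTwo ℚ).relIndex ((selmerTwo k).comap Q.incl) *
      (squares ℚˣ).relIndex (selmerTwo ℚ ⊓ Q.norm.range) ≤ 4 * 2 :=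
    Nat.mul_le_mul (by omega) h3
  omega

end QuadraticField

namespace IntegerCast

variable {K : Type*} [Field K]

theorem coe_add (x y : 𝓞 K) : ((x + y : 𝓞 K) : K) = x + y := rfl
theorem coe_sub (x y : 𝓞 K) : ((x - y : 𝓞 K) : K) = x - y := rfl
theorem coe_mul (x y : 𝓞 K) : ((x * y : 𝓞 K) : K) = x * y := rfl
theorem coe_neg (x : 𝓞 K) : ((-x : 𝓞 K) : K) = -x := rfl
theorem coe_pow (x : 𝓞 K) (n : ℕ) : ((x ^ n : 𝓞 K) : K) = x ^ n := rfl
theorem coe_one : ((1 : 𝓞 K) : K) = 1 := rfl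
theorem coe_zero : ((0 : 𝓞 K) : K) = 0 := rfl
theorem coe_natCast (n : ℕ) : ((n : 𝓞 K) : K) = n := map_natCast (algebraMap (𝓞 K) K) n
theorem coe_intCast (n : ℤ) : ((n : 𝓞 K) : K) = n := map_intCast (algebraMap (𝓞 K) K) n
theorem coe_ofNat (n : ℕ) [n.AtLeastTwo] : ((OfNat.ofNat n : 𝓞 K) : K) = OfNat.ofNat n :=
  map_ofNat (algebraMap (𝓞 K) K) n

end IntegerCast

open IntegerCast

/-- A real quadratic field `k = ℚ(√l)`, `l ≡ 1 (mod 8)` prime, together with a unit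
`u + v √l` of norm `-1`, normalised so that `4 ∣ u` and `v ≡ 1 (mod 4)`. -/
structure RealQuad (k : Type*) [Field k] [NumberField k] where
  Q : QuadExt ℚ k
  l : ℕ
  c : ℕ
  u : ℤ
  v : ℤ
  φ : k →+* ℝ
  prime_l : l.Prime
  l_eq : l = 8 * c + 1
  δ_eq : Q.δ = l
  φ_pos : 0 < φ Q.ρ
  norm_eq : u ^ 2 - l * v ^ 2 = -1
  u_mod : u % 4 = 0
  v_mod : v % 4 = 1
  u_pos : 0 < u
  v_pos : 0 < v

namespace RealQuad

variable {k : Type*} [Field k] [NumberField k] (R : RealQuad k)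

theorem ρ_sq : R.Q.ρ ^ 2 = R.l := by rw [R.Q.ρ_sq, R.δ_eq, map_natCast]

theorem exists_s : ∃ s : 𝓞 k, (s : k) = R.Q.ρ :=
  exists_integer_of_sq_eq (b := 0) (c := (R.l : 𝓞 k)) (by
    have h5 : ((R.l : 𝓞 k) : k) = R.l := map_natCast (algebraMap (𝓞 k) k) _
    have h6 : ((0 : 𝓞 k) : k) = 0 := map_zero _
    rw [R.ρ_sq, h5, h6]; ring)

/-- The square root of `l`. -/
noncomputable def s : 𝓞 k := R.exists_s.choose

theorem coe_s : (R.s : k) = R.Q.ρ := R.exists_s.choose_spec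

theorem s_sq : R.s ^ 2 = R.l := by
  apply RingOfIntegers.ext
  have h5 : ((R.l : 𝓞 k) : k) = R.l := map_natCast (algebraMap (𝓞 k) k) _
  rw [h5, ← R.ρ_sq, ← R.coe_s]
  rfl

theorem l_cast {A : Type*} [Ring A] : (R.l : A) = 8 * R.c + 1 := by
  have := R.l_eq
  exact_mod_cast congrArg (Nat.cast : ℕ → A) this

theorem l_ne_zero {A : Type*} [Ring A] [CharZero A] : (R.l : A) ≠ 0 :=
  Nat.cast_ne_zero.mpr R.prime_l.ne_zero

theorem s_ne_zero : R.s ≠ 0 := by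
  intro h
  have := R.s_sq
  rw [h, zero_pow two_ne_zero] at this
  exact R.l_ne_zero this.symm

theorem exists_ω : ∃ w : 𝓞 k, 2 * w = 1 + R.s := by
  obtain ⟨w, hw⟩ := exists_integer_of_sq_eq (x := (1 + R.Q.ρ) / 2) (b := 1)
    (c := (2 * (R.c : 𝓞 k))) (by
    have h5 : ((2 * (R.c : 𝓞 k) : 𝓞 k) : k) = 2 * R.c := by
      rw [coe_mul, coe_natCast, coe_ofNat]
    have h6 : ((1 : 𝓞 k) : k) = 1 := map_one _
    have := R.ρ_sq
    rw [R.l_cast] at this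
    rw [h5, h6]
    linear_combination this / 4)
  refine ⟨w, RingOfIntegers.ext ?_⟩
  rw [coe_mul, coe_add, coe_one, coe_ofNat, hw, R.coe_s]
  ring

/-- The integer `(1 + √l) / 2`. -/
noncomputable def ω : 𝓞 k := R.exists_ω.choose

theorem two_mul_ω : 2 * R.ω = 1 + R.s := R.exists_ω.choose_spec

theorem ω_sq : R.ω ^ 2 = R.ω + 2 * R.c := by
  have h4 : (4 : 𝓞 k) ≠ 0 := by norm_num
  apply mul_left_cancel₀ h4
  have h1 := R.two_mul_ω
  have h2 := R.s_sq
  rw [R.l_cast] at h2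
  linear_combination (2 * R.ω - 1 + R.s) * h1 + h2

/-- The nontrivial automorphism on integers. -/
noncomputable abbrev τ : 𝓞 k ≃+* 𝓞 k := R.Q.σR

theorem τ_s : R.τ R.s = -R.s := by
  apply RingOfIntegers.ext
  rw [R.Q.coe_σR, R.coe_s, R.Q.σ_ρ, ← R.coe_s]
  exact (map_neg _ _).symm

theorem τ_τ (x : 𝓞 k) : R.τ (R.τ x) = x := R.Q.σR_σR x

theorem τ_ω : R.τ R.ω = 1 - R.ω := by
  have h2 : (2 : 𝓞 k) ≠ 0 := two_ne_zero
  apply mul_left_cancel₀ h2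
  have h1 := congrArg R.τ R.two_mul_ω
  rw [map_mul, map_add, map_one, R.τ_s, map_ofNat] at h1
  linear_combination h1 + R.two_mul_ω

theorem exists_int_of_τ_eq {x : 𝓞 k} (h : R.τ x = x) : ∃ a : ℤ, x = a := by
  obtain ⟨a, ha⟩ := R.Q.fixedR h
  obtain ⟨b, rfl⟩ := Rat.ringOfIntegersEquiv.symm.surjective a
  refine ⟨b, ?_⟩
  rw [← ha]
  simp

theorem exists_coords (x : 𝓞 k) : ∃ a b : ℤ, x = a + b * R.ω := by
  obtain ⟨t, ht⟩ := R.exists_int_of_τ_eq (x := x + R.τ x) (by rw [map_add, R.τ_τ, add_comm])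
  obtain ⟨d, hd⟩ := R.exists_int_of_τ_eq (x := (x - R.τ x) * R.s)
    (by rw [map_mul, map_sub, R.τ_τ, R.τ_s]; ring)
  obtain ⟨n, hn⟩ := R.exists_int_of_τ_eq (x := x * R.τ x) (by rw [map_mul, R.τ_τ, mul_comm])
  have h1 : (d : 𝓞 k) ^ 2 = R.l * (t ^ 2 - 4 * n) := by
    rw [← ht, ← hd, ← hn, ← R.s_sq]; ring
  have h2 : d ^ 2 = R.l * (t ^ 2 - 4 * n) := by exact_mod_cast h1
  have hlp : Prime (R.l : ℤ) := Nat.prime_iff_prime_int.mp R.prime_l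
  obtain ⟨b, rfl⟩ : (R.l : ℤ) ∣ d := hlp.dvd_of_dvd_pow (Dvd.intro _ h2.symm)
  have h3 : R.l * b ^ 2 = t ^ 2 - 4 * n := by
    have := R.l_ne_zero (A := ℤ)
    apply mul_left_cancel₀ this
    rw [← h2]; ring
  have h4 : (x - R.τ x) = b * R.s := by
    apply mul_right_cancel₀ R.s_ne_zero
    rw [hd, mul_assoc, ← pow_two, R.s_sq]
    push_cast; ring
  have h5 : (t - b) % 2 = 0 := by
    have h6 : (t ^ 2 - b ^ 2) % 2 = 0 := by
      have := R.l_cast (A := ℤ)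
      rw [this] at h3
      have : t ^ 2 - b ^ 2 = 2 * (4 * R.c * b ^ 2 + 2 * n) := by linear_combination - h3
      omega
    rcases Int.emod_two_eq_zero_or_one t with ht | ht <;>
    rcases Int.emod_two_eq_zero_or_one b with hb | hb <;>
    simp [pow_two, Int.sub_emod, Int.mul_emod, ht, hb] at h6 ⊢
  obtain ⟨a, ha⟩ := Int.dvd_of_emod_eq_zero h5
  refine ⟨a, b, ?_⟩
  have h2 : (2 : 𝓞 k) ≠ 0 := two_ne_zero
  apply mul_left_cancel₀ h2
  have ha' : (t - b : 𝓞 k) = 2 * a := by exact_mod_cast congrArg (Int.cast : ℤ → 𝓞 k) ha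
  linear_combination ht + h4 + ha' - (b : 𝓞 k) * R.two_mul_ω

theorem int_of_coe_eq {a b : ℤ} (h : (a : 𝓞 k) = b) : a = b := by exact_mod_cast h

theorem natCast_dvd_intCast (R : RealQuad k) {p : ℕ} {a : ℤ} (h : (p : 𝓞 k) ∣ a) (hp : p ≠ 0) : (p : ℤ) ∣ a := by
  obtain ⟨y, hy⟩ := h
  have hy' : R.τ y = y := by
    have hp0 : (p : 𝓞 k) ≠ 0 := Nat.cast_ne_zero.mpr hp
    apply mul_left_cancel₀ hp0
    have := congrArg R.τ hy
    rw [map_mul, map_natCast, map_intCast] at this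
    rw [← this, hy]
  obtain ⟨b, rfl⟩ := R.exists_int_of_τ_eq hy'
  exact ⟨b, by exact_mod_cast hy⟩

theorem span_pair_ne_top {p : ℕ} (hp : p.Prime) {m : 𝓞 k} (h : (p : 𝓞 k) ∣ m * R.τ m) :
    Ideal.span {(p : 𝓞 k), m} ≠ ⊤ := by
  intro ht
  have h1 := (Ideal.eq_top_iff_one _).mp ht
  obtain ⟨x, y, hxy⟩ := Ideal.mem_span_pair.mp h1
  have h2 := congrArg R.τ hxy
  rw [map_add, map_mul, map_mul, map_natCast, map_one] at h2
  have h3 : (p : 𝓞 k) ∣ (1 : ℤ) := by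
    obtain ⟨z, hz⟩ := h
    refine ⟨x + R.τ x - x * R.τ x * p + y * R.τ y * z, ?_⟩
    push_cast
    linear_combination (-1 + R.τ x * p) * hxy - (y * m) * h2 + y * R.τ y * hz
  have h4 := R.natCast_dvd_intCast h3 hp.ne_zero
  exact hp.one_lt.ne' (by exact_mod_cast Int.eq_one_of_dvd_one (by positivity) h4)

theorem prime_of_mem {I : Ideal (𝓞 k)} (hI : I ≠ ⊤) {p : ℕ} (hp : p.Prime) (hpI : (p : 𝓞 k) ∈ I)
    {a : ℤ} (ha : R.ω - a ∈ I) : Prime I := by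
  have hI0 : I ≠ 0 := by
    rintro rfl
    have := (Submodule.mem_bot (𝓞 k)).mp hpI
    exact hp.ne_zero (by exact_mod_cast this)
  have hmem : ∀ x : 𝓞 k, ∃ z : ℤ, x - z ∈ I := by
    intro x
    obtain ⟨m, n, rfl⟩ := R.exists_coords x
    refine ⟨m + n * a, ?_⟩
    have : (m + n * R.ω : 𝓞 k) - ((m + n * a : ℤ) : 𝓞 k) = n * (R.ω - a) := by push_cast; ring
    rw [this]
    exact I.mul_mem_left _ ha
  have hinteg : ∀ z : ℤ, (z : 𝓞 k) ∈ I → (p : ℤ) ∣ z := by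
    intro z hz
    by_contra hnd
    have hcop : IsCoprime (p : ℤ) z :=
      (Nat.prime_iff_prime_int.mp hp).coprime_iff_not_dvd.mpr hnd
    obtain ⟨x, y, hxy⟩ := hcop
    apply hI
    rw [Ideal.eq_top_iff_one]
    have h1 : (1 : 𝓞 k) = x * p + y * z := by exact_mod_cast congrArg (Int.cast : ℤ → 𝓞 k) hxy.symm
    rw [h1]
    exact add_mem (I.mul_mem_left _ hpI) (I.mul_mem_left _ hz)
  refine (Ideal.prime_iff_isPrime hI0).mpr ⟨hI, ?_⟩
  intro x y hxy
  obtain ⟨a, ha⟩ := hmem x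
  obtain ⟨b, hb⟩ := hmem y
  have hab : ((a * b : ℤ) : 𝓞 k) ∈ I := by
    have : ((a * b : ℤ) : 𝓞 k) = x * y - (x - a) * y - a * (y - b) := by push_cast; ring
    rw [this]
    exact sub_mem (sub_mem hxy (I.mul_mem_right _ ha)) (I.mul_mem_left _ hb)
  have hpm : ∀ z : ℤ, (p : ℤ) ∣ z → (z : 𝓞 k) ∈ I := by
    rintro _ ⟨w, rfl⟩
    push_cast
    exact I.mul_mem_right _ hpI
  rcases (Nat.prime_iff_prime_int.mp hp).dvd_or_dvd (hinteg _ hab) with h | h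
  · left
    have := add_mem ha (hpm _ h)
    rwa [sub_add_cancel] at this
  · right
    have := add_mem hb (hpm _ h)
    rwa [sub_add_cancel] at this

/-- The unit `u + v √l`. -/
noncomputable def ε : (𝓞 k)ˣ where
  val := R.u + R.v * R.s
  inv := -(R.u - R.v * R.s)
  val_inv := by
    have h := congrArg (Int.cast : ℤ → 𝓞 k) R.norm_eq
    push_cast at h
    linear_combination - h + R.v ^ 2 * R.s_sq
  inv_val := by
    have h := congrArg (Int.cast : ℤ → 𝓞 k) R.norm_eq
    push_cast at h
    linear_combination - h + R.v ^ 2 * R.s_sq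

theorem coe_ε : (R.ε : 𝓞 k) = R.u + R.v * R.s := rfl

theorem ε_mul_τ : (R.ε : 𝓞 k) * R.τ R.ε = -1 := by
  rw [coe_ε, map_add, map_mul, map_intCast, map_intCast, R.τ_s]
  have h := congrArg (Int.cast : ℤ → 𝓞 k) R.norm_eq
  push_cast at h
  linear_combination h - R.v ^ 2 * R.s_sq

/-- The unit `u + v √l` as an element of the multiplicative group of the field. -/
noncomputable def εk : kˣ := unitsIncl k R.ε

theorem coe_εk : (R.εk : k) = R.u + R.v * R.Q.ρ := by
  change ((R.ε : 𝓞 k) : k) = _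
  rw [coe_ε, coe_add, coe_mul, coe_intCast, coe_intCast, ← R.coe_s]

theorem εk_mul_σ : (R.εk : k) * R.Q.σ R.εk = -1 := by
  rw [coe_εk, map_add, map_mul, map_intCast, map_intCast, R.Q.σ_ρ]
  have h := congrArg (Int.cast : ℤ → k) R.norm_eq
  push_cast at h
  linear_combination h - R.v ^ 2 * R.ρ_sq

/-- The second real embedding. -/
noncomputable def φ' : k →+* ℝ := R.φ.comp (R.Q.σ : k →+* k)

theorem φ'_apply (x : k) : R.φ' x = R.φ (R.Q.σ x) := rfl

theorem φ_ε_pos : 0 < R.φ R.εk := by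
  rw [coe_εk, map_add, map_mul, map_intCast, map_intCast]
  have := R.φ_pos
  have h1 : (0 : ℝ) < R.u := by exact_mod_cast R.u_pos
  have h2 : (0 : ℝ) < R.v := by exact_mod_cast R.v_pos
  positivity

theorem φ'_ε_neg : R.φ' R.εk < 0 := by
  have h := congrArg R.φ R.εk_mul_σ
  rw [map_mul, ← φ'_apply, map_neg, map_one] at h
  by_contra h'
  have := mul_nonneg R.φ_ε_pos.le (not_lt.mp h')
  linarith

theorem neg_one_notMem (R : RealQuad k) : (-1 : kˣ) ∉ squares kˣ := by
  rintro ⟨x, hx⟩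
  have h : (x : k) ^ 2 = -1 := by simpa using congrArg Units.val hx
  have h := congrArg R.φ h
  rw [map_pow, map_neg, map_one] at h
  nlinarith [sq_nonneg (R.φ x)]

theorem ε_notMem : R.εk ∉ squares kˣ := by
  rintro ⟨x, hx⟩
  have h : (x : k) ^ 2 = R.εk := by simpa using congrArg Units.val hx
  have h := congrArg R.φ' h
  rw [map_pow] at h
  nlinarith [sq_nonneg (R.φ' x), R.φ'_ε_neg]

theorem neg_ε_notMem : -1 * R.εk ∉ squares kˣ := by
  rintro ⟨x, hx⟩
  have h : (x : k) ^ 2 = -1 * R.εk := by simpa using congrArg Units.val hx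
  have h := congrArg R.φ h
  rw [map_pow, map_mul, map_neg, map_one] at h
  nlinarith [sq_nonneg (R.φ x), R.φ_ε_pos]

theorem card_twoTorsion (R : RealQuad k) :
    Nat.card {x : ClassGroup (𝓞 k) // x ^ 2 = 1} = 1 :=
  card_twoTorsion_quadratic R.Q R.prime_l (by have := R.l_eq; omega) R.δ_eq R.φ

theorem oddClass (R : RealQuad k) : OddClass k := oddClass_of_card R.card_twoTorsion

theorem relIndex_selmerTwo (R : RealQuad k) : (squares kˣ).relIndex (selmerTwo k) = 4 := by
  rw [relIndex_squares_selmerTwo_of_card_eq_one R.card_twoTorsion,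
    rank_eq_one_of_finrank_two R.Q.finrank_eq_two R.φ]
  norm_num

theorem neg_one_mem_selmerTwo : (-1 : kˣ) ∈ selmerTwo k := by
  have h := unitsIncl_mem_selmerTwo (k := k) (-1)
  have : unitsIncl k (-1) = -1 := by
    apply Units.ext
    simp
  rwa [this] at h

theorem ε_mem_selmerTwo : R.εk ∈ selmerTwo k := unitsIncl_mem_selmerTwo _

theorem mem_selmerTwo_cases {x : kˣ} (hx : x ∈ selmerTwo k) :
    x ∈ squares kˣ ∨ -1 * x ∈ squares kˣ ∨ R.εk * x ∈ squares kˣ ∨ -1 * R.εk * x ∈ squares kˣ :=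
  mem_of_relIndex_eq_four R.relIndex_selmerTwo le_rfl neg_one_mem_selmerTwo R.ε_mem_selmerTwo
    R.neg_one_notMem R.ε_notMem R.neg_ε_notMem hx

end RealQuad

namespace RealQuad

variable {k F : Type*} [Field k] [NumberField k] [Field F] [NumberField F] [Algebra k F]
  (R : RealQuad k) (Q : QuadExt k F)

theorem exists_int_θ (hδ : Q.δ = R.εk) :
    ∃ θ : 𝓞 F, (θ : F) = algebraMap k F R.ω * ((1 + Q.ρ) / 2) := by
  obtain ⟨a, ha⟩ := Int.dvd_of_emod_eq_zero R.u_mod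
  obtain ⟨b, hb⟩ : ∃ b, R.v = 4 * b + 1 := ⟨R.v / 4, by have := R.v_mod; omega⟩
  refine exists_integer_of_sq_eq (b := algebraMap (𝓞 k) (𝓞 F) R.ω)
    (c := algebraMap (𝓞 k) (𝓞 F) (R.ω ^ 2 * (a - b + 2 * b * R.ω) + R.ω * R.c)) ?_
  change _ = algebraMap k F R.ω * _ +
    algebraMap k F ((R.ω ^ 2 * (a - b + 2 * b * R.ω) + R.ω * R.c : 𝓞 k) : k)
  have hk : (4 : k) * ((R.ω ^ 2 * (a - b + 2 * b * R.ω) + R.ω * R.c : 𝓞 k) : k) =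
      (R.ω : k) ^ 2 * (R.εk - 1) := by
    have h1 : (4 : 𝓞 k) * (R.ω ^ 2 * (a - b + 2 * b * R.ω) + R.ω * R.c) =
        R.ω ^ 2 * (R.ε - 1) := by
      rw [coe_ε, ha, hb]
      push_cast
      linear_combination - 2 * R.ω * R.ω_sq + R.ω ^ 2 * (4 * b + 1) * R.two_mul_ω
    exact congrArg (algebraMap (𝓞 k) k) h1
  have hk' := congrArg (algebraMap k F) hk
  rw [map_mul, map_mul, map_sub, map_one, map_ofNat, map_pow, ← hδ, ← Q.ρ_sq] at hk'
  linear_combination - hk' / 4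

theorem prime_two_ω : Prime (Ideal.span {((2 : ℕ) : 𝓞 k), R.ω}) := by
  refine R.prime_of_mem (R.span_pair_ne_top Nat.prime_two ?_) Nat.prime_two
    (Ideal.subset_span (Set.mem_insert _ _)) (a := 0)
    (by rw [Int.cast_zero, sub_zero]; exact Ideal.subset_span (Set.mem_insert_of_mem _ rfl))
  rw [τ_ω]
  refine ⟨-R.c, ?_⟩
  push_cast
  linear_combination - R.ω_sq

theorem relIndex_selmerTwo_sqrt_ε_le (hδ : Q.δ = R.εk) :
    (selmerTwo k).relIndex ((selmerTwo F).comap Q.incl) ≤ 3 := by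
  refine Q.relIndex_selmerTwo_le_of_dvd_prime_pow R.prime_two_ω 2 fun 𝔟 h => ?_
  obtain ⟨θ, hθ⟩ : ∃ θ : 𝓞 F, (θ : F) = Q.ρ :=
    exists_integer_of_sq_eq (b := 0) (c := algebraMap (𝓞 k) (𝓞 F) R.ε) (by
      rw [coe_zero, zero_mul, zero_add, Q.ρ_sq, hδ]
      rfl)
  obtain ⟨θ', hθ'⟩ := R.exists_int_θ Q hδ
  have h1 := h θ (4 * R.ε) (by
    apply RingOfIntegers.ext
    change algebraMap k F ((4 * R.ε : 𝓞 k) : k) = ((θ : F) - (Q.σR θ : F)) ^ 2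
    rw [Q.coe_σR, hθ, Q.σ_ρ, coe_mul, coe_ofNat, map_mul, map_ofNat]
    have h2 : Q.ρ ^ 2 = algebraMap k F ((R.ε : 𝓞 k) : k) := by rw [Q.ρ_sq, hδ]; rfl
    linear_combination - 4 * h2)
  have h2 := h θ' (R.ω ^ 2 * R.ε) (by
    apply RingOfIntegers.ext
    change algebraMap k F ((R.ω ^ 2 * R.ε : 𝓞 k) : k) = ((θ' : F) - (Q.σR θ' : F)) ^ 2
    have h7 : Q.σ (2 : F) = 2 := map_ofNat Q.σ 2
    rw [Q.coe_σR, hθ', map_mul, map_div₀, map_add, map_one, Q.σ_ρ, h7, Q.σ.commutes, coe_mul,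
      coe_pow, map_mul, map_pow]
    have h2 : Q.ρ ^ 2 = algebraMap k F ((R.ε : 𝓞 k) : k) := by rw [Q.ρ_sq, hδ]; rfl
    linear_combination - (algebraMap k F R.ω) ^ 2 * h2)
  rw [Ideal.dvd_span_singleton, Ideal.mul_unit_mem_iff_mem _ R.ε.isUnit] at h1 h2
  rw [Ideal.dvd_iff_le, pow_two, Ideal.span_pair_mul_span_pair, Ideal.span_le]
  have h3 : 2 * R.ω ∈ 𝔟 := by
    have : 2 * R.ω = 2 * R.ω ^ 2 - R.c * 4 := by rw [R.ω_sq]; ring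
    rw [this]
    exact sub_mem (𝔟.mul_mem_left _ h2) (𝔟.mul_mem_left _ h1)
  rintro _ (rfl | rfl | rfl | rfl)
  · convert h1 using 1; norm_num
  · exact h3
  · rw [mul_comm]; exact h3
  · rw [← pow_two]; exact h2

theorem neg_one_notMem_norm (hδ : Q.δ = R.εk) : (-1 : kˣ) ∉ Q.norm.range := by
  rw [Q.mem_norm_range_iff]
  rintro ⟨a, b, h⟩
  have := congrArg R.φ' h
  rw [hδ, map_sub, map_mul, map_pow, map_pow, Units.val_neg, Units.val_one, map_neg, map_one] at this
  nlinarith [sq_nonneg (R.φ' a), mul_nonneg (neg_nonneg.mpr R.φ'_ε_neg.le) (sq_nonneg (R.φ' b))]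

theorem oddClass_sqrt_ε (hδ : Q.δ = R.εk) (ψ : F →+* ℝ) : OddClass F := by
  apply oddClass_of_card
  have h1 := Q.index_formula R.oddClass
  have h2 := Q.relIndex_inf_norm_mul
  have h3 := R.relIndex_selmerTwo_sqrt_ε_le Q hδ
  have hfr : Module.finrank ℚ F = 4 := by
    rw [← Module.finrank_mul_finrank ℚ k F, R.Q.finrank_eq_two, Q.finrank_eq_two]
  have hr := two_le_rank_of_finrank_four hfr ψ
  rw [index_squares_units, Q.relIndex_comap_selmerTwo, R.relIndex_selmerTwo] at h1
  rw [R.relIndex_selmerTwo] at h2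
  have h4 : (selmerTwo k ⊓ Q.norm.range).relIndex (selmerTwo k) ≠ 1 := by
    rw [Ne, Subgroup.relIndex_eq_one]
    intro h
    exact R.neg_one_notMem_norm Q hδ (h neg_one_mem_selmerTwo).2
  have h5 : (squares kˣ).relIndex (selmerTwo k ⊓ Q.norm.range) ≤ 2 := by
    by_contra h
    rcases Nat.lt_or_ge ((selmerTwo k ⊓ Q.norm.range).relIndex (selmerTwo k)) 2 with h6 | h6
    · interval_cases (selmerTwo k ⊓ Q.norm.range).relIndex (selmerTwo k) <;> omega
    · nlinarith
  have h6 : 2 ^ 3 ≤ 2 ^ (Units.rank F + 1) := Nat.pow_le_pow_right two_pos (by omega)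
  have h7 := nat_card_sq_eq_one_pos F
  have h8 : 4 * (selmerTwo k).relIndex ((selmerTwo F).comap Q.incl) *
      (squares kˣ).relIndex (selmerTwo k ⊓ Q.norm.range) ≤ 12 * 2 :=
    Nat.mul_le_mul (by omega) h5
  have h9 := Nat.mul_le_mul_right (Nat.card {x : ClassGroup (𝓞 F) // x ^ 2 = 1}) h6
  omega

end RealQuad

namespace QuadExt

variable {k L : Type*} [Field k] [NumberField k] [Field L] [NumberField L] [Algebra k L]
  (Q : QuadExt k L)

theorem exists_mul_conj_eq (hL : OddClass L) {d m s : 𝓞 k} (hd : Q.δ = d) (h2 : IsCoprime m 2)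
    (hmd : IsCoprime m d) (hs : m ∣ s ^ 2 - d) :
    ∃ (β : 𝓞 L) (H : ℕ) (e : (𝓞 k)ˣ), Odd H ∧
      β * Q.σR β = algebraMap (𝓞 k) (𝓞 L) (m ^ H * e) := by
  obtain ⟨r, hr⟩ : ∃ r : 𝓞 L, (r : L) = Q.ρ :=
    exists_integer_of_sq_eq (b := 0) (c := algebraMap (𝓞 k) (𝓞 L) d) (by
      rw [coe_zero, zero_mul, zero_add, Q.ρ_sq, hd]
      rfl)
  have hr2 : r ^ 2 = algebraMap (𝓞 k) (𝓞 L) d := by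
    apply RingOfIntegers.ext
    rw [coe_pow, hr, Q.ρ_sq, hd]
    rfl
  have hσr : Q.σR r = -r := by
    apply RingOfIntegers.ext
    rw [Q.coe_σR, coe_neg, hr, Q.σ_ρ]
  set ι := algebraMap (𝓞 k) (𝓞 L) with hι
  have hms : IsCoprime m (2 * s) := by
    refine h2.mul_right (IsCoprime.pow_right_iff two_pos |>.mp ?_)
    obtain ⟨z, hz⟩ := hs
    have : s ^ 2 = d + m * z := by linear_combination hz
    rw [this]
    exact hmd.add_mul_left_right z
  obtain ⟨x, y, hxy⟩ := hms
  set J : Ideal (𝓞 L) := Ideal.span {ι m, ι s - r} with hJ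
  have hcJ : Q.conj J = Ideal.span {ι m, ι s + r} := by
    rw [hJ, conj, Ideal.map_span, Set.image_pair]
    have h1 : Q.σR (ι m) = ι m := Q.σR_algebraMap m
    have h2 : Q.σR (ι s - r) = ι s + r := by
      rw [map_sub, hι, Q.σR_algebraMap, hσr, sub_neg_eq_add]
    exact congrArg₂ (fun a b => Ideal.span {a, b}) h1 h2
  have hprod : J * Q.conj J = Ideal.span {ι m} := by
    rw [hcJ, hJ, Ideal.span_pair_mul_span_pair]
    apply le_antisymm
    · rw [Ideal.span_le]
      rintro _ (rfl | rfl | rfl | rfl)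
      · exact Ideal.mem_span_singleton.mpr (Dvd.intro _ rfl)
      · exact Ideal.mem_span_singleton.mpr (Dvd.intro _ rfl)
      · exact Ideal.mem_span_singleton.mpr (Dvd.intro_left _ rfl)
      · obtain ⟨z, hz⟩ := hs
        refine Ideal.mem_span_singleton.mpr ⟨ι z, ?_⟩
        have := congrArg ι hz
        rw [map_sub, map_pow, map_mul] at this
        linear_combination this - hr2
    · rw [Ideal.span_singleton_le_iff_mem]
      have h3 := congrArg ι hxy
      rw [map_add, map_mul, map_mul, map_mul, map_ofNat, map_one] at h3
      have h4 : ι m = ι x * (ι m * ι m) + ι y * (ι m * (ι s + r) + (ι s - r) * ι m) := by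
        linear_combination - ι m * h3
      have h7 : ι x * (ι m * ι m) + ι y * (ι m * (ι s + r) + (ι s - r) * ι m) ∈ Ideal.span
          {ι m * ι m, ι m * (ι s + r), (ι s - r) * ι m, (ι s - r) * (ι s + r)} :=
        add_mem (Ideal.mul_mem_left _ _ (Ideal.subset_span (Or.inl rfl)))
          (Ideal.mul_mem_left _ _ (add_mem (Ideal.subset_span (Or.inr (Or.inl rfl)))
            (Ideal.subset_span (Or.inr (Or.inr (Or.inl rfl))))))
      rwa [← h4] at h7
  obtain ⟨H, hH, hprin⟩ := hL
  obtain ⟨β, hβ⟩ := hprin J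
  have h5 : Ideal.span {β * Q.σR β} = Ideal.span {ι m ^ H} := by
    rw [← Ideal.span_singleton_pow, ← hprod, mul_pow, hβ, conj, ← Ideal.map_pow, hβ,
      Ideal.map_span, Set.image_singleton, Ideal.span_singleton_mul_span_singleton]
  obtain ⟨a, ha⟩ := Q.fixedR (x := β * Q.σR β) (by rw [map_mul, Q.σR_σR, mul_comm])
  have h6 : Ideal.span {m ^ H} = Ideal.span {a} := by
    apply Ideal.map_ringOfIntegers_injective (L := L)
    rw [Ideal.map_span, Ideal.map_span, Set.image_singleton, Set.image_singleton, ha, h5, map_pow]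
  obtain ⟨e, he⟩ := Ideal.span_singleton_eq_span_singleton.mp h6
  exact ⟨β, H, e, hH, by rw [he, ha]⟩

theorem exists_unit_mul_mem_norm (hL : OddClass L) {d m s : 𝓞 k} (hd : Q.δ = d)
    (h2 : IsCoprime m 2) (hmd : IsCoprime m d) (hs : m ∣ s ^ 2 - d) {g : kˣ} (hg : (g : k) = m) :
    ∃ e : (𝓞 k)ˣ, unitsIncl k e * g ∈ Q.norm.range := by
  obtain ⟨β, H, e, ⟨c, hc⟩, h⟩ := Q.exists_mul_conj_eq hL hd h2 hmd hs
  have h' : (β : L) * Q.σ β = algebraMap k L ((m : k) ^ H * ((e : 𝓞 k) : k)) :=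
    congrArg (algebraMap (𝓞 L) L) h
  have hm0 : (m : k) ≠ 0 := by rw [← hg]; exact g.ne_zero
  have he0 : ((e : 𝓞 k) : k) ≠ 0 := (unitsIncl k e).ne_zero
  have hβ0 : (β : L) ≠ 0 := by
    intro h0
    rw [h0, zero_mul, eq_comm, map_eq_zero] at h'
    exact mul_ne_zero (pow_ne_zero _ hm0) he0 h'
  refine ⟨e, (Subgroup.mul_mem_cancel_right _
    (Q.squares_le_norm_range (show (g ^ c) ^ 2 ∈ squares kˣ from ⟨g ^ c, rfl⟩))).mp ?_⟩
  refine ⟨Units.mk0 _ hβ0, ?_⟩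
  rw [norm_eq_iff, Units.val_mk0, h', hc, ← hg]
  congr 1
  rw [Units.val_mul, Units.val_mul, Units.val_pow_eq_pow_val, Units.val_pow_eq_pow_val]
  change _ = ((e : 𝓞 k) : k) * _ * _
  ring

end QuadExt

section QuarticSymbols

open scoped NumberTheorySymbols

theorem int_eq_of_sq_one {p : ℕ} (hp : 2 < p) {a b : ℤ} (ha : a = 1 ∨ a = -1)
    (hb : b = 1 ∨ b = -1) (h : (a : ZMod p) = b) : a = b := by
  have h2 := (ZMod.intCast_eq_intCast_iff_dvd_sub _ _ _).mp h
  rcases ha with rfl | rfl <;> rcases hb with rfl | rfl <;> norm_num at h2 ⊢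
  · have := Int.le_of_dvd (by norm_num) h2
    omega
  · have := Int.le_of_dvd (by norm_num) h2
    omega

theorem isCoprime_natAbs_right {a b : ℤ} : IsCoprime a (b.natAbs : ℤ) ↔ IsCoprime a b := by
  rcases Int.natAbs_eq b with h | h
  · rw [← h]
  · conv_rhs => rw [h]
    rw [IsCoprime.neg_right_iff]

theorem quartSym_eq_or (p : ℕ) (a : ℤ) : quartSym p a = 1 ∨ quartSym p a = -1 := by
  unfold quartSym
  split_ifs <;> simp

theorem coe_quartSym {p : ℕ} (hp : p.Prime) (hp4 : p % 4 = 1) {a : ℤ}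
    (h : (a : ZMod p) ^ ((p - 1) / 2) = 1) :
    ((quartSym p a : ℤ) : ZMod p) = (a : ZMod p) ^ ((p - 1) / 4) := by
  have : Fact p.Prime := ⟨hp⟩
  unfold quartSym
  split_ifs with h1
  · rw [h1, Int.cast_one]
  · have h2 : ((a : ZMod p) ^ ((p - 1) / 4)) ^ 2 = 1 := by
      rw [← pow_mul]
      have : (p - 1) / 4 * 2 = (p - 1) / 2 := by omega
      rwa [this]
    rw [(sq_eq_one_iff.mp h2).resolve_left h1]
    simp

theorem two_lt_of_mod_four {p : ℕ} (hp : p.Prime) (hp4 : p % 4 = 1) : 2 < p := by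
  have := hp.two_le
  omega

theorem coe_jacobiSym {p : ℕ} (hp : p.Prime) (hp4 : p % 4 = 1) (a : ℤ) :
    ((J(a | p) : ℤ) : ZMod p) = (a : ZMod p) ^ ((p - 1) / 2) := by
  have : Fact p.Prime := ⟨hp⟩
  rw [← jacobiSym.legendreSym.to_jacobiSym, legendreSym.eq_pow]
  have : p / 2 = (p - 1) / 2 := by omega
  rw [this]

theorem jacobiSym_neg_one_of_mod_four {p : ℕ} (hp4 : p % 4 = 1) : J(-1 | p) = 1 := by
  rw [jacobiSym.at_neg_one (Nat.odd_iff.mpr (by omega))]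
  exact ZMod.χ₄_nat_one_mod_four hp4

theorem jacobiSym_natAbs {p : ℕ} (hp4 : p % 4 = 1) (a : ℤ) : J((a.natAbs : ℤ) | p) = J(a | p) := by
  rcases Int.natAbs_eq a with h | h
  · rw [← h]
  · conv_rhs => rw [h, ← neg_one_mul, jacobiSym.mul_left, jacobiSym_neg_one_of_mod_four hp4, one_mul]

theorem jacobiSym_eq_of_dvd {b : ℕ} {x y : ℤ} (h : (b : ℤ) ∣ x - y) : J(x | b) = J(y | b) :=
  jacobiSym.mod_left' (Int.modEq_iff_dvd.mpr h).symm

theorem jacobiSym_eq_or {p : ℕ} {a : ℤ} (h : IsCoprime a (p : ℤ)) :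
    J(a | p) = 1 ∨ J(a | p) = -1 :=
  jacobiSym.eq_one_or_neg_one (Int.isCoprime_iff_gcd_eq_one.mp h)

theorem jacobiSym_sq_mul {b : ℕ} {a c : ℤ} (h : IsCoprime a (b : ℤ)) :
    J(c * a ^ 2 | b) = J(c | b) := by
  rw [jacobiSym.mul_left, jacobiSym.sq_one' (Int.isCoprime_iff_gcd_eq_one.mp h), mul_one]

theorem jacobiSym_odd_pow {b : ℕ} {a : ℤ} {H : ℕ} (hH : Odd H) (h : IsCoprime a (b : ℤ)) :
    J(a ^ H | b) = J(a | b) := by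
  obtain ⟨c, rfl⟩ := hH
  rw [pow_succ, mul_comm, mul_comm 2 c, pow_mul, jacobiSym_sq_mul h.pow_left]

/-- Scholz's computation with a generator of an odd power of a prime above `q`. -/
theorem jacobiSym_eq_quartSym_mul {l q : ℕ} (hl : l.Prime) (hq : q.Prime) (hl8 : l % 8 = 1)
    (hq4 : q % 4 = 1) (hlq : l ≠ q) (hql : (q : ZMod l) ^ ((l - 1) / 2) = 1)
    {u v : ℤ} (huv : u ^ 2 - l * v ^ 2 = -1) (hu : u % 4 = 0) (hv : v % 4 = 1) (hv0 : 0 < v)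
    {x y : ℤ} {H : ℕ} (hH : Odd H) (hxy : x ^ 2 - l * y ^ 2 = q ^ H) (hqx : ¬ (q : ℤ) ∣ x)
    {r : ℤ} (hr : (q : ℤ) ∣ r ^ 2 - l) :
    J(u + v * r | q) = quartSym l q * quartSym q l := by
  have hl4 : l % 4 = 1 := by omega
  have hqp : Prime (q : ℤ) := Nat.prime_iff_prime_int.mp hq
  have hlp : Prime (l : ℤ) := Nat.prime_iff_prime_int.mp hl
  have hH0 : H ≠ 0 := by rintro rfl; exact absurd hH (by decide)
  have hqy : ¬ (q : ℤ) ∣ y := by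
    intro h
    apply hqx
    apply hqp.dvd_of_dvd_pow (n := 2)
    rw [show x ^ 2 = l * y * y + q ^ H by linear_combination hxy]
    exact dvd_add (h.mul_left _) (dvd_pow_self _ hH0)
  have hcop : ∀ {z : ℤ}, ¬ (q : ℤ) ∣ z → IsCoprime (q : ℤ) z :=
    fun h => hqp.coprime_iff_not_dvd.mpr h
  have hlx : ¬ (l : ℤ) ∣ x := by
    intro h
    have h1 : (l : ℤ) ∣ (q : ℤ) ^ H := by
      rw [← hxy]
      exact dvd_sub (dvd_pow h two_ne_zero) (Dvd.intro _ rfl)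
    have h2 := hlp.dvd_of_dvd_pow h1
    exact hlq ((Nat.prime_dvd_prime_iff_eq hl hq).mp (by exact_mod_cast h2))
  have hxmod : x % 2 = 1 ∧ y % 2 = 0 := by
    have hqH : (q : ℤ) ^ H ≡ 1 [ZMOD 4] := by
      have : (q : ℤ) ≡ 1 [ZMOD 4] := by unfold Int.ModEq; omega
      simpa using this.pow H
    have hlm : (l : ℤ) % 4 = 1 := by omega
    rw [← hxy] at hqH
    have h4 : (x ^ 2 - l * y ^ 2) % 4 = 1 := hqH
    have hx4 : x % 4 = 0 ∨ x % 4 = 1 ∨ x % 4 = 2 ∨ x % 4 = 3 := by omega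
    have hy4 : y % 4 = 0 ∨ y % 4 = 1 ∨ y % 4 = 2 ∨ y % 4 = 3 := by omega
    rcases hx4 with hx4 | hx4 | hx4 | hx4 <;> rcases hy4 with hy4 | hy4 | hy4 | hy4 <;>
      simp [pow_two, Int.sub_emod, Int.mul_emod, hx4, hy4, hlm] at h4 <;> omega
  obtain ⟨hx2, hy2⟩ := hxmod
  set X := x.natAbs with hX
  have hXodd : Odd X := Nat.odd_iff.mpr (by omega)
  have hqxc : IsCoprime ((q : ℤ) ^ H) x := (hcop hqx).pow_left
  have hyX : IsCoprime y (X : ℤ) := by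
    rw [hX, isCoprime_natAbs_right]
    obtain ⟨a, b, hab⟩ := hqxc
    exact ⟨-a * l * y, a * x + b, by rw [← hab, ← hxy]; ring⟩
  have hxl : J(x | l) = quartSym l q := by
    apply int_eq_of_sq_one (two_lt_of_mod_four hl hl4)
      (jacobiSym_eq_or (hlp.coprime_iff_not_dvd.mpr hlx).symm) (quartSym_eq_or _ _)
    have h1 : ((quartSym l q : ℤ) : ZMod l) = (((quartSym l q) ^ H : ℤ) : ZMod l) := by
      rcases quartSym_eq_or l q with h | h <;> rw [h]
      · rw [one_pow]
      · rw [hH.neg_one_pow]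
    have h2 := congrArg (Int.cast : ℤ → ZMod l) hxy
    push_cast at h2
    rw [ZMod.natCast_self, zero_mul, sub_zero] at h2
    rw [h1, Int.cast_pow, coe_quartSym hl hl4 (by simpa using hql), ← pow_mul, mul_comm, pow_mul,
      Int.cast_natCast, ← h2, ← pow_mul, coe_jacobiSym hl hl4]
    congr 1
    omega
  have hxX : J(x | q) = J(-1 | X) * J(x | l) := by
    rw [← jacobiSym_natAbs hq4, ← jacobiSym_natAbs hl4,
      ← jacobiSym.quadratic_reciprocity_one_mod_four hq4 hXodd,
      ← jacobiSym.quadratic_reciprocity_one_mod_four hl4 hXodd, ← jacobiSym.mul_left,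
      ← jacobiSym_odd_pow hH (isCoprime_natAbs_right.mpr (hcop hqx)),
      ← jacobiSym_sq_mul hyX (c := -1 * l)]
    apply jacobiSym_eq_of_dvd
    rw [← hxy, Int.natAbs_dvd]
    exact ⟨x, by ring⟩
  have : Fact q.Prime := ⟨hq⟩
  have hyq := jacobiSym_eq_or (hcop hqy).symm
  have hyq2 : J(y | q) * J(y | q) = 1 := by rcases hyq with h | h <;> rw [h] <;> norm_num
  have hxq := jacobiSym_eq_or (hcop hqx).symm
  have hxl2 : J(x | l) * J(x | l) = 1 := by
    rcases quartSym_eq_or l q with h | h <;> rw [hxl, h] <;> norm_num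
  have hqlne : ¬ (q : ℤ) ∣ l := fun h =>
    hlq ((Nat.prime_dvd_prime_iff_eq hq hl).mp (by exact_mod_cast h)).symm
  have hr' : (r : ZMod q) ^ 2 = l := by
    have := (ZMod.intCast_zmod_eq_zero_iff_dvd _ q).mpr hr
    push_cast at this
    exact sub_eq_zero.mp this
  have hlz : (l : ZMod q) ≠ 0 := by
    intro h
    apply hqlne
    exact (ZMod.intCast_zmod_eq_zero_iff_dvd _ q).mp (by exact_mod_cast h)
  have hlq2 : (l : ZMod q) ^ ((q - 1) / 2) = 1 := by
    have hr0 : (r : ZMod q) ≠ 0 := by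
      intro h
      rw [h, zero_pow two_ne_zero] at hr'
      exact hlz hr'.symm
    rw [← hr', ← pow_mul]
    have : 2 * ((q - 1) / 2) = q - 1 := by omega
    rw [this]
    exact ZMod.pow_card_sub_one_eq_one hr0
  have hql' : quartSym q l = J(x | q) * J(y | q) := by
    apply int_eq_of_sq_one (two_lt_of_mod_four hq hq4) (quartSym_eq_or _ _)
    · rcases hxq with h | h <;> rcases hyq with h' | h' <;> rw [h, h'] <;> norm_num
    · have h2 := congrArg (Int.cast : ℤ → ZMod q) hxy
      push_cast at h2
      rw [ZMod.natCast_self, zero_pow hH0, sub_eq_zero] at h2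
      have h3 : (J(y | q) : ZMod q) * (J(y | q) : ZMod q) = 1 := by
        exact_mod_cast congrArg (Int.cast : ℤ → ZMod q) hyq2
      have hq2 : (q - 1) / 2 = 2 * ((q - 1) / 4) := by omega
      rw [Int.cast_mul, coe_quartSym hq hq4 (by simpa using hlq2)]
      have h4 : (J(x | q) : ZMod q) = (l : ZMod q) ^ ((q - 1) / 4) * (J(y | q) : ZMod q) := by
        rw [coe_jacobiSym hq hq4, coe_jacobiSym hq hq4, hq2, pow_mul, h2, mul_pow, ← pow_mul]
      rw [h4, mul_assoc, h3, mul_one, Int.cast_natCast]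
  set Z := u * y - v * x with hZ
  have hqZ : ¬ (q : ℤ) ∣ Z := by
    intro h
    have h1 : (q : ℤ) ∣ x * u - l * y * v := by
      apply hqp.dvd_of_dvd_pow (n := 2)
      have : (x * u - l * y * v) ^ 2 = Z * (l * Z) - q ^ H := by
        rw [hZ, ← hxy]; linear_combination (x ^ 2 - l * y ^ 2) * huv
      rw [this]
      exact dvd_sub (h.mul_right _) (dvd_pow_self _ hH0)
    apply hqx
    have : x = -((x * u - l * y * v) * u + Z * (l * v)) := by
      rw [hZ]; linear_combination x * huv
    rw [this]
    exact (dvd_add (h1.mul_right _) (h.mul_right _)).neg_right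
  obtain ⟨a, ha⟩ := Int.dvd_of_emod_eq_zero hu
  obtain ⟨b, hb⟩ : ∃ b, v = 4 * b + 1 := ⟨v / 4, by omega⟩
  obtain ⟨y', hy'⟩ := Int.dvd_of_emod_eq_zero hy2
  have hZx : (4 : ℤ) ∣ Z + x := ⟨a * y - b * x, by rw [hZ, ha, hb]; ring⟩
  have hlt : (u * y) ^ 2 < (v * x) ^ 2 := by
    have h1 : (v * x) ^ 2 - (u * y) ^ 2 = v ^ 2 * q ^ H + y ^ 2 := by
      rw [← hxy]; linear_combination - y ^ 2 * huv
    have h2 : 0 < v ^ 2 * (q : ℤ) ^ H := by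
      have : 0 < (q : ℤ) := by exact_mod_cast hq.pos
      positivity
    nlinarith [sq_nonneg y]
  have habs := abs_lt.mp (sq_lt_sq.mp hlt |>.trans_eq rfl)
  have hZX : Z.natAbs % 4 = X % 4 := by
    rcases lt_or_ge 0 x with hx0 | hx0
    · have h1 : 0 < v * x := mul_pos hv0 hx0
      rw [abs_of_pos h1] at habs
      have : Z < 0 := by rw [hZ]; linarith [habs.2]
      omega
    · have h1 : v * x ≤ 0 := mul_nonpos_of_nonneg_of_nonpos hv0.le hx0
      rw [abs_of_nonpos h1] at habs
      have : 0 < Z := by rw [hZ]; linarith [habs.1]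
      omega
  have hZodd : Odd Z.natAbs := Nat.odd_iff.mpr (by have := Nat.odd_iff.mp hXodd; omega)
  have hJZ : J(Z | q) = J(-1 | X) := by
    have hcW : IsCoprime (x * u - l * y * v) (Z.natAbs : ℤ) := by
      rw [isCoprime_natAbs_right]
      obtain ⟨c, d, hcd⟩ : IsCoprime ((q : ℤ) ^ H) Z := (hcop hqZ).pow_left
      refine ⟨-c * (x * u - l * y * v), c * l * Z + d, ?_⟩
      rw [← hcd, ← hxy, hZ]
      linear_combination (-c * (x ^ 2 - l * y ^ 2)) * huv
    have h1 : J(Z | q) = J(-1 | Z.natAbs) := by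
      rw [← jacobiSym_natAbs hq4, ← jacobiSym.quadratic_reciprocity_one_mod_four hq4 hZodd,
        ← jacobiSym_odd_pow hH (isCoprime_natAbs_right.mpr (hcop hqZ)),
        ← jacobiSym_sq_mul hcW (c := -1)]
      apply jacobiSym_eq_of_dvd
      rw [Int.natAbs_dvd]
      exact ⟨l * Z, by rw [hZ, ← hxy]; linear_combination (x ^ 2 - l * y ^ 2) * huv⟩
    rw [h1, jacobiSym.at_neg_one hZodd, jacobiSym.at_neg_one hXodd, ZMod.χ₄_nat_mod_four, hZX,
      ← ZMod.χ₄_nat_mod_four]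
  have hJ1 := jacobiSym_neg_one_of_mod_four hq4
  have hfin : J(y * (u + v * r) | q) = J(Z | q) := by
    have h1 : (q : ℤ) ∣ (r * y + x) * (r * y - x) := by
      have : (r * y + x) * (r * y - x) = (r ^ 2 - l) * y ^ 2 - q ^ H := by rw [← hxy]; ring
      rw [this]
      exact dvd_sub (hr.mul_right _) (dvd_pow_self _ hH0)
    rcases hqp.dvd_or_dvd h1 with h | h
    · apply jacobiSym_eq_of_dvd
      have : y * (u + v * r) - Z = (r * y + x) * v := by rw [hZ]; ring
      rw [this]
      exact h.mul_right _
    · have h2 : J(y * (u + v * r) | q) = J(u * y + v * x | q) := by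
        apply jacobiSym_eq_of_dvd
        have : y * (u + v * r) - (u * y + v * x) = (r * y - x) * v := by ring
        rw [this]
        exact h.mul_right _
      have h3 : J(u * y + v * x | q) * J(Z | q) = 1 := by
        rw [← jacobiSym.mul_left, ← hJ1, ← jacobiSym_sq_mul (hcop hqy).symm (c := -1)]
        apply jacobiSym_eq_of_dvd
        have : (u * y + v * x) * Z - -1 * y ^ 2 = - v ^ 2 * q ^ H := by
          rw [hZ, ← hxy]; linear_combination y ^ 2 * huv
        rw [this]
        exact (dvd_pow_self _ hH0).mul_left _
      rw [h2]
      rcases jacobiSym_eq_or (hcop hqZ).symm with h4 | h4 <;> rw [h4] at h3 ⊢ <;> linarith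
  rw [jacobiSym.mul_left, hJZ] at hfin
  rw [← hxl, hql', hxX]
  linear_combination J(y | q) * hfin - J(u + v * r | q) * hyq2 - J(-1 | X) * J(y | q) * hxl2

end QuarticSymbols

theorem exists_sq_sub_eq_pow_of_dvd {l q : ℕ} (hl : l.Prime) (hq : q.Prime) (hlq : l ≠ q) :
    ∀ (H : ℕ) (x y : ℤ), Odd H → x ^ 2 - l * y ^ 2 = q ^ H →
      ∃ (x y : ℤ) (H : ℕ), Odd H ∧ x ^ 2 - l * y ^ 2 = q ^ H ∧ ¬ (q : ℤ) ∣ x := by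
  have hqp : Prime (q : ℤ) := Nat.prime_iff_prime_int.mp hq
  have hq0 : (q : ℤ) ≠ 0 := hqp.ne_zero
  have hqlne : ¬ (q : ℤ) ∣ l := fun h =>
    hlq ((Nat.prime_dvd_prime_iff_eq hq hl).mp (by exact_mod_cast h)).symm
  intro H
  induction H using Nat.strong_induction_on with
  | _ H ih =>
    intro x y hH hxy
    by_cases hx : (q : ℤ) ∣ x
    · have hH0 : H ≠ 0 := by rintro rfl; exact absurd hH (by decide)
      have hy : (q : ℤ) ∣ y := by
        have h1 : (q : ℤ) ∣ l * y ^ 2 := by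
          rw [show l * y ^ 2 = x ^ 2 - q ^ H by linear_combination - hxy]
          exact dvd_sub (dvd_pow hx two_ne_zero) (dvd_pow_self _ hH0)
        exact hqp.dvd_of_dvd_pow ((hqp.dvd_or_dvd h1).resolve_left hqlne)
      obtain ⟨x, rfl⟩ := hx
      obtain ⟨y, rfl⟩ := hy
      obtain ⟨c, rfl⟩ := hH
      rcases Nat.eq_zero_or_pos c with rfl | hc
      · exfalso
        have h1 : (q : ℤ) * (q * (x ^ 2 - l * y ^ 2)) = q * 1 := by linear_combination hxy
        have h2 := mul_left_cancel₀ hq0 h1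
        exact hqp.not_isUnit (IsUnit.of_mul_eq_one _ h2)
      · obtain ⟨c, rfl⟩ := Nat.exists_eq_succ_of_ne_zero hc.ne'
        refine ih (2 * c + 1) (by omega) x y ⟨c, rfl⟩ ?_
        apply mul_left_cancel₀ (pow_ne_zero 2 hq0)
        rw [← pow_add, show 2 + (2 * c + 1) = 2 * c.succ + 1 by omega, ← hxy]
        ring
    · exact ⟨x, y, H, hH, hxy, hx⟩

namespace RealQuad

variable {k : Type*} [Field k] [NumberField k] (R : RealQuad k)

theorem exists_sq_sub_eq_pow {q : ℕ} (hq : q.Prime) (hq2 : q ≠ 2) (hlq : R.l ≠ q) {r : ℤ}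
    (hr : (q : ℤ) ∣ r ^ 2 - R.l) :
    ∃ (x y : ℤ) (H : ℕ), Odd H ∧ x ^ 2 - R.l * y ^ 2 = q ^ H ∧ ¬ (q : ℤ) ∣ x := by
  have h2 : IsCoprime (q : 𝓞 ℚ) 2 := by
    have := Nat.isCoprime_iff_coprime.mpr ((Nat.coprime_primes hq Nat.prime_two).mpr hq2)
    have := this.map (Int.castRingHom (𝓞 ℚ))
    simpa using this
  have hd : IsCoprime (q : 𝓞 ℚ) (R.l : 𝓞 ℚ) := by
    have := Nat.isCoprime_iff_coprime.mpr ((Nat.coprime_primes hq R.prime_l).mpr hlq.symm)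
    have := this.map (Int.castRingHom (𝓞 ℚ))
    simpa using this
  obtain ⟨z, hz⟩ := hr
  obtain ⟨β, H, e, hH, hβ⟩ := R.Q.exists_mul_conj_eq (m := (q : 𝓞 ℚ)) (s := (r : 𝓞 ℚ))
    (d := (R.l : 𝓞 ℚ)) R.oddClass (by rw [R.δ_eq, coe_natCast]) h2 hd
    ⟨(z : 𝓞 ℚ), by exact_mod_cast congrArg (Int.cast : ℤ → 𝓞 ℚ) hz⟩
  have he : (e : 𝓞 ℚ) = 1 ∨ (e : 𝓞 ℚ) = -1 := by
    have := Int.isUnit_iff.mp (e.isUnit.map Rat.ringOfIntegersEquiv)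
    rcases this with h | h
    · left
      apply Rat.ringOfIntegersEquiv.injective
      rw [h, map_one]
    · right
      apply Rat.ringOfIntegersEquiv.injective
      rw [h, map_neg, map_one]
  obtain ⟨γ, hγ⟩ : ∃ γ : 𝓞 k, γ * R.τ γ = q ^ H := by
    rcases he with h | h
    · exact ⟨β, by rw [hβ, h, mul_one, map_pow, map_natCast]⟩
    · refine ⟨β * R.ε, ?_⟩
      rw [h, map_mul, map_neg, map_one, map_pow, map_natCast] at hβ
      rw [map_mul, mul_mul_mul_comm, hβ, R.ε_mul_τ]
      ring
  obtain ⟨a, b, rfl⟩ := R.exists_coords γ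
  rw [map_add, map_mul, map_intCast, map_intCast, R.τ_ω] at hγ
  have h1 : a * (a + b) - 2 * R.c * b ^ 2 = (q : ℤ) ^ H := by
    apply int_of_coe_eq (k := k)
    push_cast
    linear_combination hγ + b ^ 2 * R.ω_sq
  have hb : b % 2 = 0 := by
    have hodd : Odd ((q : ℤ) ^ H) := by
      apply Odd.pow
      exact_mod_cast hq.odd_of_ne_two hq2
    rw [← h1, Int.odd_sub', ] at hodd
    have h3 : ¬ Odd (2 * (R.c : ℤ) * b ^ 2) := by
      rw [Int.not_odd_iff_even]
      exact ⟨R.c * b ^ 2, by ring⟩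
    have h4 : Odd (a * (a + b)) := by
      by_contra h
      exact h3 (hodd.mpr (Int.not_odd_iff_even.mp h))
    obtain ⟨h5, h6⟩ := Int.odd_mul.mp h4
    have h5 := Int.odd_iff.mp h5
    have h6 := Int.odd_iff.mp h6
    omega
  obtain ⟨y, rfl⟩ := Int.dvd_of_emod_eq_zero hb
  refine exists_sq_sub_eq_pow_of_dvd R.prime_l hq hlq H (a + y) y hH ?_
  rw [← h1, R.l_cast]
  ring

open scoped NumberTheorySymbols in
theorem jacobiSym_ε {q : ℕ} (hq : q.Prime) (hq4 : q % 4 = 1) (hlq : R.l ≠ q)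
    (hql : (q : ZMod R.l) ^ ((R.l - 1) / 2) = 1) {r : ℤ} (hr : (q : ℤ) ∣ r ^ 2 - R.l) :
    J(R.u + R.v * r | q) = quartSym R.l q * quartSym q R.l := by
  obtain ⟨x, y, H, hH, hxy, hqx⟩ := R.exists_sq_sub_eq_pow hq (by omega) hlq hr
  exact jacobiSym_eq_quartSym_mul R.prime_l hq (by have := R.l_eq; omega) hq4 hlq hql R.norm_eq
    R.u_mod R.v_mod R.v_pos hH hxy hqx hr

end RealQuad

namespace RealQuad

variable {k : Type*} [Field k] [NumberField k] (R : RealQuad k)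

theorem prime_span_s : Prime (Ideal.span {R.s}) := by
  have h1 : Ideal.span {(R.l : 𝓞 k), R.s} = Ideal.span {R.s} := by
    apply le_antisymm
    · rw [Ideal.span_le]
      rintro _ (rfl | rfl)
      · exact Ideal.mem_span_singleton.mpr ⟨R.s, by rw [← R.s_sq, pow_two]⟩
      · exact Ideal.mem_span_singleton_self _
    · exact Ideal.span_mono (by simp)
  rw [← h1]
  have hl : (R.l : 𝓞 k) ∈ Ideal.span {(R.l : 𝓞 k), R.s} := Ideal.subset_span (Or.inl rfl)
  have hs : R.s ∈ Ideal.span {(R.l : 𝓞 k), R.s} := Ideal.subset_span (Or.inr rfl)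
  refine R.prime_of_mem (R.span_pair_ne_top R.prime_l ?_) R.prime_l hl (a := 4 * R.c + 1) ?_
  · rw [R.τ_s]
    exact ⟨-1, by linear_combination - R.s_sq⟩
  · have : R.ω - ((4 * R.c + 1 : ℤ) : 𝓞 k) =
        (R.ω - (4 * R.c + 1) + 4 * R.c) * R.l - 4 * R.c * R.s := by
      rw [R.l_cast]
      push_cast
      linear_combination (-4 * (R.c : 𝓞 k)) * R.two_mul_ω
    rw [this]
    exact sub_mem (Ideal.mul_mem_left _ _ hl) (Ideal.mul_mem_left _ _ hs)

theorem prime_span_pair {q : ℕ} (hq : q.Prime) (hq2 : q ≠ 2) {r : ℤ}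
    (hr : (q : ℤ) ∣ r ^ 2 - R.l) : Prime (Ideal.span {(q : 𝓞 k), R.s - r}) := by
  have hqm : (q : 𝓞 k) ∈ Ideal.span {(q : 𝓞 k), R.s - r} := Ideal.subset_span (Or.inl rfl)
  have hsm : R.s - r ∈ Ideal.span {(q : 𝓞 k), R.s - r} := Ideal.subset_span (Or.inr rfl)
  obtain ⟨e, he⟩ := hq.odd_of_ne_two hq2
  have he' : (q : 𝓞 k) = 2 * e + 1 := by exact_mod_cast congrArg (Nat.cast : ℕ → 𝓞 k) he
  refine R.prime_of_mem (R.span_pair_ne_top hq ?_) hq hqm (a := - e * (1 + r)) ?_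
  · obtain ⟨z, hz⟩ := hr
    have hz' : (r : 𝓞 k) ^ 2 - R.l = q * z := by exact_mod_cast congrArg (Int.cast : ℤ → 𝓞 k) hz
    rw [map_sub, R.τ_s, map_intCast]
    exact ⟨z, by linear_combination hz' - R.s_sq⟩
  · have : R.ω - ((- e * (1 + r) : ℤ) : 𝓞 k) =
        (R.ω - ((- e * (1 + r) : ℤ) : 𝓞 k) - e * (1 + r)) * q - e * (R.s - r) := by
      rw [he']
      push_cast
      linear_combination (-e : 𝓞 k) * R.two_mul_ω
    rw [this]
    exact sub_mem (Ideal.mul_mem_left _ _ hqm) (Ideal.mul_mem_left _ _ hsm)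

theorem isCoprime_natCast {A : Type*} [CommRing A] {a b : ℕ} (h : a.Coprime b) :
    IsCoprime (a : A) (b : A) := by
  have := (Nat.isCoprime_iff_coprime.mpr h).map (Int.castRingHom A)
  simpa using this

theorem prime_span_natCast {p : ℕ} (hp : p.Prime) (hp2 : p ≠ 2)
    (hin : ∀ x : ℤ, ¬ (p : ℤ) ∣ x ^ 2 - R.l) : Prime (Ideal.span {(p : 𝓞 k)}) := by
  have hp0 : (p : 𝓞 k) ≠ 0 := Nat.cast_ne_zero.mpr hp.ne_zero
  have hpp : Prime (p : ℤ) := Nat.prime_iff_prime_int.mp hp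
  have key : ∀ x : 𝓞 k, (p : 𝓞 k) ∣ x * R.τ x → (p : 𝓞 k) ∣ x := by
    intro x hx
    obtain ⟨a, b, rfl⟩ := R.exists_coords x
    have h1 : (p : ℤ) ∣ (2 * a + b) ^ 2 - R.l * b ^ 2 := by
      apply R.natCast_dvd_intCast _ hp.ne_zero
      refine (hx.mul_left 4).trans (dvd_of_eq ?_)
      push_cast
      rw [map_add, map_mul, map_intCast, map_intCast, R.τ_ω, R.l_cast]
      linear_combination -4 * b ^ 2 * R.ω_sq
    have hb : (p : ℤ) ∣ b := by
      by_contra hb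
      obtain ⟨c, d, hcd⟩ := hpp.coprime_iff_not_dvd.mpr hb
      apply hin ((2 * a + b) * d)
      have : ((2 * a + b) * d) ^ 2 - R.l =
          ((2 * a + b) ^ 2 - R.l * b ^ 2) * d ^ 2 - p * (R.l * c * (1 + d * b)) := by
        linear_combination (R.l * (1 + d * b)) * hcd
      rw [this]
      exact dvd_sub (h1.mul_right _) (Dvd.intro _ rfl)
    have ha : (p : ℤ) ∣ 2 * a + b := by
      apply hpp.dvd_of_dvd_pow (n := 2)
      have := dvd_add h1 ((dvd_pow hb two_ne_zero).mul_left (R.l : ℤ))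
      rwa [sub_add_cancel] at this
    have ha' : (p : ℤ) ∣ a := by
      have h2 : (p : ℤ) ∣ (2 : ℕ) * a := by
        have := dvd_sub ha hb
        rwa [add_sub_cancel_right] at this
      exact (Nat.isCoprime_iff_coprime.mpr ((Nat.coprime_primes hp Nat.prime_two).mpr
        hp2)).dvd_of_dvd_mul_left h2
    obtain ⟨a, rfl⟩ := ha'
    obtain ⟨b, rfl⟩ := hb
    exact ⟨a + b * R.ω, by push_cast; ring⟩
  have hprime : Prime (p : 𝓞 k) := by
    refine ⟨hp0, ?_, ?_⟩
    · intro hu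
      have h1 : (p : 𝓞 k) ∣ ((1 : ℤ) : 𝓞 k) := by
        rw [Int.cast_one]; exact isUnit_iff_dvd_one.mp hu
      exact hpp.not_isUnit (isUnit_iff_dvd_one.mpr (R.natCast_dvd_intCast h1 hp.ne_zero))
    · intro x y hxy
      obtain ⟨a, ha⟩ := R.exists_int_of_τ_eq (x := x * R.τ x) (by rw [map_mul, R.τ_τ, mul_comm])
      obtain ⟨b, hb⟩ := R.exists_int_of_τ_eq (x := y * R.τ y) (by rw [map_mul, R.τ_τ, mul_comm])
      have h1 : (p : ℤ) ∣ a * b := by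
        apply R.natCast_dvd_intCast _ hp.ne_zero
        refine (hxy.mul_right (R.τ (x * y))).trans (dvd_of_eq ?_)
        push_cast
        rw [← ha, ← hb, map_mul]
        ring
      have hcast : ∀ z : ℤ, (p : ℤ) ∣ z → (p : 𝓞 k) ∣ (z : 𝓞 k) := by
        rintro _ ⟨w, rfl⟩
        exact ⟨w, by push_cast; rfl⟩
      refine (hpp.dvd_or_dvd h1).imp (fun h => key x ?_) (fun h => key y ?_)
      · rw [ha]; exact hcast _ h
      · rw [hb]; exact hcast _ h
  rw [Ideal.prime_iff_isPrime (by simpa using hp0)]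
  exact (Ideal.span_singleton_prime hp0).mpr hprime

theorem isCoprime_two_mul {q : ℕ} (hq : q.Prime) (hq2 : q ≠ 2) (hql : q ≠ R.l) {r : ℤ}
    (hr : (q : ℤ) ∣ r ^ 2 - R.l) : IsCoprime (q : ℤ) (2 * r) := by
  have hqp : Prime (q : ℤ) := Nat.prime_iff_prime_int.mp hq
  refine IsCoprime.mul_right ?_ ?_
  · exact_mod_cast Nat.isCoprime_iff_coprime.mpr ((Nat.coprime_primes hq Nat.prime_two).mpr hq2)
  · apply hqp.coprime_iff_not_dvd.mpr
    intro h
    apply hql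
    have h2 : (q : ℤ) ∣ R.l := by
      have := dvd_sub (dvd_pow h two_ne_zero) hr
      rwa [sub_sub_cancel] at this
    exact (Nat.prime_dvd_prime_iff_eq hq R.prime_l).mp (by exact_mod_cast h2)

theorem span_pair_mul_span_pair {q : ℕ} (hq : q.Prime) (hq2 : q ≠ 2) (hql : q ≠ R.l) {r : ℤ}
    (hr : (q : ℤ) ∣ r ^ 2 - R.l) :
    Ideal.span {(q : 𝓞 k), R.s - r} * Ideal.span {(q : 𝓞 k), R.s - (-r : ℤ)} =
      Ideal.span {(q : 𝓞 k)} := by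
  obtain ⟨x, y, hxy⟩ := R.isCoprime_two_mul hq hq2 hql hr
  have hxy' : (x : 𝓞 k) * q + y * (2 * r) = 1 := by
    exact_mod_cast congrArg (Int.cast : ℤ → 𝓞 k) hxy
  rw [Ideal.span_pair_mul_span_pair]
  apply le_antisymm
  · rw [Ideal.span_le]
    rintro _ (rfl | rfl | rfl | rfl)
    · exact Ideal.mem_span_singleton.mpr (Dvd.intro _ rfl)
    · exact Ideal.mem_span_singleton.mpr (Dvd.intro _ rfl)
    · exact Ideal.mem_span_singleton.mpr (Dvd.intro_left _ rfl)
    · obtain ⟨z, hz⟩ := hr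
      have hz' : (r : 𝓞 k) ^ 2 - R.l = q * z := by exact_mod_cast congrArg (Int.cast : ℤ → 𝓞 k) hz
      refine Ideal.mem_span_singleton.mpr ⟨-z, ?_⟩
      push_cast
      linear_combination - hz' + R.s_sq
  · rw [Ideal.span_singleton_le_iff_mem]
    have h4 : (q : 𝓞 k) = x * (q * q) + y * (q * (R.s - (-r : ℤ)) - (R.s - r) * q) := by
      push_cast
      linear_combination - (q : 𝓞 k) * hxy'
    have h7 : (x : 𝓞 k) * (q * q) + y * (q * (R.s - (-r : ℤ)) - (R.s - r) * q) ∈ Ideal.span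
        {(q : 𝓞 k) * q, q * (R.s - (-r : ℤ)), (R.s - r) * q, (R.s - r) * (R.s - (-r : ℤ))} :=
      add_mem (Ideal.mul_mem_left _ _ (Ideal.subset_span (Or.inl rfl)))
        (Ideal.mul_mem_left _ _ (sub_mem (Ideal.subset_span (Or.inr (Or.inl rfl)))
          (Ideal.subset_span (Or.inr (Or.inr (Or.inl rfl))))))
    rwa [← h4] at h7

end RealQuad

/-- Two families of primes `≡ 1 (mod 4)`: the `p i` are inert in `k`, the `q j` split. -/
structure RealQuad.Radicand {k : Type*} [Field k] [NumberField k] (R : RealQuad k)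
    (t₁ t₂ : ℕ) where
  p : Fin t₁ → ℕ
  q : Fin t₂ → ℕ
  r : Fin t₂ → ℤ
  prime_p : ∀ i, (p i).Prime
  prime_q : ∀ j, (q j).Prime
  p_inj : Function.Injective p
  q_inj : Function.Injective q
  p_ne_q : ∀ i j, p i ≠ q j
  p_ne_l : ∀ i, p i ≠ R.l
  q_ne_l : ∀ j, q j ≠ R.l
  p_mod : ∀ i, p i % 4 = 1
  q_mod : ∀ j, q j % 4 = 1
  p_inert : ∀ i (x : ℤ), ¬ (p i : ℤ) ∣ x ^ 2 - R.l
  q_split : ∀ j, (q j : ℤ) ∣ r j ^ 2 - R.l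
  q_euler : ∀ j, (q j : ZMod R.l) ^ ((R.l - 1) / 2) = 1

namespace RealQuad.Radicand

variable {k : Type*} [Field k] [NumberField k] {R : RealQuad k} {t₁ t₂ : ℕ} (N : R.Radicand t₁ t₂)

/-- The product of all the primes. -/
def n : ℕ := (∏ i, N.p i) * ∏ j, N.q j

/-- The integer `n ε √l`. -/
noncomputable def d : 𝓞 k := N.n * R.ε * R.s

theorem p_ne_two (i : Fin t₁) : N.p i ≠ 2 := by have := N.p_mod i; omega

theorem q_ne_two (j : Fin t₂) : N.q j ≠ 2 := by have := N.q_mod j; omega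

/-- The prime ideals dividing `n ε √l`. -/
noncomputable def primeIdeal : Unit ⊕ Fin t₁ ⊕ Fin t₂ ⊕ Fin t₂ → Ideal (𝓞 k) :=
  Sum.elim (fun _ => Ideal.span {R.s}) (Sum.elim (fun i => Ideal.span {(N.p i : 𝓞 k)})
    (Sum.elim (fun j => Ideal.span {(N.q j : 𝓞 k), R.s - N.r j})
      (fun j => Ideal.span {(N.q j : 𝓞 k), R.s - (-N.r j : ℤ)})))

/-- The rational primes below the prime ideals dividing `n ε √l`. -/
def primeBelow : Unit ⊕ Fin t₁ ⊕ Fin t₂ ⊕ Fin t₂ → ℕ :=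
  Sum.elim (fun _ => R.l) (Sum.elim N.p (Sum.elim N.q N.q))

theorem prime_primeBelow (x) : (N.primeBelow x).Prime := by
  rcases x with x | x | x | x
  exacts [R.prime_l, N.prime_p _, N.prime_q _, N.prime_q _]

theorem q_split' (j : Fin t₂) : (N.q j : ℤ) ∣ (-N.r j) ^ 2 - R.l := by
  rw [neg_sq]; exact N.q_split j

theorem prime_primeIdeal (x) : Prime (N.primeIdeal x) := by
  rcases x with x | x | x | x
  · exact R.prime_span_s
  · exact R.prime_span_natCast (N.prime_p x) (N.p_ne_two x) (N.p_inert x)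
  · exact R.prime_span_pair (N.prime_q x) (N.q_ne_two x) (N.q_split x)
  · exact R.prime_span_pair (N.prime_q x) (N.q_ne_two x) (N.q_split' x)

theorem primeBelow_mem (x) : (N.primeBelow x : 𝓞 k) ∈ N.primeIdeal x := by
  rcases x with x | x | x | x
  · exact Ideal.mem_span_singleton.mpr
      ⟨R.s, by rw [← pow_two, R.s_sq]; rfl⟩
  · exact Ideal.mem_span_singleton_self _
  · exact Ideal.subset_span (Or.inl rfl)
  · exact Ideal.subset_span (Or.inl rfl)

theorem eq_top_of_isCoprime {A : Type*} [CommRing A] {I : Ideal A} {a b : A} (h : IsCoprime a b)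
    (ha : a ∈ I) (hb : b ∈ I) : I = ⊤ := by
  obtain ⟨x, y, hxy⟩ := h
  rw [Ideal.eq_top_iff_one, ← hxy]
  exact add_mem (I.mul_mem_left _ ha) (I.mul_mem_left _ hb)

theorem primeBelow_eq {x y} (h : N.primeIdeal x = N.primeIdeal y) :
    N.primeBelow x = N.primeBelow y := by
  by_contra hne
  refine (Ideal.isPrime_of_prime (N.prime_primeIdeal x)).ne_top (eq_top_of_isCoprime
    (isCoprime_natCast ((Nat.coprime_primes (N.prime_primeBelow x) (N.prime_primeBelow y)).mpr hne))
    (N.primeBelow_mem x) ?_)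
  rw [h]
  exact N.primeBelow_mem y

theorem span_pair_ne_span_pair (j : Fin t₂) :
    Ideal.span {(N.q j : 𝓞 k), R.s - N.r j} ≠ Ideal.span {(N.q j : 𝓞 k), R.s - (-N.r j : ℤ)} := by
  intro h
  have hcop := (R.isCoprime_two_mul (N.prime_q j) (N.q_ne_two j) (N.q_ne_l j) (N.q_split j)).map
    (Int.castRingHom (𝓞 k))
  refine (Ideal.isPrime_of_prime (N.prime_primeIdeal (Sum.inr (Sum.inr (Sum.inl j))))).ne_top
    (eq_top_of_isCoprime hcop ?_ ?_)
  · exact Ideal.subset_span (Or.inl (by simp))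
  · have h1 : R.s - N.r j ∈ Ideal.span {(N.q j : 𝓞 k), R.s - N.r j} :=
      Ideal.subset_span (Or.inr rfl)
    have h2 : R.s - (-N.r j : ℤ) ∈ Ideal.span {(N.q j : 𝓞 k), R.s - N.r j} := by
      rw [h]; exact Ideal.subset_span (Or.inr rfl)
    have h3 := sub_mem h2 h1
    have h4 : R.s - ((-N.r j : ℤ) : 𝓞 k) - (R.s - N.r j) = Int.castRingHom (𝓞 k) (2 * N.r j) := by
      push_cast
      simp
      ring
    rwa [h4] at h3

theorem primeIdeal_injective : Function.Injective N.primeIdeal := by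
  intro x y h
  have h1 := N.primeBelow_eq h
  rcases x with x | x | x | x <;> rcases y with y | y | y | y
  · rfl
  · exact absurd h1.symm (N.p_ne_l y)
  · exact absurd h1.symm (N.q_ne_l y)
  · exact absurd h1.symm (N.q_ne_l y)
  · exact absurd h1 (N.p_ne_l x)
  · rw [N.p_inj h1]
  · exact absurd h1 (N.p_ne_q x y)
  · exact absurd h1 (N.p_ne_q x y)
  · exact absurd h1 (N.q_ne_l x)
  · exact absurd h1.symm (N.p_ne_q y x)
  · rw [N.q_inj h1]
  · obtain rfl := N.q_inj h1
    exact absurd h (N.span_pair_ne_span_pair x)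
  · exact absurd h1 (N.q_ne_l x)
  · exact absurd h1.symm (N.p_ne_q y x)
  · obtain rfl := N.q_inj h1
    exact absurd h.symm (N.span_pair_ne_span_pair x)
  · rw [N.q_inj h1]

theorem span_d : Ideal.span {N.d} = ∏ x, N.primeIdeal x := by
  rw [Fintype.prod_sum_type, Fintype.prod_sum_type, Fintype.prod_sum_type, ← Finset.prod_mul_distrib]
  have h1 : ∀ j, N.primeIdeal (Sum.inr (Sum.inr (Sum.inl j))) *
      N.primeIdeal (Sum.inr (Sum.inr (Sum.inr j))) = Ideal.span {(N.q j : 𝓞 k)} := fun j =>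
    R.span_pair_mul_span_pair (N.prime_q j) (N.q_ne_two j) (N.q_ne_l j) (N.q_split j)
  have h2 : ∀ i, N.primeIdeal (Sum.inr (Sum.inl i)) = Ideal.span {(N.p i : 𝓞 k)} := fun i => rfl
  have h3 : ∀ i, N.primeIdeal (Sum.inl i) = Ideal.span {R.s} := fun i => rfl
  simp only [h1, h2, h3, Finset.univ_unique, Finset.prod_singleton, Ideal.prod_span_singleton,
    Ideal.span_singleton_mul_span_singleton]
  rw [Ideal.span_singleton_eq_span_singleton]
  refine (Associated.symm ⟨R.ε, ?_⟩)
  rw [d, n]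
  push_cast
  ring

end RealQuad.Radicand

namespace RealQuad.Radicand

variable {k K : Type*} [Field k] [NumberField k] [Field K] [NumberField K] [Algebra k K]
  {R : RealQuad k} {t₁ t₂ : ℕ} (N : R.Radicand t₁ t₂) (Q : QuadExt k K)

theorem n_mod : N.n % 4 = 1 := by
  have h1 : (∏ i, N.p i) % 4 = 1 := Finset.prod_induction _ (fun x => x % 4 = 1)
    (fun a b ha hb => by simp [Nat.mul_mod, ha, hb]) rfl (fun i _ => N.p_mod i)
  have h2 : (∏ i, N.q i) % 4 = 1 := Finset.prod_induction _ (fun x => x % 4 = 1)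
    (fun a b ha hb => by simp [Nat.mul_mod, ha, hb]) rfl (fun i _ => N.q_mod i)
  simp [n, Nat.mul_mod, h1, h2]

theorem n_pos : 0 < N.n := by have := N.n_mod; omega

theorem exists_four_mul_eq : ∃ c : 𝓞 k, N.d = 4 * c + 1 := by
  obtain ⟨a, ha⟩ := Int.dvd_of_emod_eq_zero R.u_mod
  obtain ⟨b, hb⟩ : ∃ b, R.v = 4 * b + 1 := ⟨R.v / 4, by have := R.v_mod; omega⟩
  obtain ⟨m, hm⟩ : ∃ m, N.n = 4 * m + 1 := ⟨N.n / 4, by have := N.n_mod; omega⟩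
  refine ⟨(4 * m + 1) * (a * R.s + b * (8 * R.c + 1) + 2 * R.c) + m, ?_⟩
  rw [d, hm, R.coe_ε, ha, hb]
  have := R.s_sq
  rw [R.l_cast] at this
  push_cast
  linear_combination ((4 * m + 1) * (4 * b + 1) : 𝓞 k) * this

theorem relIndex_selmerTwo (hδ : Q.δ = N.d) :
    (selmerTwo k).relIndex ((selmerTwo K).comap Q.incl) = 2 ^ (1 + t₁ + 2 * t₂) := by
  classical
  obtain ⟨c, hc⟩ := N.exists_four_mul_eq
  have hck : (N.d : k) = 4 * c + 1 := congrArg (algebraMap (𝓞 k) k) hc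
  have hcK := congrArg (algebraMap k K) hck
  rw [map_add, map_mul, map_one, map_ofNat, ← hδ, ← Q.ρ_sq] at hcK
  obtain ⟨θ, hθ⟩ := exists_integer_of_sq_eq (x := (1 + Q.ρ) / 2) (b := 1)
    (c := algebraMap (𝓞 k) (𝓞 K) c) (by
      change _ = (1 : K) * _ + algebraMap k K (c : k)
      linear_combination hcK / 4)
  have hP := Q.relIndex_selmerTwo_eq R.oddClass
    (Finset.univ.map ⟨N.primeIdeal, N.primeIdeal_injective⟩) (fun 𝔭 h𝔭 => by
      obtain ⟨x, -, rfl⟩ := Finset.mem_map.mp h𝔭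
      exact N.prime_primeIdeal x) θ N.d (by
      apply RingOfIntegers.ext
      change algebraMap k K (N.d : k) = _
      rw [coe_pow, coe_sub, Q.coe_σR, hθ, map_div₀, map_add, map_one, map_ofNat, Q.σ_ρ, ← hδ,
        ← Q.ρ_sq]
      ring) (by rw [N.span_d, Finset.prod_map]; rfl)
  rw [hP, Finset.card_map, Finset.card_univ]
  simp only [Fintype.card_sum, Fintype.card_unit, Fintype.card_fin]
  congr 1
  omega

open ComplexConjugate in
theorem isTotallyReal (hδ : Q.δ = N.d) : IsTotallyReal K := by
  refine ⟨fun w => ?_⟩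
  rw [← InfinitePlace.mk_embedding w, InfinitePlace.isReal_mk_iff, ComplexEmbedding.isReal_iff]
  set φ := w.embedding
  have hsq : ∀ (z : ℂ) (t : ℝ), 0 ≤ t → z ^ 2 = t → conj z = z := by
    intro z t ht hz
    have h1 : z ^ 2 = ((Real.sqrt t : ℝ) : ℂ) ^ 2 := by
      rw [hz, ← Complex.ofReal_pow, Real.sq_sqrt ht]
    rcases sq_eq_sq_iff_eq_or_eq_neg.mp h1 with h | h <;> rw [h]
    · exact Complex.conj_ofReal _
    · rw [map_neg, Complex.conj_ofReal]
  set x := φ (algebraMap k K R.Q.ρ) with hx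
  have hx2 : x ^ 2 = ((R.l : ℝ) : ℂ) := by
    rw [hx, ← map_pow, ← map_pow, R.ρ_sq, map_natCast, map_natCast, Complex.ofReal_natCast]
  have hxc := hsq x _ (Nat.cast_nonneg _) hx2
  obtain ⟨y, hy⟩ := Complex.conj_eq_iff_real.mp hxc
  have hy2 : y ^ 2 = R.l := by rw [hy] at hx2; exact_mod_cast hx2
  have hρ2 : φ Q.ρ ^ 2 = ((N.n * (R.u * y + R.v * R.l) : ℝ) : ℂ) := by
    rw [← map_pow, Q.ρ_sq, hδ]
    have h1 : (N.d : k) = N.n * (R.u * R.Q.ρ + R.v * R.l) := by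
      rw [d, coe_mul, coe_mul, coe_natCast, ← R.ρ_sq, R.coe_s]
      change _ * (R.εk : k) * _ = _
      rw [R.coe_εk]
      ring
    rw [h1]
    simp only [map_mul, map_add, map_natCast, map_intCast]
    rw [← hx, hy]
    push_cast
    ring
  have hpos : (0 : ℝ) ≤ N.n * (R.u * y + R.v * R.l) := by
    refine mul_nonneg (Nat.cast_nonneg _) ?_
    have hu : (0 : ℝ) < R.u := by exact_mod_cast R.u_pos
    have hv : (0 : ℝ) < R.v := by exact_mod_cast R.v_pos
    have hl : (0 : ℝ) < R.l := by exact_mod_cast R.prime_l.pos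
    have hn : (R.u : ℝ) ^ 2 - R.l * R.v ^ 2 = -1 := by exact_mod_cast R.norm_eq
    have h1 : |R.u * y| ≤ |(R.v * R.l : ℝ)| := by
      apply sq_le_sq.mp
      rw [mul_pow, hy2]
      nlinarith
    rw [abs_of_pos (mul_pos hv hl)] at h1
    have := neg_abs_le (R.u * y)
    linarith
  have hρc := hsq _ _ hpos hρ2
  ext z
  rw [ComplexEmbedding.conjugate_coe_eq]
  obtain ⟨a, b, rfl⟩ := Q.exists_coords z
  have hk : ∀ a : k, conj (φ (algebraMap k K a)) = φ (algebraMap k K a) := by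
    intro a
    obtain ⟨e, f, rfl⟩ := R.Q.exists_coords a
    simp only [map_add, map_mul, eq_ratCast, map_ratCast]
    rw [← hx, hxc]
  rw [map_add, map_mul, map_add, map_mul, hk, hk, hρc]

theorem exists_sq_add_sq : ∃ x y : ℤ, 2 * N.n * R.v = x ^ 2 + y ^ 2 := by
  have hmul : ∀ a b : ℤ, (∃ x y : ℤ, a = x ^ 2 + y ^ 2) → (∃ x y : ℤ, b = x ^ 2 + y ^ 2) →
      ∃ x y : ℤ, a * b = x ^ 2 + y ^ 2 := by
    rintro _ _ ⟨x, y, rfl⟩ ⟨z, w, rfl⟩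
    exact ⟨x * z - y * w, x * w + y * z, by ring⟩
  have hprime : ∀ p : ℕ, p.Prime → p % 4 = 1 → ∃ x y : ℤ, (p : ℤ) = x ^ 2 + y ^ 2 := by
    intro p hp hp4
    have : Fact p.Prime := ⟨hp⟩
    obtain ⟨a, b, h⟩ := Nat.Prime.sq_add_sq (p := p) (by omega)
    exact ⟨a, b, by exact_mod_cast h.symm⟩
  refine hmul _ _ (hmul _ _ ⟨1, 1, by norm_num⟩ ?_) ?_
  · rw [n, Nat.cast_mul, Nat.cast_prod, Nat.cast_prod]
    exact hmul _ _ (Finset.prod_induction _ _ hmul ⟨1, 0, by norm_num⟩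
      fun i _ => hprime _ (N.prime_p i) (N.p_mod i)) (Finset.prod_induction _ _ hmul
      ⟨1, 0, by norm_num⟩ fun i _ => hprime _ (N.prime_q i) (N.q_mod i))
  · obtain ⟨w, hw⟩ := Int.eq_ofNat_of_zero_le R.v_pos.le
    have h1 : IsSquare (-1 : ZMod w) := by
      refine ⟨(R.u : ZMod w), ?_⟩
      have h := congrArg (Int.cast : ℤ → ZMod w) R.norm_eq
      rw [hw] at h
      push_cast at h
      rw [ZMod.natCast_self] at h
      linear_combination - h
    obtain ⟨x, y, h⟩ := Nat.eq_sq_add_sq_of_isSquare_mod_neg_one h1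
    exact ⟨x, y, by rw [hw]; exact_mod_cast h⟩

theorem neg_one_mem_norm_range (hδ : Q.δ = N.d) : (-1 : kˣ) ∈ Q.norm.range := by
  obtain ⟨x, y, hxy⟩ := N.exists_sq_add_sq
  have hxy' : (2 * N.n * R.v : k) = x ^ 2 + y ^ 2 := by
    exact_mod_cast congrArg (Int.cast : ℤ → k) hxy
  have hv : (R.v : k) ≠ 0 := Int.cast_ne_zero.mpr R.v_pos.ne'
  have hd : (N.d : k) = N.n * R.εk * R.Q.ρ := by
    rw [d, coe_mul, coe_mul, coe_natCast, R.coe_s]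
    rfl
  have hε : (R.εk : k) ^ 2 + 1 = 2 * R.v * R.εk * R.Q.ρ := by
    rw [R.coe_εk]
    have h := congrArg (Int.cast : ℤ → k) R.norm_eq
    push_cast at h
    linear_combination h - R.v ^ 2 * R.ρ_sq
  have hsum : Q.δ = ((x * R.εk + y) / (2 * R.v)) ^ 2 + ((x - y * R.εk) / (2 * R.v)) ^ 2 := by
    rw [hδ, hd]
    field_simp
    linear_combination (R.v * 2) * (R.εk : k) * R.Q.ρ * hxy' - (x ^ 2 + y ^ 2 : k) * hε
  obtain ⟨A, B, hAB⟩ : ∃ A B, Q.δ = A ^ 2 + B ^ 2 := ⟨_, _, hsum⟩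
  have hB : B ≠ 0 := by
    rintro rfl
    rw [zero_pow two_ne_zero, add_zero] at hAB
    exact Q.δ_not_sq _ hAB.symm
  rw [Q.mem_norm_range_iff]
  refine ⟨A / B, 1 / B, ?_⟩
  rw [hAB, Units.val_neg, Units.val_one]
  field_simp
  ring

theorem card_mul_eq (hδ : Q.δ = N.d) :
    Nat.card {x : ClassGroup (𝓞 K) // x ^ 2 = 1} * 4 =
      2 ^ (t₁ + 2 * t₂) * (squares kˣ).relIndex (selmerTwo k ⊓ Q.norm.range) := by
  have := N.isTotallyReal Q hδ
  have h4 : Module.finrank ℚ K = 4 := by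
    rw [← Module.finrank_mul_finrank ℚ k K, R.Q.finrank_eq_two, Q.finrank_eq_two]
  have h := Q.index_formula R.oddClass
  rw [index_squares_units, rank_of_isTotallyReal, h4, Q.relIndex_comap_selmerTwo,
    R.relIndex_selmerTwo, N.relIndex_selmerTwo Q hδ] at h
  have h2 : 2 ^ (1 + t₁ + 2 * t₂) = 2 * 2 ^ (t₁ + 2 * t₂) := by rw [add_assoc, pow_add, pow_one]
  rw [h2, show 4 - 1 + 1 = 4 from rfl] at h
  apply Nat.eq_of_mul_eq_mul_left (show 0 < 8 by norm_num)
  linear_combination h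

theorem card_eq_of_ε_mem (hδ : Q.δ = N.d) (hε : R.εk ∈ Q.norm.range) :
    Nat.card {x : ClassGroup (𝓞 K) // x ^ 2 = 1} = 2 ^ (t₁ + 2 * t₂) := by
  have h1 := N.neg_one_mem_norm_range Q hδ
  have h2 : selmerTwo k ⊓ Q.norm.range = selmerTwo k := by
    refine inf_eq_left.mpr fun x hx => ?_
    rcases R.mem_selmerTwo_cases hx with h | h | h | h
    · exact Q.squares_le_norm_range h
    · exact (Subgroup.mul_mem_cancel_left _ h1).mp (Q.squares_le_norm_range h)
    · exact (Subgroup.mul_mem_cancel_left _ hε).mp (Q.squares_le_norm_range h)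
    · exact (Subgroup.mul_mem_cancel_left _ (mul_mem h1 hε)).mp (Q.squares_le_norm_range h)
  have h := N.card_mul_eq Q hδ
  rw [h2, R.relIndex_selmerTwo] at h
  omega

theorem card_eq_of_ε_notMem (hδ : Q.δ = N.d) (ht : 1 ≤ t₁ + t₂) (hε : R.εk ∉ Q.norm.range) :
    Nat.card {x : ClassGroup (𝓞 K) // x ^ 2 = 1} = 2 ^ (t₁ + 2 * t₂ - 1) := by
  have h1 := N.neg_one_mem_norm_range Q hδ
  have h := N.card_mul_eq Q hδ
  have h2 := Q.relIndex_inf_norm_mul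
  rw [R.relIndex_selmerTwo] at h2
  have h3 : (squares kˣ).relIndex (selmerTwo k ⊓ Q.norm.range) ≠ 1 := by
    intro h4
    exact R.neg_one_notMem (Subgroup.relIndex_eq_one.mp h4 ⟨neg_one_mem_selmerTwo, h1⟩)
  have h4 : (squares kˣ).relIndex (selmerTwo k ⊓ Q.norm.range) ≠ 4 := by
    intro h4
    rw [h4] at h2
    have h5 : (selmerTwo k ⊓ Q.norm.range).relIndex (selmerTwo k) = 1 := by omega
    exact hε (Subgroup.relIndex_eq_one.mp h5 R.ε_mem_selmerTwo).2
  have h5 : (squares kˣ).relIndex (selmerTwo k ⊓ Q.norm.range) = 2 := by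
    have hle := Nat.le_of_dvd (by norm_num) (Dvd.intro _ h2)
    generalize (squares kˣ).relIndex (selmerTwo k ⊓ Q.norm.range) = m at *
    interval_cases m <;> omega
  rw [h5] at h
  obtain ⟨t, ht'⟩ : ∃ t, t₁ + 2 * t₂ = t + 1 := ⟨t₁ + 2 * t₂ - 1, by omega⟩
  rw [ht', pow_succ] at h
  rw [ht', Nat.add_sub_cancel]
  omega

end RealQuad.Radicand

namespace QuadExt

variable {k K : Type*} [Field k] [NumberField k] [Field K] [NumberField K] [Algebra k K]
  (Q : QuadExt k K)

theorem exists_sq_sub_mul_mem_of_notMem_pow {𝔮 : Ideal (𝓞 k)} (h𝔮 : 𝔮.IsPrime) {d e w c : 𝓞 k}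
    (hd : d ∈ 𝔮) (hd2 : d ∉ 𝔮 ^ 2) (hw : w ∉ 𝔮) (hc0 : c ≠ 0) (hc : c ∈ 𝔮)
    (hcw : ∀ x ∈ 𝔮, c ∣ w * x) :
    ∀ (M : ℕ) (x y z : 𝓞 k), x ^ 2 - d * y ^ 2 = e * z ^ 2 → z ∉ 𝔮 ^ M →
      ∃ x z : 𝓞 k, z ∉ 𝔮 ∧ x ^ 2 - e * z ^ 2 ∈ 𝔮 := by
  intro M
  induction M with
  | zero => intro x y z _ hz; simp at hz
  | succ M ih =>
    intro x y z h hz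
    by_cases hz𝔮 : z ∈ 𝔮
    · have hx : x ∈ 𝔮 := by
        apply h𝔮.mem_of_pow_mem 2
        rw [show x ^ 2 = y ^ 2 * d + e * z * z by linear_combination h]
        exact add_mem (𝔮.mul_mem_left _ hd) (𝔮.mul_mem_left _ hz𝔮)
      have hy : y ∈ 𝔮 := by
        have h1 : d * y ^ 2 ∈ 𝔮 ^ 2 := by
          rw [show d * y ^ 2 = x ^ 2 - e * z ^ 2 by linear_combination - h]
          exact sub_mem (Ideal.pow_mem_pow hx 2) (Ideal.mul_mem_left _ _ (Ideal.pow_mem_pow hz𝔮 2))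
        exact h𝔮.mem_of_pow_mem 2 ((h𝔮.mem_pow_mul _ h1).resolve_left hd2)
      obtain ⟨x', hx'⟩ := hcw x hx
      obtain ⟨y', hy'⟩ := hcw y hy
      obtain ⟨z', hz'⟩ := hcw z hz𝔮
      refine ih x' y' z' ?_ ?_
      · apply mul_left_cancel₀ (pow_ne_zero 2 hc0)
        linear_combination w ^ 2 * h - (w * x + c * x') * hx' + d * (w * y + c * y') * hy' +
          e * (w * z + c * z') * hz'
      · intro hz'M
        apply hz
        have h1 : z * w ∈ 𝔮 ^ (M + 1) := by
          rw [mul_comm, hz', pow_succ']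
          exact Ideal.mul_mem_mul hc hz'M
        exact (h𝔮.mem_pow_mul _ h1).resolve_right hw
    · refine ⟨x, z, hz𝔮, ?_⟩
      rw [show x ^ 2 - e * z ^ 2 = y ^ 2 * d by linear_combination h]
      exact 𝔮.mul_mem_left _ hd

theorem exists_sq_sub_mul_mem {𝔮 : Ideal (𝓞 k)} (h𝔮 : 𝔮.IsPrime) {d e w c : 𝓞 k}
    (hδ : Q.δ = d) (hd : d ∈ 𝔮) (hd2 : d ∉ 𝔮 ^ 2) (hw : w ∉ 𝔮) (hc0 : c ≠ 0) (hc : c ∈ 𝔮)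
    (hcw : ∀ x ∈ 𝔮, c ∣ w * x) {g : kˣ} (hg : (g : k) = e) (hgN : g ∈ Q.norm.range) :
    ∃ x z : 𝓞 k, z ∉ 𝔮 ∧ x ^ 2 - e * z ^ 2 ∈ 𝔮 := by
  classical
  obtain ⟨a, b, hab⟩ := Q.mem_norm_range_iff.mp hgN
  obtain ⟨⟨z, hz⟩, h⟩ := IsLocalization.exist_integer_multiples_of_finset (𝓞 k)⁰
    ({a, b} : Finset k)
  obtain ⟨x, hx⟩ := h a (by simp)
  obtain ⟨y, hy⟩ := h b (by simp)
  rw [Algebra.smul_def] at hx hy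
  have hz0 : z ≠ 0 := nonZeroDivisors.ne_zero hz
  have heq : x ^ 2 - d * y ^ 2 = e * z ^ 2 := by
    apply RingOfIntegers.ext
    change (x : k) ^ 2 - d * (y : k) ^ 2 = e * (z : k) ^ 2
    have hx' : (x : k) = (z : k) * a := hx
    have hy' : (y : k) = (z : k) * b := hy
    rw [hx', hy', ← hg, ← hδ, ← hab]
    ring
  obtain ⟨M, hM⟩ : ∃ M, z ∉ 𝔮 ^ M := by
    by_contra! hall
    have h1 : z ∈ ⨅ i : ℕ, 𝔮 ^ i := by
      rw [Ideal.mem_iInf]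
      exact hall
    rw [Ideal.iInf_pow_eq_bot_of_isDomain 𝔮 h𝔮.ne_top] at h1
    exact hz0 ((Submodule.mem_bot _).mp h1)
  exact exists_sq_sub_mul_mem_of_notMem_pow h𝔮 hd hd2 hw hc0 hc hcw M x y z heq hM

end QuadExt

namespace RealQuad.Radicand

variable {k K : Type*} [Field k] [NumberField k] [Field K] [NumberField K] [Algebra k K]
  {R : RealQuad k} {t₁ t₂ : ℕ} (N : R.Radicand t₁ t₂) (Q : QuadExt k K)

theorem d_notMem_sq (x) : N.d ∉ N.primeIdeal x ^ 2 := by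
  classical
  intro h
  have h1 : N.primeIdeal x ^ 2 ∣ Ideal.span {N.d} :=
    Ideal.dvd_iff_le.mpr ((Ideal.span_singleton_le_iff_mem _).mpr h)
  rw [N.span_d, ← Finset.mul_prod_erase _ _ (Finset.mem_univ x), pow_two] at h1
  have h2 := (mul_dvd_mul_iff_left (N.prime_primeIdeal x).ne_zero).mp h1
  obtain ⟨y, hy, hxy⟩ := ((N.prime_primeIdeal x).dvd_finsetProd_iff _).mp h2
  have h3 := associated_iff_eq.mp
    (((N.prime_primeIdeal x).dvd_prime_iff_associated (N.prime_primeIdeal y)).mp hxy)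
  exact Finset.ne_of_mem_erase hy (N.primeIdeal_injective h3).symm

theorem d_mem (x) : N.d ∈ N.primeIdeal x := by
  apply Ideal.dvd_span_singleton.mp
  rw [N.span_d]
  exact Finset.dvd_prod_of_mem _ (Finset.mem_univ x)

open scoped NumberTheorySymbols in
theorem jacobiSym_eq_one_of_ε_mem (hδ : Q.δ = N.d) (hε : R.εk ∈ Q.norm.range) (j : Fin t₂) :
    J(R.u + R.v * N.r j | N.q j) = 1 := by
  set 𝔮 := N.primeIdeal (Sum.inr (Sum.inr (Sum.inl j))) with h𝔮def
  have h𝔮 : 𝔮.IsPrime := Ideal.isPrime_of_prime (N.prime_primeIdeal _)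
  have hqm : (N.q j : 𝓞 k) ∈ 𝔮 := Ideal.subset_span (Or.inl rfl)
  have hsm : R.s - N.r j ∈ 𝔮 := Ideal.subset_span (Or.inr rfl)
  have hqp : Prime (N.q j : ℤ) := Nat.prime_iff_prime_int.mp (N.prime_q j)
  have hinteg : ∀ z : ℤ, (z : 𝓞 k) ∈ 𝔮 → (N.q j : ℤ) ∣ z := by
    intro z hz
    by_contra hnd
    have h1 := (hqp.coprime_iff_not_dvd.mpr hnd).map (Int.castRingHom (𝓞 k))
    exact h𝔮.ne_top (eq_top_of_isCoprime h1 (by simpa using hqm) (by simpa using hz))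
  have hcop := R.isCoprime_two_mul (N.prime_q j) (N.q_ne_two j) (N.q_ne_l j) (N.q_split j)
  have h2𝔮 : (2 : 𝓞 k) ∉ 𝔮 := by
    intro h
    have h1 := hinteg 2 (by exact_mod_cast h)
    have h2 : IsCoprime (N.q j : ℤ) 2 := hcop.of_mul_right_left
    exact hqp.coprime_iff_not_dvd.mp h2 h1
  have hmod : ∀ x : 𝓞 k, ∃ a : ℤ, 2 * x - a ∈ 𝔮 := by
    intro x
    obtain ⟨a, b, rfl⟩ := R.exists_coords x
    refine ⟨2 * a + b + b * N.r j, ?_⟩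
    have : 2 * (a + b * R.ω) - ((2 * a + b + b * N.r j : ℤ) : 𝓞 k) = b * (R.s - N.r j) := by
      push_cast
      linear_combination (b : 𝓞 k) * R.two_mul_ω
    rw [this]
    exact 𝔮.mul_mem_left _ hsm
  have hw : R.s - (-N.r j : ℤ) ∉ 𝔮 := by
    intro h
    have h1 := sub_mem h hsm
    have h2 := hinteg (2 * N.r j) (by convert h1 using 1; push_cast; ring)
    exact hqp.coprime_iff_not_dvd.mp hcop h2
  have hcw : ∀ x ∈ 𝔮, (N.q j : 𝓞 k) ∣ (R.s - (-N.r j : ℤ)) * x := by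
    intro x hx
    rw [← Ideal.mem_span_singleton, ← R.span_pair_mul_span_pair (N.prime_q j) (N.q_ne_two j)
      (N.q_ne_l j) (N.q_split j), mul_comm _ x]
    exact Ideal.mul_mem_mul hx (Ideal.subset_span (Or.inr rfl))
  obtain ⟨x, z, hz, hxz⟩ := Q.exists_sq_sub_mul_mem (e := (R.ε : 𝓞 k)) h𝔮 hδ (N.d_mem _)
    (N.d_notMem_sq _) hw (Nat.cast_ne_zero.mpr (N.prime_q j).ne_zero) hqm hcw rfl hε
  obtain ⟨a, ha⟩ := hmod x
  obtain ⟨c, hc⟩ := hmod z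
  have hqc : ¬ (N.q j : ℤ) ∣ c := by
    intro h
    have h1 : (c : 𝓞 k) ∈ 𝔮 := by
      obtain ⟨w, rfl⟩ := h
      push_cast
      exact 𝔮.mul_mem_right _ hqm
    have h2 := add_mem hc h1
    rw [sub_add_cancel] at h2
    exact (h𝔮.mem_or_mem h2).elim h2𝔮 hz
  have hac : (N.q j : ℤ) ∣ a ^ 2 - (R.u + R.v * N.r j) * c ^ 2 := by
    apply hinteg
    have : ((a ^ 2 - (R.u + R.v * N.r j) * c ^ 2 : ℤ) : 𝓞 k) =
        4 * (x ^ 2 - R.ε * z ^ 2) - (2 * x + a) * (2 * x - a) +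
          R.ε * (2 * z + c) * (2 * z - c) + R.v * c ^ 2 * (R.s - N.r j) := by
      rw [R.coe_ε]
      push_cast
      ring
    rw [this]
    exact add_mem (add_mem (sub_mem (𝔮.mul_mem_left _ hxz) (𝔮.mul_mem_left _ ha))
      (𝔮.mul_mem_left _ hc)) (𝔮.mul_mem_left _ hsm)
  have hccop := (hqp.coprime_iff_not_dvd.mpr hqc).symm
  rw [← jacobiSym_sq_mul hccop, ← jacobiSym_eq_of_dvd hac]
  have hqa : IsCoprime a (N.q j : ℤ) := by
    have huvr : ¬ (N.q j : ℤ) ∣ R.u + R.v * N.r j := by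
      intro h
      apply hqp.not_isUnit
      apply isUnit_iff_dvd_one.mpr
      have h1 := dvd_add (h.mul_right (R.v * N.r j - R.u))
        ((N.q_split j).mul_left (-R.v ^ 2))
      have : (R.u + R.v * N.r j) * (R.v * N.r j - R.u) + -R.v ^ 2 * (N.r j ^ 2 - R.l) = 1 := by
        linear_combination - R.norm_eq
      rwa [this] at h1
    refine (hqp.coprime_iff_not_dvd.mpr fun h => ?_).symm
    have h1 := dvd_sub (dvd_pow h two_ne_zero) hac
    rw [sub_sub_cancel] at h1
    exact (hqp.dvd_or_dvd h1).elim huvr fun h2 => hqc (hqp.dvd_of_dvd_pow h2)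
  rw [← one_mul (a ^ 2), jacobiSym_sq_mul hqa, jacobiSym.one_left]

theorem ε_notMem_norm_range (hδ : Q.δ = N.d) {j : Fin t₂}
    (hj : quartSym R.l (N.q j) ≠ quartSym (N.q j) R.l) : R.εk ∉ Q.norm.range := by
  intro h
  have h1 := N.jacobiSym_eq_one_of_ε_mem Q hδ h j
  rw [R.jacobiSym_ε (N.prime_q j) (N.q_mod j) (N.q_ne_l j).symm (N.q_euler j) (N.q_split j)] at h1
  apply hj
  rcases quartSym_eq_or R.l (N.q j) with h2 | h2 <;>
    rcases quartSym_eq_or (N.q j) R.l with h3 | h3 <;> rw [h2, h3] at h1 ⊢ <;> norm_num at h1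

end RealQuad.Radicand

theorem ZMod.two_ne_zero_of_mod_four {p : ℕ} (hp : p.Prime) (hp4 : p % 4 = 1) :
    (2 : ZMod p) ≠ 0 := by
  intro h
  have h1 : ((2 : ℕ) : ZMod p) = 0 := by exact_mod_cast h
  rw [ZMod.natCast_eq_zero_iff] at h1
  exact absurd (Nat.le_of_dvd two_pos h1) (two_lt_of_mod_four hp hp4).not_ge

theorem ZMod.isSquare_or_isSquare_mul {p : ℕ} [Fact p.Prime] {a b : ZMod p} (ha : a ≠ 0)
    (hb : b ≠ 0) (h : ¬ IsSquare b) : IsSquare a ∨ IsSquare (a * b) := by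
  rw [ZMod.euler_criterion p ha, ZMod.euler_criterion p (mul_ne_zero ha hb), mul_pow]
  rw [ZMod.euler_criterion p hb] at h
  rw [(ZMod.pow_div_two_eq_neg_one_or_one p hb).resolve_left h]
  rcases ZMod.pow_div_two_eq_neg_one_or_one p ha with h1 | h1 <;> simp [h1]

theorem ZMod.exists_sq_add_mul_sq_of_not_isSquare {p : ℕ} [Fact p.Prime] (hp4 : p % 4 = 1)
    {l u v : ZMod p} (hl : ¬ IsSquare l) (h : u ^ 2 - l * v ^ 2 = -1) :
    ∃ a b : ZMod p, a ^ 2 + l * b ^ 2 = u ∧ 2 * a * b = v := by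
  have hl0 : l ≠ 0 := by rintro rfl; exact hl ⟨0, by simp⟩
  have h2 : (2 : ZMod p) ≠ 0 := ZMod.two_ne_zero_of_mod_four Fact.out hp4
  have h4 : (4 : ZMod p) ≠ 0 := by
    rw [show (4 : ZMod p) = 2 * 2 by norm_num]
    exact mul_ne_zero h2 h2
  rcases eq_or_ne v 0 with rfl | hv
  · have hu : u ≠ 0 := by
      rintro rfl
      norm_num at h
    rcases ZMod.isSquare_or_isSquare_mul hu hl0 hl with ⟨a, ha⟩ | ⟨a, ha⟩
    · exact ⟨a, 0, by rw [ha]; ring, by ring⟩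
    · refine ⟨0, a / l, ?_, by ring⟩
      field_simp
      linear_combination - ha
  · obtain ⟨j, hj⟩ : IsSquare (-1 : ZMod p) := ZMod.exists_sq_eq_neg_one_iff.mpr (by omega)
    have key : ∀ i : ZMod p, -1 = i * i → IsSquare ((u + i) / 2) →
        ∃ a b : ZMod p, a ^ 2 + l * b ^ 2 = u ∧ 2 * a * b = v := by
      rintro i hi ⟨a, ha⟩
      have ha2 : u + i = 2 * (a * a) := by rw [← ha]; field_simp
      have ha0 : a ≠ 0 := by
        rintro rfl
        have h3 : l * v ^ 2 = 0 := by linear_combination - h - hi + (u - i) * ha2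
        exact mul_ne_zero hl0 (pow_ne_zero 2 hv) h3
      refine ⟨a, v / (2 * a), ?_, by field_simp⟩
      field_simp
      linear_combination - h - hi + (u - i - 2 * a ^ 2) * ha2
    by_cases h1 : IsSquare ((u + j) / 2)
    · exact key j hj h1
    by_cases h3 : IsSquare ((u + -j) / 2)
    · exact key (-j) (by rw [hj]; ring) h3
    exfalso
    have h5 : (u + j) / 2 ≠ 0 := by intro h0; rw [h0] at h1; exact h1 ⟨0, by simp⟩
    have h6 : (u + -j) / 2 ≠ 0 := by intro h0; rw [h0] at h3; exact h3 ⟨0, by simp⟩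
    obtain ⟨c, hc⟩ := (ZMod.isSquare_or_isSquare_mul h5 h6 h3).resolve_left h1
    apply hl
    refine ⟨2 * c / v, ?_⟩
    field_simp at hc ⊢
    have : (2 : ZMod p) ^ 2 = 4 := by norm_num
    rw [this] at *
    linear_combination hc - h - hj

theorem ZMod.exists_sq_add_mul_sq_of_isSquare {p : ℕ} [Fact p.Prime] (hp2 : (2 : ZMod p) ≠ 0)
    {l u v r : ZMod p} (hr : r ^ 2 = l) (hr0 : r ≠ 0) (h1 : IsSquare (u + v * r))
    (h2 : IsSquare (u + v * (-r))) :
    ∃ a b : ZMod p, a ^ 2 + l * b ^ 2 = u ∧ 2 * a * b = v := by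
  obtain ⟨x, hx⟩ := h1
  obtain ⟨y, hy⟩ := h2
  have h4 : (4 : ZMod p) ≠ 0 := by
    rw [show (4 : ZMod p) = 2 * 2 by norm_num]
    exact mul_ne_zero hp2 hp2
  refine ⟨(x + y) / 2, (x - y) / (2 * r), ?_, ?_⟩
  · rw [← hr]
    apply mul_left_cancel₀ h4
    have e1 : ((x + y) / 2) * 2 = x + y := div_mul_cancel₀ _ hp2
    have e2 : ((x - y) / (2 * r)) * (2 * r) = x - y := div_mul_cancel₀ _ (mul_ne_zero hp2 hr0)
    linear_combination (((x + y) / 2) * 2 + (x + y)) * e1 +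
      ((x - y) / (2 * r) * (2 * r) + (x - y)) * e2 - 2 * hx - 2 * hy
  · apply mul_left_cancel₀ (mul_ne_zero hp2 hr0)
    have e1 : ((x + y) / 2) * 2 = x + y := div_mul_cancel₀ _ hp2
    have e2 : ((x - y) / (2 * r)) * (2 * r) = x - y := div_mul_cancel₀ _ (mul_ne_zero hp2 hr0)
    linear_combination (x - y) / (2 * r) * (2 * r) * e1 + (x + y) * e2 - hx + hy

namespace RealQuad

variable {k : Type*} [Field k] [NumberField k] (R : RealQuad k)

theorem exists_s_dvd_sq_sub_ε : ∃ z : 𝓞 k, R.s ∣ z ^ 2 - R.ε := by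
  have : Fact R.l.Prime := ⟨R.prime_l⟩
  have h := congrArg (Int.cast : ℤ → ZMod R.l) R.norm_eq
  push_cast at h
  rw [ZMod.natCast_self, zero_mul, sub_zero] at h
  have hu : (R.u : ZMod R.l) ≠ 0 := by
    intro h0
    rw [h0] at h
    norm_num at h
  obtain ⟨z, hz⟩ : IsSquare (R.u : ZMod R.l) := by
    rw [ZMod.euler_criterion R.l hu, show R.l / 2 = 2 * (2 * R.c) by have := R.l_eq; omega,
      pow_mul, h, pow_mul]
    simp
  obtain ⟨z, rfl⟩ := ZMod.intCast_surjective z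
  have h1 : (R.l : ℤ) ∣ z * z - R.u := (ZMod.intCast_eq_intCast_iff_dvd_sub _ _ _).mp (by
    push_cast; exact hz)
  obtain ⟨w, hw⟩ := h1
  refine ⟨z, R.s * w - R.v, ?_⟩
  have hw' := congrArg (Int.cast : ℤ → 𝓞 k) hw
  push_cast at hw'
  rw [R.coe_ε]
  linear_combination hw' - w * R.s_sq

theorem exists_dvd_sq_sub_ε {p : ℕ} {a b : ZMod p} (h1 : a ^ 2 + R.l * b ^ 2 = R.u)
    (h2 : 2 * a * b = R.v) : ∃ z : 𝓞 k, (p : 𝓞 k) ∣ z ^ 2 - R.ε := by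
  obtain ⟨a, rfl⟩ := ZMod.intCast_surjective a
  obtain ⟨b, rfl⟩ := ZMod.intCast_surjective b
  have h3 : (p : ℤ) ∣ a ^ 2 + R.l * b ^ 2 - R.u :=
    (ZMod.intCast_eq_intCast_iff_dvd_sub _ _ _).mp (by push_cast; exact h1.symm)
  have h4 : (p : ℤ) ∣ 2 * a * b - R.v :=
    (ZMod.intCast_eq_intCast_iff_dvd_sub _ _ _).mp (by push_cast; exact h2.symm)
  obtain ⟨x, hx⟩ := h3
  obtain ⟨y, hy⟩ := h4
  refine ⟨a + b * R.s, x + y * R.s, ?_⟩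
  have hx' := congrArg (Int.cast : ℤ → 𝓞 k) hx
  have hy' := congrArg (Int.cast : ℤ → 𝓞 k) hy
  push_cast at hx' hy'
  rw [R.coe_ε]
  linear_combination hx' + R.s * hy' + b ^ 2 * R.s_sq

theorem exists_dvd_sq_sub_ε_of_inert {p : ℕ} (hp : p.Prime) (hp4 : p % 4 = 1)
    (hin : ∀ x : ℤ, ¬ (p : ℤ) ∣ x ^ 2 - R.l) : ∃ z : 𝓞 k, (p : 𝓞 k) ∣ z ^ 2 - R.ε := by
  have : Fact p.Prime := ⟨hp⟩
  have hl : ¬ IsSquare (R.l : ZMod p) := by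
    rintro ⟨x, hx⟩
    obtain ⟨x, rfl⟩ := ZMod.intCast_surjective x
    apply hin x
    apply (ZMod.intCast_eq_intCast_iff_dvd_sub _ _ _).mp
    push_cast
    rw [hx, pow_two]
  have hnorm := congrArg (Int.cast : ℤ → ZMod p) R.norm_eq
  push_cast at hnorm
  obtain ⟨a, b, h1, h2⟩ := ZMod.exists_sq_add_mul_sq_of_not_isSquare hp4 hl hnorm
  exact R.exists_dvd_sq_sub_ε h1 h2

theorem exists_dvd_sq_sub_ε_of_split {q : ℕ} (hq : q.Prime) (hq4 : q % 4 = 1) (hlq : R.l ≠ q)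
    (hql : (q : ZMod R.l) ^ ((R.l - 1) / 2) = 1) {r : ℤ} (hr : (q : ℤ) ∣ r ^ 2 - R.l)
    (h : quartSym R.l q = quartSym q R.l) : ∃ z : 𝓞 k, (q : 𝓞 k) ∣ z ^ 2 - R.ε := by
  have : Fact q.Prime := ⟨hq⟩
  have hmul : quartSym R.l q * quartSym q R.l = 1 := by
    rw [h]
    rcases quartSym_eq_or q R.l with h | h <;> rw [h] <;> norm_num
  have hr2 : (q : ℤ) ∣ (-r) ^ 2 - R.l := by rwa [neg_sq]
  have h1 := ZMod.isSquare_of_jacobiSym_eq_one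
    ((R.jacobiSym_ε hq hq4 hlq hql hr).trans hmul)
  have h2 := ZMod.isSquare_of_jacobiSym_eq_one
    ((R.jacobiSym_ε hq hq4 hlq hql hr2).trans hmul)
  push_cast at h1 h2
  have h3 : (2 : ZMod q) ≠ 0 := ZMod.two_ne_zero_of_mod_four hq hq4
  have h4 : (r : ZMod q) ^ 2 = R.l := by
    have := (ZMod.intCast_eq_intCast_iff_dvd_sub _ _ _).mpr hr
    push_cast at this
    exact this.symm
  have h5 : (r : ZMod q) ≠ 0 := by
    intro h0
    rw [h0, zero_pow two_ne_zero, eq_comm, ZMod.natCast_eq_zero_iff] at h4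
    exact hlq ((Nat.prime_dvd_prime_iff_eq hq R.prime_l).mp h4).symm
  obtain ⟨a, b, h1, h2⟩ := ZMod.exists_sq_add_mul_sq_of_isSquare h3 h4 h5 h1 h2
  exact R.exists_dvd_sq_sub_ε h1 h2

theorem isCoprime_s_two : IsCoprime R.s 2 := by
  have h1 : R.l.Coprime 2 := by
    rw [Nat.coprime_two_right, Nat.odd_iff]
    have := R.l_eq
    omega
  have h2 := isCoprime_natCast (A := 𝓞 k) h1
  rw [← R.s_sq, Nat.cast_ofNat] at h2
  exact h2.of_isCoprime_of_dvd_left (dvd_pow_self _ two_ne_zero)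

end RealQuad

namespace RealQuad.Radicand

variable {k F K : Type*} [Field k] [NumberField k] [Field F] [NumberField F] [Algebra k F]
  [Field K] [NumberField K] [Algebra k K] {R : RealQuad k} {t₁ t₂ : ℕ} (N : R.Radicand t₁ t₂)

theorem exists_eq_mul_s_mem_sup (QF : QuadExt k F) (hF : OddClass F) (hδF : QF.δ = R.εk)
    (h : ∀ j, quartSym R.l (N.q j) = quartSym (N.q j) R.l) :
    ∃ g ∈ (unitsIncl k).range ⊔ QF.norm.range, (g : k) = N.n * R.Q.ρ := by
  have key : ∀ m : 𝓞 k, m ≠ 0 → IsCoprime m 2 → (∃ z : 𝓞 k, m ∣ z ^ 2 - R.ε) →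
      ∃ g ∈ (unitsIncl k).range ⊔ QF.norm.range, (g : k) = m := by
    rintro m hm h2 ⟨z, hz⟩
    have hm' : (m : k) ≠ 0 := by simpa using hm
    obtain ⟨e, he⟩ := QF.exists_unit_mul_mem_norm hF (d := (R.ε : 𝓞 k)) (m := m) hδF h2
      ⟨0, (R.ε⁻¹ : (𝓞 k)ˣ), by rw [zero_mul, zero_add, Units.inv_mul]⟩ hz (g := Units.mk0 (m : k) hm') rfl
    refine ⟨Units.mk0 (m : k) hm', ?_, rfl⟩
    exact (Subgroup.mul_mem_cancel_left _ (Subgroup.mem_sup_left (MonoidHom.mem_range.mpr ⟨e, rfl⟩))).mp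
      (Subgroup.mem_sup_right he)
  have hmul : ∀ a b : k, (∃ g ∈ (unitsIncl k).range ⊔ QF.norm.range, (g : k) = a) →
      (∃ g ∈ (unitsIncl k).range ⊔ QF.norm.range, (g : k) = b) →
      ∃ g ∈ (unitsIncl k).range ⊔ QF.norm.range, (g : k) = a * b := by
    rintro _ _ ⟨x, hx, rfl⟩ ⟨y, hy, rfl⟩
    exact ⟨x * y, mul_mem hx hy, rfl⟩
  have hone : ∃ g ∈ (unitsIncl k).range ⊔ QF.norm.range, (g : k) = 1 := ⟨1, one_mem _, rfl⟩
  have hcop : ∀ p : ℕ, p.Prime → p % 4 = 1 → IsCoprime (p : 𝓞 k) 2 := by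
    intro p hp hp4
    have h1 := isCoprime_natCast (A := 𝓞 k)
      ((Nat.coprime_primes hp Nat.prime_two).mpr (by omega))
    simpa using h1
  rw [n, Nat.cast_mul, Nat.cast_prod, Nat.cast_prod]
  refine hmul _ _ (hmul _ _ (Finset.prod_induction _ _ hmul hone fun i _ => ?_)
    (Finset.prod_induction _ _ hmul hone fun j _ => ?_)) ?_
  · rw [← coe_natCast]
    exact key _ (Nat.cast_ne_zero.mpr (N.prime_p i).ne_zero) (hcop _ (N.prime_p i) (N.p_mod i))
      (R.exists_dvd_sq_sub_ε_of_inert (N.prime_p i) (N.p_mod i) (N.p_inert i))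
  · rw [← coe_natCast]
    exact key _ (Nat.cast_ne_zero.mpr (N.prime_q j).ne_zero) (hcop _ (N.prime_q j) (N.q_mod j))
      (R.exists_dvd_sq_sub_ε_of_split (N.prime_q j) (N.q_mod j) (N.q_ne_l j).symm (N.q_euler j)
        (N.q_split j) (h j))
  · rw [← R.coe_s]
    exact key _ R.s_ne_zero R.isCoprime_s_two R.exists_s_dvd_sq_sub_ε

theorem ε_mem_norm_range (QF : QuadExt k F) (hF : OddClass F) (hδF : QF.δ = R.εk)
    (Q : QuadExt k K) (hδ : Q.δ = N.d)
    (h : ∀ j, quartSym R.l (N.q j) = quartSym (N.q j) R.l) : R.εk ∈ Q.norm.range := by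
  obtain ⟨g, hg, hgn⟩ := N.exists_eq_mul_s_mem_sup QF hF hδF h
  have hmε : -1 * R.εk ∈ QF.norm.range := by
    rw [QF.mem_norm_range_iff]
    refine ⟨0, 1, ?_⟩
    rw [hδF, Units.val_mul, Units.val_neg, Units.val_one]
    ring
  have hor : g ∈ QF.norm.range ∨ -1 * g ∈ QF.norm.range := by
    obtain ⟨_, ⟨e, rfl⟩, y, hy, rfl⟩ := Subgroup.mem_sup.mp hg
    rcases R.mem_selmerTwo_cases (unitsIncl_mem_selmerTwo e) with he | he | he | he
    · exact Or.inl (mul_mem (QF.squares_le_norm_range he) hy)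
    · right
      rw [← mul_assoc]
      exact mul_mem (QF.squares_le_norm_range he) hy
    · right
      apply (Subgroup.mul_mem_cancel_left _ hmε).mp
      have := mul_mem (QF.squares_le_norm_range he) hy
      convert this using 1
      apply Units.ext
      push_cast
      ring
    · left
      apply (Subgroup.mul_mem_cancel_left _ hmε).mp
      have := mul_mem (QF.squares_le_norm_range he) hy
      convert this using 1
      apply Units.ext
      push_cast
      ring
  have hn0 : (0 : ℝ) < N.n := Nat.cast_pos.mpr N.n_pos
  rcases hor with hN | hN
  · exfalso
    obtain ⟨a, b, hab⟩ := QF.mem_norm_range_iff.mp hN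
    rw [hgn, hδF] at hab
    have h1 := congrArg R.φ' hab
    rw [map_sub, map_mul, map_mul, map_pow, map_pow, map_natCast, R.φ'_apply R.Q.ρ, R.Q.σ_ρ,
      map_neg] at h1
    have h2 := R.φ_pos
    have h3 := R.φ'_ε_neg
    have h4 : 0 ≤ -(R.φ' R.εk) * R.φ' b ^ 2 := mul_nonneg (by linarith) (sq_nonneg _)
    nlinarith [sq_nonneg (R.φ' a), mul_pos hn0 h2]
  · obtain ⟨a, b, hab⟩ := QF.mem_norm_range_iff.mp hN
    rw [Units.val_mul, hgn, hδF, Units.val_neg, Units.val_one] at hab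
    have hd : Q.δ = N.n * R.εk * R.Q.ρ := by
      rw [hδ, d, coe_mul, coe_mul, coe_natCast, R.coe_s]
      rfl
    have ha : a ≠ 0 := by
      rintro rfl
      apply Q.δ_not_sq (R.εk * b)
      rw [hd]
      linear_combination - (R.εk : k) * hab
    rw [Q.mem_norm_range_iff]
    refine ⟨R.εk * b / a, 1 / a, ?_⟩
    rw [hd]
    field_simp
    linear_combination - hab

end RealQuad.Radicand

theorem exists_int_of_isIntegral {x : ℚ} (h : IsIntegral ℤ (x : ℝ)) : ∃ z : ℤ, (z : ℚ) = x := by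
  have h1 : IsIntegral ℤ x := (isIntegral_algebraMap_iff (algebraMap ℚ ℝ).injective).mp h
  obtain ⟨z, hz⟩ := IsIntegrallyClosed.isIntegral_iff.mp h1
  exact ⟨z, by simpa using hz⟩

theorem emod_four_of_sq_sub_mul_sq {l : ℕ} (hl8 : l % 8 = 1) {u v : ℤ}
    (h : u ^ 2 - l * v ^ 2 = -1) (hv : 0 < v) : u % 4 = 0 ∧ v % 4 = 1 := by
  obtain ⟨c, hc⟩ : ∃ c : ℤ, (l : ℤ) = 8 * c + 1 := ⟨l / 8, by omega⟩
  have h8 : (u ^ 2 - v ^ 2 + 1) % 8 = 0 := by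
    have : u ^ 2 - v ^ 2 + 1 = 8 * (c * v ^ 2) := by rw [hc] at h; linear_combination h
    omega
  have hu : u % 4 = 0 ∧ v % 2 = 1 := by
    have h1 : u % 8 = 0 ∨ u % 8 = 1 ∨ u % 8 = 2 ∨ u % 8 = 3 ∨ u % 8 = 4 ∨ u % 8 = 5 ∨
      u % 8 = 6 ∨ u % 8 = 7 := by omega
    have h2 : v % 8 = 0 ∨ v % 8 = 1 ∨ v % 8 = 2 ∨ v % 8 = 3 ∨ v % 8 = 4 ∨ v % 8 = 5 ∨
      v % 8 = 6 ∨ v % 8 = 7 := by omega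
    rcases h1 with h1 | h1 | h1 | h1 | h1 | h1 | h1 | h1 <;>
    rcases h2 with h2 | h2 | h2 | h2 | h2 | h2 | h2 | h2 <;>
    first
    | omega
    | (exfalso; simp [pow_two, Int.add_emod, Int.sub_emod, Int.mul_emod, h1, h2] at h8)
  refine ⟨hu.1, ?_⟩
  obtain ⟨w, rfl⟩ := Int.eq_ofNat_of_zero_le hv.le
  have h1 : IsSquare (-1 : ZMod w) := by
    refine ⟨(u : ZMod w), ?_⟩
    have h := congrArg (Int.cast : ℤ → ZMod w) h
    push_cast at h
    rw [ZMod.natCast_self] at h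
    linear_combination - h
  obtain ⟨x, y, rfl⟩ := Nat.eq_sq_add_sq_of_isSquare_mod_neg_one h1
  have h2 : (x ^ 2 + y ^ 2) % 2 = 1 := by omega
  have h3 : (x ^ 2 + y ^ 2) % 4 = 1 := by
    have hx : x % 4 = 0 ∨ x % 4 = 1 ∨ x % 4 = 2 ∨ x % 4 = 3 := by omega
    have hy : y % 4 = 0 ∨ y % 4 = 1 ∨ y % 4 = 2 ∨ y % 4 = 3 := by omega
    have h4 : (x ^ 2 + y ^ 2) % 4 = 1 ∨ (x ^ 2 + y ^ 2) % 4 = 3 := by omega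
    refine h4.resolve_right fun h5 => ?_
    rcases hx with hx | hx | hx | hx <;> rcases hy with hy | hy | hy | hy <;>
      simp [pow_two, Nat.add_mod, Nat.mul_mod, hx, hy] at h5
  omega

theorem exists_int_coords_of_unit {l : ℕ} (hl : l.Prime) (hl8 : l % 8 = 1) {ε₀ : ℝ}
    (h1 : 1 < ε₀) (hinteg : IsIntegral ℤ ε₀) (hinv : IsIntegral ℤ ε₀⁻¹)
    (hεnorm : ∃ u v : ℚ, ε₀ = (u : ℝ) + (v : ℝ) * Real.sqrt (l : ℝ) ∧
      (u : ℝ) ^ 2 - (v : ℝ) ^ 2 * (l : ℝ) = -1) :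
    ∃ u v : ℤ, ε₀ = u + v * Real.sqrt (l : ℝ) ∧ u ^ 2 - l * v ^ 2 = -1 ∧ u % 4 = 0 ∧ v % 4 = 1 ∧
      0 < u ∧ 0 < v := by
  obtain ⟨u, v, he, hn⟩ := hεnorm
  have hl0 : (0 : ℝ) < l := Nat.cast_pos.mpr hl.pos
  have hs : Real.sqrt (l : ℝ) ^ 2 = l := Real.sq_sqrt hl0.le
  have hs0 : 0 < Real.sqrt (l : ℝ) := Real.sqrt_pos.mpr hl0
  have hinv' : ε₀⁻¹ = -(u - v * Real.sqrt (l : ℝ)) := by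
    apply inv_eq_of_mul_eq_one_right
    rw [he]
    linear_combination (v : ℝ) ^ 2 * hs - hn
  have hinv0 : 0 < ε₀⁻¹ := inv_pos.mpr (by linarith)
  have hinv1 : ε₀⁻¹ < 1 := inv_lt_one_of_one_lt₀ h1
  have hu0 : (0 : ℝ) < u := by linarith
  have hv0 : (0 : ℝ) < v := by
    by_contra h
    have := mul_nonneg (sub_nonneg.mpr (not_lt.mp h)) hs0.le
    linarith
  have hn' : u ^ 2 - v ^ 2 * l = -1 := by exact_mod_cast hn
  obtain ⟨U, hU⟩ : ∃ z : ℤ, (z : ℚ) = 2 * u := by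
    apply exists_int_of_isIntegral
    have : ((2 * u : ℚ) : ℝ) = ε₀ - ε₀⁻¹ := by
      push_cast
      rw [hinv', he]
      ring
    rw [this]
    exact hinteg.sub hinv
  obtain ⟨W, hW⟩ : ∃ z : ℤ, (z : ℚ) = 2 * v * l := by
    apply exists_int_of_isIntegral
    apply IsIntegral.of_pow two_pos
    have : ((2 * v * l : ℚ) : ℝ) ^ 2 = ((l * (U ^ 2 + 4) : ℤ) : ℝ) := by
      have h2 : (U : ℝ) = 2 * u := by exact_mod_cast congrArg (Rat.cast : ℚ → ℝ) hU
      push_cast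
      rw [h2]
      linear_combination -4 * l * hn
    rw [this]
    exact isIntegral_algebraMap
  have hlp : Prime (l : ℤ) := Nat.prime_iff_prime_int.mp hl
  have hl0' : (l : ℤ) ≠ 0 := hlp.ne_zero
  have hWU : W ^ 2 = l * (U ^ 2 + 4) := by
    have : (W : ℚ) ^ 2 = l * (U ^ 2 + 4) := by
      rw [hW, hU]
      linear_combination -4 * l * hn'
    exact_mod_cast this
  obtain ⟨V, rfl⟩ : (l : ℤ) ∣ W := hlp.dvd_of_dvd_pow (Dvd.intro _ hWU.symm)
  have hV : (V : ℚ) = 2 * v := by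
    have : (l : ℚ) ≠ 0 := Nat.cast_ne_zero.mpr hl.ne_zero
    apply mul_left_cancel₀ this
    push_cast at hW
    linear_combination hW
  have hUV : U ^ 2 - l * V ^ 2 = -4 := by
    have : (U : ℚ) ^ 2 - l * V ^ 2 = -4 := by
      rw [hU, hV]
      linear_combination 4 * hn'
    exact_mod_cast this
  have hpar : U % 2 = 0 ∧ V % 2 = 0 := by
    obtain ⟨c, hc⟩ : ∃ c : ℤ, (l : ℤ) = 8 * c + 1 := ⟨l / 8, by omega⟩
    have h8 : (U ^ 2 - V ^ 2 + 4) % 8 = 0 := by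
      have : U ^ 2 - V ^ 2 + 4 = 8 * (c * V ^ 2) := by rw [hc] at hUV; linear_combination hUV
      omega
    have h1 : U % 8 = 0 ∨ U % 8 = 1 ∨ U % 8 = 2 ∨ U % 8 = 3 ∨ U % 8 = 4 ∨ U % 8 = 5 ∨
      U % 8 = 6 ∨ U % 8 = 7 := by omega
    have h2 : V % 8 = 0 ∨ V % 8 = 1 ∨ V % 8 = 2 ∨ V % 8 = 3 ∨ V % 8 = 4 ∨ V % 8 = 5 ∨
      V % 8 = 6 ∨ V % 8 = 7 := by omega
    rcases h1 with h1 | h1 | h1 | h1 | h1 | h1 | h1 | h1 <;>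
    rcases h2 with h2 | h2 | h2 | h2 | h2 | h2 | h2 | h2 <;>
    first
    | omega
    | (exfalso; simp [pow_two, Int.add_emod, Int.sub_emod, Int.mul_emod, h1, h2] at h8)
  obtain ⟨u', rfl⟩ := Int.dvd_of_emod_eq_zero hpar.1
  obtain ⟨v', rfl⟩ := Int.dvd_of_emod_eq_zero hpar.2
  have hu' : (u' : ℚ) = u := by push_cast at hU; linarith
  have hv' : (v' : ℚ) = v := by push_cast at hV; linarith
  have hv'0 : 0 < v' := by
    have : (0 : ℝ) < ((v' : ℚ) : ℝ) := by rw [hv']; exact hv0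
    exact_mod_cast this
  have hn'' : u' ^ 2 - l * v' ^ 2 = -1 := by linarith
  obtain ⟨hu4, hv4⟩ := emod_four_of_sq_sub_mul_sq hl8 hn'' hv'0
  refine ⟨u', v', ?_, hn'', hu4, hv4, ?_, hv'0⟩
  · rw [he, ← hu', ← hv']
    push_cast
    rfl
  · have : (0 : ℝ) < ((u' : ℚ) : ℝ) := by rw [hu']; exact hu0
    exact_mod_cast this

theorem legSym_eq_one_iff {l p : ℕ} (hl : l.Prime) (hp : p.Prime) (hpl : p ≠ l) :
    legSym l p = 1 ↔ (p : ZMod l) ^ ((l - 1) / 2) = 1 := by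
  have h : (p : ZMod l) ≠ 0 := by
    rw [Ne, ZMod.natCast_eq_zero_iff]
    exact fun h => hpl ((Nat.prime_dvd_prime_iff_eq hl hp).mp h).symm
  rw [legSym, Int.cast_natCast, if_neg h]
  split_ifs with h1 <;> simp [h1]

open scoped NumberTheorySymbols in
theorem legSym_eq_one_iff_jacobiSym {l p : ℕ} (hl : l.Prime) (hl4 : l % 4 = 1) (hp : p.Prime)
    (hp4 : p % 4 = 1) (hpl : p ≠ l) : legSym l p = 1 ↔ J(l | p) = 1 := by
  rw [legSym_eq_one_iff hl hp hpl,
    ← jacobiSym.quadratic_reciprocity_one_mod_four hp4 (Nat.odd_iff.mpr (by omega))]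
  have h1 := coe_jacobiSym hl hl4 p
  rw [Int.cast_natCast] at h1
  rw [← h1]
  constructor
  · intro h
    have hcop : IsCoprime (p : ℤ) (l : ℤ) :=
      Nat.isCoprime_iff_coprime.mpr ((Nat.coprime_primes hp hl).mpr hpl)
    refine int_eq_of_sq_one (two_lt_of_mod_four hl hl4) (jacobiSym_eq_or hcop) (Or.inl rfl) ?_
    rw [h, Int.cast_one]
  · intro h
    rw [h, Int.cast_one]

open scoped NumberTheorySymbols in
theorem not_dvd_sq_sub_of_legSym {l p : ℕ} (hl : l.Prime) (hl4 : l % 4 = 1) (hp : p.Prime)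
    (hp4 : p % 4 = 1) (hpl : p ≠ l) (h : legSym l p = -1) (x : ℤ) : ¬ (p : ℤ) ∣ x ^ 2 - l := by
  intro hx
  have h1 : J(l | p) = 1 := by
    rw [← jacobiSym_eq_of_dvd hx]
    have hpp : Prime (p : ℤ) := Nat.prime_iff_prime_int.mp hp
    have hcop : IsCoprime x (p : ℤ) := by
      refine (hpp.coprime_iff_not_dvd.mpr fun hpx => hpl ?_).symm
      have h2 := dvd_sub (dvd_pow hpx two_ne_zero) hx
      rw [sub_sub_cancel] at h2
      exact (Nat.prime_dvd_prime_iff_eq hp hl).mp (by exact_mod_cast h2)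
    rw [← one_mul (x ^ 2), jacobiSym_sq_mul hcop, jacobiSym.one_left]
  have h2 := (legSym_eq_one_iff_jacobiSym hl hl4 hp hp4 hpl).mpr h1
  rw [h] at h2
  norm_num at h2

theorem exists_dvd_sq_sub_of_legSym {l q : ℕ} (hl : l.Prime) (hl4 : l % 4 = 1) (hq : q.Prime)
    (hq4 : q % 4 = 1) (hql : q ≠ l) (h : legSym l q = 1) : ∃ r : ℤ, (q : ℤ) ∣ r ^ 2 - l := by
  have : Fact q.Prime := ⟨hq⟩
  obtain ⟨r, hr⟩ := ZMod.isSquare_of_jacobiSym_eq_one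
    ((legSym_eq_one_iff_jacobiSym hl hl4 hq hq4 hql).mp h)
  obtain ⟨r, rfl⟩ := ZMod.intCast_surjective r
  refine ⟨r, (ZMod.intCast_eq_intCast_iff_dvd_sub _ _ _).mp ?_⟩
  push_cast at hr ⊢
  rw [hr, pow_two]

theorem RealQuad.sq_ne_ε {k : Type*} [Field k] [NumberField k] (R : RealQuad k) (a : k) :
    a ^ 2 ≠ R.εk := by
  intro h
  have h := congrArg R.φ' h
  rw [map_pow] at h
  nlinarith [sq_nonneg (R.φ' a), R.φ'_ε_neg]

namespace RealQuad.Radicand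

variable {k : Type*} [Field k] [NumberField k] {R : RealQuad k} {t₁ t₂ : ℕ} (N : R.Radicand t₁ t₂)

theorem coe_d : (N.d : k) = N.n * R.εk * R.Q.ρ := by
  rw [d, coe_mul, coe_mul, coe_natCast, R.coe_s]
  rfl

theorem sq_ne_d (a : k) : a ^ 2 ≠ N.d := by
  intro h
  obtain ⟨x, rfl⟩ := exists_integer_of_sq_eq (x := a) (b := 0) (c := N.d) (by
    rw [coe_zero, h]; ring)
  have hx : x ^ 2 = N.d := RingOfIntegers.ext h
  apply N.d_notMem_sq (Sum.inl ())
  have hmem := N.d_mem (Sum.inl ())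
  rw [← hx] at hmem ⊢
  exact Ideal.pow_mem_pow ((Ideal.isPrime_of_prime (N.prime_primeIdeal _)).mem_of_pow_mem 2 hmem) 2

end RealQuad.Radicand

section Subfields

open IntermediateField

theorem exists_coords_of_mem_adjoin {A : IntermediateField ℚ ℝ} {ρ : ℝ} (hinteg : IsIntegral ℚ ρ)
    (hρ : ρ ^ 2 ∈ A) {x : ℝ} (hx : x ∈ adjoin ℚ ({ρ} : Set ℝ)) :
    ∃ a ∈ A, ∃ b ∈ A, x = a + b * ρ := by
  rw [← mem_toSubalgebra, adjoin_simple_toSubalgebra_of_isAlgebraic hinteg.isAlgebraic] at hx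
  induction hx using Algebra.adjoin_induction with
  | mem x hx =>
    rw [Set.mem_singleton_iff] at hx
    exact ⟨0, zero_mem _, 1, one_mem _, by rw [hx]; ring⟩
  | algebraMap r => exact ⟨_, A.algebraMap_mem r, 0, zero_mem _, by ring⟩
  | add x y _ _ hx hy =>
    obtain ⟨a, ha, b, hb, rfl⟩ := hx
    obtain ⟨c, hc, d, hd, rfl⟩ := hy
    exact ⟨_, add_mem ha hc, _, add_mem hb hd, by ring⟩
  | mul x y _ _ hx hy =>
    obtain ⟨a, ha, b, hb, rfl⟩ := hx
    obtain ⟨c, hc, d, hd, rfl⟩ := hy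
    exact ⟨_, add_mem (mul_mem ha hc) (mul_mem (mul_mem hb hd) hρ), _,
      add_mem (mul_mem ha hd) (mul_mem hb hc), by ring⟩

theorem numberField_adjoin {ρ : ℝ} (hinteg : IsIntegral ℚ ρ) :
    NumberField (adjoin ℚ ({ρ} : Set ℝ)) where
  to_charZero := inferInstance
  to_finiteDimensional := by
    convert adjoin.finiteDimensional hinteg

theorem exists_quadExt_adjoin {k L : IntermediateField ℚ ℝ} [NumberField k] [NumberField L]
    {ρ : ℝ} {δ : k} [Algebra k L] (halg : ∀ x : k, (algebraMap k L x : ℝ) = x)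
    (hL : L = adjoin ℚ ({ρ} : Set ℝ)) (hinteg : IsIntegral ℚ ρ)
    (hρ : ρ ^ 2 = δ) (hδ : ∀ a : k, a ^ 2 ≠ δ) : ∃ Q : QuadExt k L, Q.δ = δ := by
  have hmem : ρ ∈ L := hL ▸ mem_adjoin_simple_self ℚ ρ
  obtain ⟨Q, hQ, -⟩ := exists_quadExt (⟨ρ, hmem⟩ : L) δ
    (Subtype.ext (by rw [halg, ← hρ]; rfl)) hδ (by
      intro x
      obtain ⟨a, ha, b, hb, h⟩ := exists_coords_of_mem_adjoin (A := k) (x := x) hinteg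
        (by rw [hρ]; exact δ.2) (by rw [← hL]; exact x.2)
      refine ⟨⟨a, ha⟩, ⟨b, hb⟩, Subtype.ext ?_⟩
      rw [h]
      change _ = (algebraMap k L ⟨a, ha⟩ : ℝ) + (algebraMap k L ⟨b, hb⟩ : ℝ) * ρ
      rw [halg, halg])
  exact ⟨Q, hQ⟩

theorem exists_realQuad {l : ℕ} (hl : l.Prime) (hl8 : l % 8 = 1) {u v : ℤ}
    (hn : u ^ 2 - l * v ^ 2 = -1) (hu4 : u % 4 = 0) (hv4 : v % 4 = 1) (hu : 0 < u) (hv : 0 < v)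
    [NumberField (adjoin ℚ ({Real.sqrt (l : ℝ)} : Set ℝ))] :
    ∃ R : RealQuad (adjoin ℚ ({Real.sqrt (l : ℝ)} : Set ℝ)),
      R.l = l ∧ R.u = u ∧ R.v = v ∧ (R.Q.ρ : ℝ) = Real.sqrt (l : ℝ) := by
  have hl0 : (0 : ℝ) < l := Nat.cast_pos.mpr hl.pos
  have hs : Real.sqrt (l : ℝ) ^ 2 = l := Real.sq_sqrt hl0.le
  have hinteg : IsIntegral ℚ (Real.sqrt (l : ℝ)) := by
    apply IsIntegral.of_pow two_pos
    rw [hs]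
    exact isIntegral_algebraMap (R := ℚ) (x := (l : ℚ))
  obtain ⟨Q, hQδ, hQρ⟩ := exists_quadExt (k := ℚ)
    (⟨Real.sqrt (l : ℝ), mem_adjoin_simple_self ℚ _⟩ : adjoin ℚ ({Real.sqrt (l : ℝ)} : Set ℝ))
    (l : ℚ) (Subtype.ext (by rw [map_natCast]; exact hs)) (by
      intro a ha
      have h1 : IsSquare (l : ℚ) := ⟨a, by rw [← ha, pow_two]⟩
      rw [Rat.isSquare_natCast_iff] at h1
      exact hl.prime.not_isSquare h1) (by
      intro x
      obtain ⟨a, ha, b, hb, h⟩ := exists_coords_of_mem_adjoin (A := ⊥) hinteg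
        (by rw [hs]; exact IntermediateField.natCast_mem _ l) x.2
      obtain ⟨a, rfl⟩ := mem_bot.mp ha
      obtain ⟨b, rfl⟩ := mem_bot.mp hb
      refine ⟨a, b, Subtype.ext ?_⟩
      rw [h, eq_ratCast, eq_ratCast, eq_ratCast, eq_ratCast]
      rfl)
  exact ⟨⟨Q, l, l / 8, u, v, (adjoin ℚ ({Real.sqrt (l : ℝ)} : Set ℝ)).val, hl, by omega, hQδ,
    by rw [hQρ]; exact Real.sqrt_pos.mpr hl0, hn, hu4, hv4, hu, hv⟩, rfl, rfl, rfl, by rw [hQρ]⟩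

end Subfields

end ClassGroups

/-- `l ≡ 1 (mod 8)` prime, `n = p₁⋯p_{t₁}·q₁⋯q_{t₂}` a product of
`t₁ + t₂ ≥ 1` distinct primes `≡ 1 (mod 4)` coprime to `l`, with `(pᵢ/l) = -1` and
`(qⱼ/l) = 1`.  If `(qⱼ/l)₄ ≠ (l/qⱼ)₄` for some `j` then `r₂(H) = t₁ + 2t₂ - 1`;
if `(qⱼ/l)₄ = (l/qⱼ)₄` for all `j` then `r₂(H) = t₁ + 2t₂`. -/
theorem stmt_2 (l : ℕ) (hl : l.Prime) (hl8 : l % 8 = 1)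
    (ε₀ : ℝ) (hε : IsFundamentalUnit l ε₀)
    (hεnorm : ∃ u v : ℚ, ε₀ = (u : ℝ) + (v : ℝ) * Real.sqrt (l : ℝ) ∧
      (u : ℝ) ^ 2 - (v : ℝ) ^ 2 * (l : ℝ) = -1)
    (t₁ t₂ : ℕ) (ht : 1 ≤ t₁ + t₂)
    (p : Fin t₁ → ℕ) (q : Fin t₂ → ℕ)
    (hpprime : ∀ i, (p i).Prime) (hqprime : ∀ j, (q j).Prime)
    (hpinj : Function.Injective p) (hqinj : Function.Injective q)
    (hpq : ∀ i j, p i ≠ q j)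
    (hpl : ∀ i, p i ≠ l) (hql : ∀ j, q j ≠ l)
    (hp4 : ∀ i, p i % 4 = 1) (hq4 : ∀ j, q j % 4 = 1)
    (hpleg : ∀ i, legSym l (p i) = -1) (hqleg : ∀ j, legSym l (q j) = 1)
    (n : ℕ) (hn : n = (∏ i, p i) * ∏ j, q j)
    (K : IntermediateField ℚ ℝ)
    (hK : K = IntermediateField.adjoin ℚ
      ({Real.sqrt ((n : ℝ) * ε₀ * Real.sqrt (l : ℝ))} : Set ℝ))
    [NumberField K] :
    ((∃ j, quartSym l (q j) ≠ quartSym (q j) l) →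
        twoTorsCard K = 2 ^ (t₁ + 2 * t₂ - 1)) ∧
      ((∀ j, quartSym l (q j) = quartSym (q j) l) →
        twoTorsCard K = 2 ^ (t₁ + 2 * t₂)) := by
  obtain ⟨h1, -, hinteg, hinv, -⟩ := hε
  obtain ⟨u, v, he, hnorm, hu4, hv4, hu, hv⟩ :=
    exists_int_coords_of_unit hl hl8 h1 hinteg hinv hεnorm
  have hl0 : (0 : ℝ) < l := Nat.cast_pos.mpr hl.pos
  have hs0 : 0 < Real.sqrt (l : ℝ) := Real.sqrt_pos.mpr hl0
  have hs : Real.sqrt (l : ℝ) ^ 2 = l := Real.sq_sqrt hl0.le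
  have hsint : IsIntegral ℚ (Real.sqrt (l : ℝ)) := by
    apply IsIntegral.of_pow two_pos
    rw [hs]
    exact isIntegral_algebraMap (R := ℚ) (x := (l : ℚ))
  have hεint : IsIntegral ℚ ε₀ := hinteg.tower_top
  have hε2 : Real.sqrt ε₀ ^ 2 = ε₀ := Real.sq_sqrt (by linarith)
  have hFint : IsIntegral ℚ (Real.sqrt ε₀) := by
    apply IsIntegral.of_pow two_pos
    rwa [hε2]
  have hn0 : (0 : ℝ) < n := by
    rw [hn]
    exact Nat.cast_pos.mpr (mul_pos (Finset.prod_pos fun i _ => (hpprime i).pos)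
      (Finset.prod_pos fun j _ => (hqprime j).pos))
  have hd2 : Real.sqrt (n * ε₀ * Real.sqrt (l : ℝ)) ^ 2 = n * ε₀ * Real.sqrt (l : ℝ) :=
    Real.sq_sqrt (by positivity)
  have hKint : IsIntegral ℚ (Real.sqrt (n * ε₀ * Real.sqrt (l : ℝ))) := by
    apply IsIntegral.of_pow two_pos
    rw [hd2]
    exact ((isIntegral_algebraMap (R := ℚ) (x := (n : ℚ))).mul hεint).mul hsint
  have := numberField_adjoin hsint
  have := numberField_adjoin hFint
  obtain ⟨R, hRl, hRu, hRv, hRρ⟩ := exists_realQuad hl hl8 hnorm hu4 hv4 hu hv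
  have hRε : ((R.εk : IntermediateField.adjoin ℚ ({Real.sqrt (l : ℝ)} : Set ℝ)) : ℝ) = ε₀ := by
    rw [R.coe_εk, hRu, hRv, he]
    push_cast
    rw [hRρ]
  have hl4 : l % 4 = 1 := by omega
  choose r hr using fun j => exists_dvd_sq_sub_of_legSym hl hl4 (hqprime j) (hq4 j) (hql j)
    (hqleg j)
  let N : R.Radicand t₁ t₂ :=
    { p := p, q := q, r := r, prime_p := hpprime, prime_q := hqprime, p_inj := hpinj
      q_inj := hqinj, p_ne_q := hpq, p_ne_l := by rwa [hRl], q_ne_l := by rwa [hRl]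
      p_mod := hp4, q_mod := hq4
      p_inert := fun i => by
        rw [hRl]
        exact not_dvd_sq_sub_of_legSym hl hl4 (hpprime i) (hp4 i) (hpl i) (hpleg i)
      q_split := fun j => by
        rw [hRl]
        exact hr j
      q_euler := fun j => by
        rw [hRl]
        exact (legSym_eq_one_iff hl (hqprime j) (hql j)).mp (hqleg j) }
  have hNd : ((N.d : IntermediateField.adjoin ℚ ({Real.sqrt (l : ℝ)} : Set ℝ)) : ℝ) = n * ε₀ * Real.sqrt (l : ℝ) := by
    have hNn : N.n = n := hn.symm
    rw [N.coe_d, hNn]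
    push_cast
    rw [hRε, hRρ]
  have hkF : IntermediateField.adjoin ℚ ({Real.sqrt (l : ℝ)} : Set ℝ) ≤ IntermediateField.adjoin ℚ ({Real.sqrt ε₀} : Set ℝ) := by
    rw [IntermediateField.adjoin_simple_le_iff]
    have hmem := pow_mem (IntermediateField.mem_adjoin_simple_self ℚ (Real.sqrt ε₀)) 2
    rw [hε2] at hmem
    have hv0 : (v : ℝ) ≠ 0 := Int.cast_ne_zero.mpr hv.ne'
    have : Real.sqrt (l : ℝ) = (ε₀ - u) / v := by
      rw [he]
      field_simp
      ring
    rw [this]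
    exact div_mem (sub_mem hmem (intCast_mem _ u)) (intCast_mem _ v)
  have hkK : IntermediateField.adjoin ℚ ({Real.sqrt (l : ℝ)} : Set ℝ) ≤ K := by
    rw [IntermediateField.adjoin_simple_le_iff]
    have hmem := pow_mem (IntermediateField.mem_adjoin_simple_self ℚ (Real.sqrt (n * ε₀ * Real.sqrt (l : ℝ)))) 2
    rw [hd2, ← hK] at hmem
    have hu0 : (u : ℝ) ≠ 0 := Int.cast_ne_zero.mpr hu.ne'
    have : Real.sqrt (l : ℝ) = (n * ε₀ * Real.sqrt (l : ℝ) / n - v * l) / u := by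
      rw [he]
      field_simp
      linear_combination - (v : ℝ) * hs
    rw [this]
    exact div_mem (sub_mem (div_mem hmem (IntermediateField.natCast_mem _ n)) (mul_mem (intCast_mem _ v)
      (IntermediateField.natCast_mem _ l))) (intCast_mem _ u)
  let : Algebra (IntermediateField.adjoin ℚ ({Real.sqrt (l : ℝ)} : Set ℝ)) (IntermediateField.adjoin ℚ ({Real.sqrt ε₀} : Set ℝ)) :=
    (IntermediateField.inclusion hkF).toAlgebra
  let : Algebra (IntermediateField.adjoin ℚ ({Real.sqrt (l : ℝ)} : Set ℝ)) K := (IntermediateField.inclusion hkK).toAlgebra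
  obtain ⟨QF, hQF⟩ := exists_quadExt_adjoin
    (k := IntermediateField.adjoin ℚ ({Real.sqrt (l : ℝ)} : Set ℝ)) (L := IntermediateField.adjoin ℚ ({Real.sqrt ε₀} : Set ℝ))
    (δ := R.εk) (fun x => rfl) rfl hFint (hε2.trans hRε.symm)
    R.sq_ne_ε
  obtain ⟨Q, hQ⟩ := exists_quadExt_adjoin
    (k := IntermediateField.adjoin ℚ ({Real.sqrt (l : ℝ)} : Set ℝ)) (L := K) (δ := N.d) (fun x => rfl) hK hKint
    (hd2.trans hNd.symm) N.sq_ne_d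
  constructor
  · rintro ⟨j, hj⟩
    exact N.card_eq_of_ε_notMem Q hQ ht (N.ε_notMem_norm_range Q hQ (j := j) (by rwa [hRl]))
  · intro h
    exact N.card_eq_of_ε_mem Q hQ (N.ε_mem_norm_range QF
      (R.oddClass_sqrt_ε QF hQF (IntermediateField.adjoin ℚ ({Real.sqrt ε₀} : Set ℝ)).val) hQF Q hQ (by rwa [hRl]))
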